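/- arXiv:math-ph/0012020 — 4 statements merged into one kernel-verified Lean document; each statement's English description precedes it below -/
import Mathlib

section
/- Let τ : 𝒲 → 𝒲 be a bijection of the set of wedges in ℝ⁴ such that (i) τ ∘ τ = id, (ii) W₁ ⊆ W₂ implies τ(W₁) ⊆ τ(W₂), and (iii) if the closures of W₁ and W₂ are disjoint then τ(W₁) and τ(W₂) are disjoint. Then there exists an element g of the full Poincaré group 𝒫 (an affine map x ↦ Λx + a whose linear part Λ preserves the Minkowski form) such that τ(W₁) = g W₁ for every W₁ ∈ 𝒲. -/
noncomputable section

open Real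

/-- The Minkowski bilinear form on `ℝ⁴`. -/
def mink (x y : Fin 4 → ℝ) : ℝ := x 0 * y 0 - x 1 * y 1 - x 2 * y 2 - x 3 * y 3

/-- The right wedge `W_r = {x : |x⁰| < x¹}`. -/
def rightWedge : Set (Fin 4 → ℝ) := {x | |x 0| < x 1}

/-- The proper orthochronous Lorentz group `𝓛₊↑`, as a set of real 4×4 matrices. -/
def LorentzPO : Set (Matrix (Fin 4) (Fin 4) ℝ) :=
  {Λ | (∀ x y, mink (Λ.mulVec x) (Λ.mulVec y) = mink x y) ∧ Λ.det = 1 ∧ 0 < Λ 0 0}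

/-- The set of wedges `𝒲`: images of the right wedge under proper orthochronous
Poincaré transformations. -/
def WedgeSet : Set (Set (Fin 4 → ℝ)) :=
  {S | ∃ (Λ : Matrix (Fin 4) (Fin 4) ℝ) (a : Fin 4 → ℝ), Λ ∈ LorentzPO ∧
    S = (fun x => Λ.mulVec x + a) '' rightWedge}

/-- The causal complement of a set: the interior of the set of points spacelike to it. -/
def causalCompl (S : Set (Fin 4 → ℝ)) : Set (Fin 4 → ℝ) :=
  interior {x | ∀ y ∈ S, mink (x - y) (x - y) < 0}

/-- The open forward light cone. -/
def fwdCone : Set (Fin 4 → ℝ) := {x | 0 < x 0 ∧ 0 < mink x x}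

/-- A double cone is a set of the form `(a + V⁺) ∩ (b − V⁺)` with `b − a ∈ V⁺`. -/
def IsDoubleCone (D : Set (Fin 4 → ℝ)) : Prop :=
  ∃ a b : Fin 4 → ℝ, b - a ∈ fwdCone ∧ D = {x | x - a ∈ fwdCone ∧ b - x ∈ fwdCone}

/-- The boost group `Λ_{W_r}(t)` of the right wedge. -/
def boost (t : ℝ) : Matrix (Fin 4) (Fin 4) ℝ :=
  Matrix.of fun i j =>
    if i = 0 ∧ j = 0 then Real.cosh (2 * π * t)
    else if i = 0 ∧ j = 1 then -Real.sinh (2 * π * t)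
    else if i = 1 ∧ j = 0 then -Real.sinh (2 * π * t)
    else if i = 1 ∧ j = 1 then Real.cosh (2 * π * t)
    else if i = j then 1 else 0


lemma mink_comm (x y : Fin 4 → ℝ) : mink x y = mink y x := by unfold mink; ring
lemma mink_add_right (x y z : Fin 4 → ℝ) : mink x (y + z) = mink x y + mink x z := by
  simp only [mink, Pi.add_apply]; ring
lemma mink_add_left (x y z : Fin 4 → ℝ) : mink (x + y) z = mink x z + mink y z := by
  simp only [mink, Pi.add_apply]; ring
lemma mink_smul_right (c : ℝ) (x y : Fin 4 → ℝ) : mink x (c • y) = c * mink x y := by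
  simp only [mink, Pi.smul_apply, smul_eq_mul]; ring
lemma mink_smul_left (c : ℝ) (x y : Fin 4 → ℝ) : mink (c • x) y = c * mink x y := by
  simp only [mink, Pi.smul_apply, smul_eq_mul]; ring
lemma mink_neg_right (x y : Fin 4 → ℝ) : mink x (-y) = - mink x y := by
  simp only [mink, Pi.neg_apply]; ring
lemma mink_neg_left (x y : Fin 4 → ℝ) : mink (-x) y = - mink x y := by
  simp only [mink, Pi.neg_apply]; ring
lemma mink_zero_right (x : Fin 4 → ℝ) : mink x 0 = 0 := by simp [mink]

lemma mink_sum_right {ι : Type*} [Fintype ι] (x : Fin 4 → ℝ) (l : ι → ℝ) (a : ι → Fin 4 → ℝ) :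
    mink x (∑ i, l i • a i) = ∑ i, l i * mink x (a i) := by
  have : ∀ s : Finset ι, mink x (∑ i ∈ s, l i • a i) = ∑ i ∈ s, l i * mink x (a i) := by
    intro s
    classical
    induction s using Finset.induction_on with
    | empty => simp [mink_zero_right]
    | insert i s hi ih => rw [Finset.sum_insert hi, Finset.sum_insert hi, mink_add_right, ih, mink_smul_right]
  exact this _

/-- A theorem of the alternative for strict affine inequalities. -/
lemma farkas {ι : Type*} [Fintype ι] (a : ι → Fin 4 → ℝ) (b : ι → ℝ)
    (h : ¬ ∃ x, ∀ i, b i < mink x (a i)) :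
    ∃ l : ι → ℝ, (∀ i, 0 ≤ l i) ∧ (∃ i, l i ≠ 0) ∧ ∑ i, l i • a i = 0 ∧ 0 ≤ ∑ i, l i * b i := by
  classical
  let L : (Option ι → ℝ) →ₗ[ℝ] (Fin 4 → ℝ) × ℝ :=
    { toFun := fun w => (∑ i, w (some i) • a i, w none - ∑ i, w (some i) * b i)
      map_add' := by
        intro v w
        ext
        · simp [add_mul, Finset.sum_add_distrib]
        · simp [add_mul, Finset.sum_add_distrib]; ring
      map_smul' := by
        intro c w
        ext
        · simp [Finset.mul_sum, mul_assoc]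
        · simp [Finset.mul_sum, mul_assoc, mul_sub] }
  let K : Set ((Fin 4 → ℝ) × ℝ) := L '' stdSimplex ℝ (Option ι)
  have hKc : IsCompact K := (isCompact_stdSimplex ℝ (Option ι)).image (LinearMap.continuous_of_finiteDimensional L)
  have hKconv : Convex ℝ K := (convex_stdSimplex ℝ (Option ι)).linear_image L
  by_cases h0 : (0 : (Fin 4 → ℝ) × ℝ) ∈ K
  · obtain ⟨w, ⟨hw0, hw1⟩, hw⟩ := h0
    have e1 : ∑ i, w (some i) • a i = 0 := congrArg Prod.fst hw
    have e2 : w none - ∑ i, w (some i) * b i = 0 := congrArg Prod.snd hw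
    refine ⟨fun i => w (some i), fun i => hw0 _, ?_, e1, ?_⟩
    · by_contra hc
      push Not at hc
      rw [Fintype.sum_option] at hw1
      simp [hc] at hw1 e2
      linarith
    · have := hw0 none
      show 0 ≤ ∑ i, w (some i) * b i
      linarith
  · exfalso
    obtain ⟨f, u, hu, hf⟩ := geometric_hahn_banach_point_closed hKconv hKc.isClosed h0
    rw [map_zero] at hu
    have key : ∀ j, 0 < f (L (Pi.single j 1)) := fun j =>
      hu.trans (hf _ ⟨_, single_mem_stdSimplex ℝ j, rfl⟩)
    have Ln : L (Pi.single none 1) = (0, 1) := by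
      simp [L]
    have Ls : ∀ i, L (Pi.single (some i) 1) = (a i, - b i) := by
      intro i
      simp [L, Pi.single_apply]
    have hdec : ∀ (y : Fin 4 → ℝ) (s : ℝ), ((y, s) : (Fin 4 → ℝ) × ℝ) =
        y 0 • (Pi.single 0 1, 0) + y 1 • (Pi.single 1 1, 0) + y 2 • (Pi.single 2 1, 0)
          + y 3 • (Pi.single 3 1, 0) + s • (0, 1) := by
      intro y s
      ext i
      · fin_cases i <;> simp
      · simp
    let t := f (0, 1)
    have ht : 0 < t := by have := key none; rwa [Ln] at this
    apply h
    refine ⟨t⁻¹ • ![f (Pi.single 0 1, 0), -f (Pi.single 1 1, 0), -f (Pi.single 2 1, 0), -f (Pi.single 3 1, 0)], fun i => ?_⟩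
    have := key (some i)
    rw [Ls, hdec] at this
    simp only [map_add, map_smul, smul_eq_mul] at this
    rw [mink_smul_left, inv_mul_eq_div, lt_div_iff₀ ht]
    simp only [mink, Matrix.cons_val]
    simp only [t]
    linarith

/-- Normalized null vectors (future or past pointing). -/
def IsN (n : Fin 4 → ℝ) : Prop := (n 0) ^ 2 = 1 ∧ mink n n = 0

/-- Pairs of normalized null vectors defining a wedge. -/
def Valid (n m : Fin 4 → ℝ) : Prop := IsN n ∧ IsN m ∧ n 0 = - m 0 ∧ n ≠ -m

lemma IsN.neg {n : Fin 4 → ℝ} (h : IsN n) : IsN (-n) := by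
  refine ⟨by simpa using h.1, ?_⟩
  rw [mink_neg_left, mink_neg_right, h.2]; simp

lemma IsN.cases {n : Fin 4 → ℝ} (h : IsN n) : n 0 = 1 ∨ n 0 = -1 := sq_eq_one_iff.1 h.1

lemma Valid.symm {n m : Fin 4 → ℝ} (h : Valid n m) : Valid m n :=
  ⟨h.2.1, h.1, by linarith [h.2.2.1], fun e => h.2.2.2 (by rw [e]; simp)⟩

lemma Valid.ne {n m : Fin 4 → ℝ} (h : Valid n m) : n ≠ m := by
  rintro rfl
  have h1 := h.1.1
  have h2 := h.2.2.1
  have h3 : n 0 = 0 := by linarith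
  rw [h3] at h1; norm_num at h1

lemma Valid.neg {n m : Fin 4 → ℝ} (h : Valid n m) : Valid (-n) (-m) :=
  ⟨h.1.neg, h.2.1.neg, by simp [h.2.2.1], fun e => h.2.2.2 (neg_injective e)⟩

lemma null_key {n m : Fin 4 → ℝ} (hn : IsN n) (hm : IsN m) (h0 : n 0 = m 0) :
    2 * mink n m = (n 1 - m 1) ^ 2 + (n 2 - m 2) ^ 2 + (n 3 - m 3) ^ 2 := by
  have h1 := hn.1; have h2 := hm.1; have h3 := hn.2; have h4 := hm.2
  simp only [mink] at *
  rw [h0] at *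
  linear_combination h3 + h4

lemma null_pos {n m : Fin 4 → ℝ} (hn : IsN n) (hm : IsN m) (h0 : n 0 = m 0) (hne : n ≠ m) :
    0 < mink n m := by
  have h := null_key hn hm h0
  by_contra hc
  apply hne
  have a1 := sq_nonneg (n 1 - m 1)
  have a2 := sq_nonneg (n 2 - m 2)
  have a3 := sq_nonneg (n 3 - m 3)
  have e1 : n 1 - m 1 = 0 := pow_eq_zero_iff (two_ne_zero) |>.1 (by linarith)
  have e2 : n 2 - m 2 = 0 := pow_eq_zero_iff (two_ne_zero) |>.1 (by linarith)
  have e3 : n 3 - m 3 = 0 := pow_eq_zero_iff (two_ne_zero) |>.1 (by linarith)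
  ext i
  fin_cases i
  · exact h0
  · exact sub_eq_zero.1 e1
  · exact sub_eq_zero.1 e2
  · exact sub_eq_zero.1 e3

lemma Valid.mink_neg {n m : Fin 4 → ℝ} (h : Valid n m) : mink n m < 0 := by
  have := null_pos h.1 h.2.1.neg (by simpa using h.2.2.1) h.2.2.2
  rw [mink_neg_right] at this; linarith

/-- no nontrivial relation among two null vectors -/
lemma core2 {a c : Fin 4 → ℝ} (ha : IsN a) (hac : a 0 = c 0) (hne : a ≠ c) {s t : ℝ}
    (h : s • a = t • c) : s = 0 ∧ t = 0 := by
  have h0 := congrFun h 0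
  simp only [Pi.smul_apply, smul_eq_mul, hac] at h0
  have hc0 : c 0 ≠ 0 := by rw [← hac]; intro e; have := ha.1; simp [e] at this
  have : s = t := mul_right_cancel₀ hc0 h0
  subst this
  by_contra hs
  have hs' : s ≠ 0 := fun e => hs ⟨e, e⟩
  exact hne (smul_right_injective _ hs' h)

/-- The basic rigidity lemma: a null vector is not a positive combination of two others. -/
lemma core3 {a b c : Fin 4 → ℝ} (ha : IsN a) (hb : IsN b) (hc : IsN c) (hac : a 0 = c 0)
    (hbc : b 0 = c 0) (hne : a ≠ c) (hne' : b ≠ c) {s t r : ℝ} (hs : 0 ≤ s) (ht : 0 ≤ t)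
    (h : s • a + t • b = r • c) : s = 0 ∧ t = 0 ∧ r = 0 := by
  by_cases hs0 : s = 0
  · subst hs0
    have := core2 hb hbc hne' (s := t) (t := r) (by simpa using h)
    exact ⟨rfl, this⟩
  by_cases ht0 : t = 0
  · subst ht0
    have := core2 ha hac hne (s := s) (t := r) (by simpa using h)
    exact ⟨this.1, rfl, this.2⟩
  have hs1 : 0 < s := lt_of_le_of_ne hs (Ne.symm hs0)
  have ht1 : 0 < t := lt_of_le_of_ne ht (Ne.symm ht0)
  by_cases hab : a = b
  · subst hab
    have := core2 ha hac hne (s := s + t) (t := r) (by rw [add_smul]; exact h)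
    linarith
  · have hp := null_pos ha hb (hac.trans hbc.symm) hab
    have e : mink (s • a + t • b) (s • a + t • b) = 0 := by
      rw [h, mink_smul_left, mink_smul_right, hc.2]; simp
    simp only [mink_add_left, mink_add_right, mink_smul_left, mink_smul_right, ha.2, hb.2,
      mink_comm b a] at e
    have : 0 < s * (t * mink a b) := by positivity
    nlinarith

/-- Half spaces -/
def hs (n : Fin 4 → ℝ) (a : ℝ) : Set (Fin 4 → ℝ) := {x | a < mink x n}

/-- Wedges in terms of two null half spaces -/
def wd (n : Fin 4 → ℝ) (a : ℝ) (m : Fin 4 → ℝ) (b : ℝ) : Set (Fin 4 → ℝ) := hs n a ∩ hs m b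

lemma wd_swap (n : Fin 4 → ℝ) (a : ℝ) (m : Fin 4 → ℝ) (b : ℝ) : wd n a m b = wd m b n a :=
  Set.inter_comm _ _

/-- a wedge contained in or disjoint from a half space: key lemma -/
lemma wd_inter_hs {n m k : Fin 4 → ℝ} {a b c : ℝ} (hv : Valid n m) (hk : IsN k)
    (h : wd n a m b ∩ hs k c = ∅) : (k = -n ∧ 0 ≤ a + c) ∨ (k = -m ∧ 0 ≤ b + c) := by
  obtain ⟨l, hl0, hl1, hl2, hl3⟩ := farkas ![n, m, k] ![a, b, c] (by
    rintro ⟨x, hx⟩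
    have : x ∈ wd n a m b ∩ hs k c := ⟨⟨hx 0, hx 1⟩, hx 2⟩
    rw [h] at this; exact this)
  rw [Fin.sum_univ_three] at hl2 hl3
  simp only [Matrix.cons_val] at hl2 hl3
  -- time component sign
  have hkn : k 0 = - n 0 ∨ k 0 = - m 0 := by
    rcases hk.cases with h1 | h1 <;> rcases hv.1.cases with h2 | h2 <;> 
      have h3 := hv.2.2.1 <;> first | (left; linarith) | (right; linarith)
  have main : ∀ (n m : Fin 4 → ℝ) (a b : ℝ) (l0 l1 l2 : ℝ), Valid n m → k 0 = - n 0 → 0 ≤ l0 → 0 ≤ l1 →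
      0 ≤ l2 → (l0 ≠ 0 ∨ l1 ≠ 0 ∨ l2 ≠ 0) → l0 • n + l1 • m + l2 • k = 0 → 
      0 ≤ l0 * a + l1 * b + l2 * c → (k = -n ∧ 0 ≤ a + c) := by
    intro n m a b l0 l1 l2 hv hkn h0 h1 h2 hne hrel hin
    have hrel' : l1 • m + l2 • k = l0 • (-n) := by
      have : l1 • m + l2 • k = (l0 • n + l1 • m + l2 • k) - l0 • n := by abel
      rw [this, hrel]; simp
    by_cases hkn' : k = -n
    · subst hkn'
      have := core2 hv.2.1 (c := -n) (s := l1) (t := l0 - l2) (by simp [hv.2.2.1]) hv.symm.2.2.2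
        (by rw [sub_smul, ← hrel']; abel)
      have hl : l0 = l2 := by linarith [this.2]
      rw [this.1, ← hl] at hin
      have hpos : 0 < l0 := by
        rcases hne with h | h | h
        · exact lt_of_le_of_ne h0 (Ne.symm h)
        · exact absurd this.1 h
        · rw [hl]; exact lt_of_le_of_ne h2 (Ne.symm h)
      refine ⟨rfl, ?_⟩
      by_contra hc
      nlinarith
    · have := core3 hv.2.1 hk hv.1.neg (by simp [hv.2.2.1]) (by simpa using hkn) hv.symm.2.2.2 hkn' h1 h2 hrel'
      simp [this] at hne
  have hex : l 0 ≠ 0 ∨ l 1 ≠ 0 ∨ l 2 ≠ 0 := by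
    obtain ⟨i, hi⟩ := hl1
    fin_cases i <;> simp_all
  rcases hkn with hkn | hkn
  · left; exact main n m a b (l 0) (l 1) (l 2) hv hkn (hl0 _) (hl0 _) (hl0 _) hex hl2 hl3
  · right
    refine main m n b a (l 1) (l 0) (l 2) hv.symm hkn (hl0 _) (hl0 _) (hl0 _) (by tauto) ?_ (by linarith)
    rw [← hl2]; abel

lemma hs_disj_hs_neg {n : Fin 4 → ℝ} {a c : ℝ} (h : 0 ≤ a + c) : hs n a ∩ hs (-n) c = ∅ := by
  ext x
  simp only [hs, Set.mem_inter_iff, Set.mem_ofPred_eq, mink_neg_right, Set.mem_empty_iff_false, iff_false]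
  rintro ⟨h1, h2⟩; linarith

lemma wd_sub_hs {n m k : Fin 4 → ℝ} {a b c : ℝ} (hv : Valid n m) (hk : IsN k)
    (h : wd n a m b ⊆ hs k c) : (k = n ∧ c ≤ a) ∨ (k = m ∧ c ≤ b) := by
  have := wd_inter_hs (a := a) (b := b) (c := -c) hv hk.neg (by
    ext x
    simp only [Set.mem_inter_iff, Set.mem_empty_iff_false, iff_false]
    rintro ⟨h1, h2⟩
    have h3 := h h1
    simp only [hs, Set.mem_ofPred_eq, mink_neg_right] at h2 h3
    linarith)
  rcases this with ⟨h1, h2⟩ | ⟨h1, h2⟩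
  · left; exact ⟨neg_injective h1, by linarith⟩
  · right; exact ⟨neg_injective h1, by linarith⟩

lemma hs_mono {n : Fin 4 → ℝ} {a c : ℝ} (h : c ≤ a) : hs n a ⊆ hs n c := fun _ hx => lt_of_le_of_lt h hx

lemma wd_sub_wd {n m n' m' : Fin 4 → ℝ} {a b a' b' : ℝ} (hv : Valid n m) (hv' : Valid n' m')
    (h : wd n a m b ⊆ wd n' a' m' b') :
    (n' = n ∧ m' = m ∧ a' ≤ a ∧ b' ≤ b) ∨ (n' = m ∧ m' = n ∧ a' ≤ b ∧ b' ≤ a) := by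
  have h1 := wd_sub_hs hv hv'.1 (h.trans Set.inter_subset_left)
  have h2 := wd_sub_hs hv hv'.2.1 (h.trans Set.inter_subset_right)
  have h3 := hv'.ne
  rcases h1 with ⟨e1, l1⟩ | ⟨e1, l1⟩ <;> rcases h2 with ⟨e2, l2⟩ | ⟨e2, l2⟩
  · exact absurd (e1.trans e2.symm) h3
  · left; exact ⟨e1, e2, l1, l2⟩
  · right; exact ⟨e1, e2, l1, l2⟩
  · exact absurd (e1.trans e2.symm) h3

lemma wd_sub_iff {n m : Fin 4 → ℝ} {a b a' b' : ℝ} (hv : Valid n m) :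
    wd n a m b ⊆ wd n a' m b' ↔ a' ≤ a ∧ b' ≤ b := by
  constructor
  · intro h
    rcases wd_sub_wd hv hv h with h | h
    · exact h.2.2
    · exact absurd h.1 hv.ne
  · rintro ⟨h1, h2⟩
    exact Set.inter_subset_inter (hs_mono h1) (hs_mono h2)

lemma wd_ext {n m : Fin 4 → ℝ} {a b a' b' : ℝ} (hv : Valid n m) (h : wd n a m b = wd n a' m b') :
    a = a' ∧ b = b' := by
  have h1 := (wd_sub_iff hv).1 h.le
  have h2 := (wd_sub_iff hv).1 h.ge
  exact ⟨le_antisymm h2.1 h1.1, le_antisymm h2.2 h1.2⟩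


/-- in `ℝ³` two vectors have a common unit normal -/
lemma exists_perp (u1 u2 u3 v1 v2 v3 : ℝ) : ∃ w1 w2 w3 : ℝ, w1 ^ 2 + w2 ^ 2 + w3 ^ 2 = 1 ∧
    w1 * u1 + w2 * u2 + w3 * u3 = 0 ∧ w1 * v1 + w2 * v2 + w3 * v3 = 0 := by
  let A : Matrix (Fin 3) (Fin 3) ℝ := !![u1, u2, u3; v1, v2, v3; 0, 0, 0]
  have hA : A.det = 0 := by simp [A, Matrix.det_fin_three]
  obtain ⟨w, hw, hw0⟩ := Matrix.exists_mulVec_eq_zero_iff.2 hA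
  have e1 := congrFun hw0 0
  have e2 := congrFun hw0 1
  simp [A, Matrix.mulVec, dotProduct, Fin.sum_univ_three] at e1 e2
  have hpos : 0 < w 0 ^ 2 + w 1 ^ 2 + w 2 ^ 2 := by
    by_contra hc
    apply hw
    have a1 := sq_nonneg (w 0)
    have a2 := sq_nonneg (w 1)
    have a3 := sq_nonneg (w 2)
    have b1 : w 0 = 0 := pow_eq_zero_iff (two_ne_zero) |>.1 (by linarith)
    have b2 : w 1 = 0 := pow_eq_zero_iff (two_ne_zero) |>.1 (by linarith)
    have b3 : w 2 = 0 := pow_eq_zero_iff (two_ne_zero) |>.1 (by linarith)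
    ext i
    fin_cases i
    · exact b1
    · exact b2
    · exact b3
  obtain ⟨r, hr, hr2⟩ : ∃ r : ℝ, 0 < r ∧ r ^ 2 = w 0 ^ 2 + w 1 ^ 2 + w 2 ^ 2 :=
    ⟨_, Real.sqrt_pos.2 hpos, Real.sq_sqrt hpos.le⟩
  refine ⟨w 0 / r, w 1 / r, w 2 / r, ?_, ?_, ?_⟩
  · field_simp; linarith
  · field_simp; linarith
  · field_simp; linarith

/-- matrices preserving the form have square of determinant one -/
lemma det_sq (Λ : Matrix (Fin 4) (Fin 4) ℝ)
    (h : ∀ x y, mink (Λ.mulVec x) (Λ.mulVec y) = mink x y) :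
    Λ.transpose * Matrix.diagonal ![1, -1, -1, -1] * Λ = Matrix.diagonal ![1, -1, -1, -1] := by
  ext i j
  have := h (Pi.single i 1) (Pi.single j 1)
  simp only [Matrix.mulVec_single_one, mink, Matrix.col_apply] at this
  rw [Matrix.mul_apply, Fin.sum_univ_four]
  simp only [Matrix.mul_diagonal, Matrix.transpose_apply, Matrix.cons_val]
  have e : (Matrix.diagonal ![1, -1, -1, -1] : Matrix (Fin 4) (Fin 4) ℝ) i j = 
    (Pi.single i 1 : Fin 4 → ℝ) 0 * (Pi.single j 1 : Fin 4 → ℝ) 0 - (Pi.single i 1 : Fin 4 → ℝ) 1 * (Pi.single j 1 : Fin 4 → ℝ) 1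
    - (Pi.single i 1 : Fin 4 → ℝ) 2 * (Pi.single j 1 : Fin 4 → ℝ) 2 - (Pi.single i 1 : Fin 4 → ℝ) 3 * (Pi.single j 1 : Fin 4 → ℝ) 3 := by
    fin_cases i <;> fin_cases j <;> simp
  rw [e, ← this]; ring

lemma det_pm (Λ : Matrix (Fin 4) (Fin 4) ℝ)
    (h : ∀ x y, mink (Λ.mulVec x) (Λ.mulVec y) = mink x y) : Λ.det = 1 ∨ Λ.det = -1 := by
  have := congrArg Matrix.det (det_sq Λ h)
  rw [Matrix.det_mul, Matrix.det_mul, Matrix.det_transpose] at this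
  have hd : (Matrix.diagonal ![1, -1, -1, -1] : Matrix (Fin 4) (Fin 4) ℝ).det = -1 := by
    simp [Matrix.det_diagonal, Fin.prod_univ_four]
  rw [hd] at this
  apply sq_eq_one_iff.1; nlinarith

/-- matrix with prescribed orthonormal columns -/
lemma cols_lorentz (e : Fin 4 → Fin 4 → ℝ)
    (h00 : mink (e 0) (e 0) = 1) (h11 : mink (e 1) (e 1) = -1) (h22 : mink (e 2) (e 2) = -1)
    (h33 : mink (e 3) (e 3) = -1) (h01 : mink (e 0) (e 1) = 0) (h02 : mink (e 0) (e 2) = 0)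
    (h03 : mink (e 0) (e 3) = 0) (h12 : mink (e 1) (e 2) = 0) (h13 : mink (e 1) (e 3) = 0)
    (h23 : mink (e 2) (e 3) = 0) (x y : Fin 4 → ℝ) :
    mink ((Matrix.of fun i j => e j i).mulVec x) ((Matrix.of fun i j => e j i).mulVec y) = mink x y := by
  have hm : ∀ x : Fin 4 → ℝ, (Matrix.of fun i j => e j i).mulVec x =
      x 0 • e 0 + x 1 • e 1 + x 2 • e 2 + x 3 • e 3 := by
    intro x
    ext i
    simp [Matrix.mulVec, dotProduct, Fin.sum_univ_four]; ring
  rw [hm, hm]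
  simp only [mink_add_left, mink_add_right, mink_smul_left, mink_smul_right, h00, h11, h22, h33, h01, h02,
    h03, h12, h13, h23, mink_comm (e 1) (e 0), mink_comm (e 2) (e 0), mink_comm (e 3) (e 0),
    mink_comm (e 2) (e 1), mink_comm (e 3) (e 1), mink_comm (e 3) (e 2)]
  simp only [mink]; ring


lemma frame_norm (u1 u2 u3 v1 v2 v3 w1 w2 w3 : ℝ) (hw : w1 ^ 2 + w2 ^ 2 + w3 ^ 2 = 1)
    (hu : w1 * u1 + w2 * u2 + w3 * u3 = 0) (hv : w1 * v1 + w2 * v2 + w3 * v3 = 0)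
    (hu1 : u1 ^ 2 + u2 ^ 2 + u3 ^ 2 = 1) (hv1 : v1 ^ 2 + v2 ^ 2 + v3 ^ 2 = 1) :
    (w1 * (u2 * v3 - u3 * v2) + w2 * (u3 * v1 - u1 * v3) + w3 * (u1 * v2 - u2 * v1)) ^ 2
      - (w2 * (u3 - v3) - w3 * (u2 - v2)) ^ 2 - (w3 * (u1 - v1) - w1 * (u3 - v3)) ^ 2
      - (w1 * (u2 - v2) - w2 * (u1 - v1)) ^ 2 = - (1 - (u1 * v1 + u2 * v2 + u3 * v3)) ^ 2 := by
  have e1 : (w1 * (u2 * v3 - u3 * v2) + w2 * (u3 * v1 - u1 * v3) + w3 * (u1 * v2 - u2 * v1)) ^ 2 =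
    (w1 ^ 2 + w2 ^ 2 + w3 ^ 2) * ((u1 ^ 2 + u2 ^ 2 + u3 ^ 2) * (v1 ^ 2 + v2 ^ 2 + v3 ^ 2) - (u1 * v1 + u2 * v2 + u3 * v3) ^ 2)
    - ((u1 * (w1 * v1 + w2 * v2 + w3 * v3) - v1 * (w1 * u1 + w2 * u2 + w3 * u3)) ^ 2
      + (u2 * (w1 * v1 + w2 * v2 + w3 * v3) - v2 * (w1 * u1 + w2 * u2 + w3 * u3)) ^ 2
      + (u3 * (w1 * v1 + w2 * v2 + w3 * v3) - v3 * (w1 * u1 + w2 * u2 + w3 * u3)) ^ 2) := by ring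
  have e2 : (w2 * (u3 - v3) - w3 * (u2 - v2)) ^ 2 + (w3 * (u1 - v1) - w1 * (u3 - v3)) ^ 2
      + (w1 * (u2 - v2) - w2 * (u1 - v1)) ^ 2 = (w1 ^ 2 + w2 ^ 2 + w3 ^ 2) *
      ((u1 ^ 2 + u2 ^ 2 + u3 ^ 2) + (v1 ^ 2 + v2 ^ 2 + v3 ^ 2) - 2 * (u1 * v1 + u2 * v2 + u3 * v3))
      - ((w1 * u1 + w2 * u2 + w3 * u3) - (w1 * v1 + w2 * v2 + w3 * v3)) ^ 2 := by ring
  rw [hw, hu, hv, hu1, hv1] at e1 e2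
  linear_combination e1 - e2

/-- Completing two null directions to a Lorentz matrix -/
lemma exists_lorentz {l k : Fin 4 → ℝ} (hl : IsN l) (hk : IsN k) (hl0 : l 0 = 1) (hk0 : k 0 = 1)
    (hne : l ≠ k) : ∃ Λ ∈ LorentzPO, ∃ s : ℝ, 0 < s ∧ Λ.mulVec ![1, 1, 0, 0] = s • l ∧
      Λ.mulVec ![1, -1, 0, 0] = s • k := by
  have hpos := null_pos hl hk (by rw [hl0, hk0]) hne
  have hl2 := hl.2
  have hk2 := hk.2
  obtain ⟨w1, w2, w3, hw, hwl, hwk⟩ := exists_perp (l 1) (l 2) (l 3) (k 1) (k 2) (k 3)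
  set c := mink l k with hc
  obtain ⟨r, hr, hr2⟩ : ∃ r : ℝ, 0 < r ∧ r ^ 2 = 2 * c :=
    ⟨_, Real.sqrt_pos.2 (by positivity), Real.sq_sqrt (by positivity)⟩
  let β := w1 * (l 2 * k 3 - l 3 * k 2) + w2 * (l 3 * k 1 - l 1 * k 3) + w3 * (l 1 * k 2 - l 2 * k 1)
  set z : Fin 4 → ℝ := ![β, w2 * (l 3 - k 3) - w3 * (l 2 - k 2), w3 * (l 1 - k 1) - w1 * (l 3 - k 3),
          w1 * (l 2 - k 2) - w2 * (l 1 - k 1)] with hz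
  have gen : ∀ σ : ℝ, σ ^ 2 = 1 → ∃ Λ : Matrix (Fin 4) (Fin 4) ℝ, 
      Λ = Matrix.of (fun i j => (![(1 / r) • (l + k), (1 / r) • (l - k), ![0, w1, w2, w3],
        (σ / c) • z] : Fin 4 → Fin 4 → ℝ) j i) ∧
      ∀ x y, mink (Λ.mulVec x) (Λ.mulVec y) = mink x y := by
    intro σ hσ
    have hzz : mink z z = - c ^ 2 := by
      have := frame_norm (l 1) (l 2) (l 3) (k 1) (k 2) (k 3) w1 w2 w3 hw hwl hwk
        (by simp only [mink, hl0] at hl2; linarith) (by simp only [mink, hk0] at hk2; linarith)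
      simp only [z, mink, Matrix.cons_val, hc, hl0, hk0, β]
      linear_combination this
    have hlz : mink l z = 0 := by
      simp only [z, mink, Matrix.cons_val, hl0, β]; ring
    have hkz : mink k z = 0 := by
      simp only [z, mink, Matrix.cons_val, hk0, β]; ring
    have hwz : mink ![0, w1, w2, w3] z = 0 := by
      simp only [z, mink, Matrix.cons_val, β]; ring
    clear_value z
    refine ⟨_, rfl, cols_lorentz _ ?_ ?_ ?_ ?_ ?_ ?_ ?_ ?_ ?_ ?_⟩
    all_goals simp only [Matrix.cons_val, mink_smul_left, mink_smul_right, sub_eq_add_neg, mink_add_left, mink_add_right, mink_neg_left,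
      mink_neg_right, hl2, hk2, mink_comm k l, ← hc, hzz, hlz, hkz, hwz]
    · field_simp; linarith
    · field_simp; linarith
    · simp [mink]; linarith
    · field_simp; linarith
    · ring
    · simp [mink]; right; linarith
    · simp
    · simp [mink]; right; linarith
    · simp
    · simp
  obtain ⟨Λ, σ, hdet, hΛ, hL⟩ : ∃ (Λ : Matrix (Fin 4) (Fin 4) ℝ) (σ : ℝ), Λ.det = 1 ∧ 
      Λ = Matrix.of (fun i j => (![(1 / r) • (l + k), (1 / r) • (l - k), ![0, w1, w2, w3],
        (σ / c) • z] : Fin 4 → Fin 4 → ℝ) j i) ∧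
      ∀ x y, mink (Λ.mulVec x) (Λ.mulVec y) = mink x y := by
    obtain ⟨Λ1, h1, hL1⟩ := gen 1 (by norm_num)
    obtain ⟨Λ2, h2, hL2⟩ := gen (-1) (by norm_num)
    have h12 : Λ2 = Λ1 * Matrix.diagonal ![1, 1, 1, -1] := by
      rw [h1, h2]
      ext i j
      rw [Matrix.mul_diagonal]
      fin_cases j <;> simp
      ring
    have hd : (Matrix.diagonal ![1, 1, 1, -1] : Matrix (Fin 4) (Fin 4) ℝ).det = -1 := by
      simp [Matrix.det_diagonal, Fin.prod_univ_four]
    rcases det_pm Λ1 hL1 with h | h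
    · exact ⟨Λ1, 1, h, h1, hL1⟩
    · refine ⟨Λ2, -1, ?_, h2, hL2⟩
      rw [h12, Matrix.det_mul, hd, h]; norm_num
  refine ⟨Λ, ⟨hL, hdet, ?_⟩, 2 / r, by positivity, ?_, ?_⟩
  · rw [hΛ]; simp [hl0, hk0]; positivity
  · rw [hΛ]; ext i; simp [Matrix.mulVec, dotProduct, Fin.sum_univ_four]; ring
  · rw [hΛ]; ext i; simp [Matrix.mulVec, dotProduct, Fin.sum_univ_four]; ring

lemma mink_nondeg {v : Fin 4 → ℝ} (h : ∀ y, mink v y = 0) : v = 0 := by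
  ext i
  have := h (Pi.single i 1)
  fin_cases i <;> simpa [mink] using this

/-- Lorentz matrices are invertible, and the image of a half space is a half space. -/
lemma lorentz_surj {Λ : Matrix (Fin 4) (Fin 4) ℝ} (hd : Λ.det ≠ 0) (x : Fin 4 → ℝ) :
    ∃ y, Λ.mulVec y = x :=
  Matrix.mulVec_surjective_iff_isUnit.2 ((Matrix.isUnit_iff_isUnit_det _).2 (isUnit_iff_ne_zero.2 hd)) x

lemma rightWedge_eq : rightWedge = {x | mink x ![1, 1, 0, 0] < 0 ∧ 0 < mink x ![1, -1, 0, 0]} := by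
  ext x
  simp only [rightWedge, Set.mem_ofPred_eq, abs_lt, mink, Matrix.cons_val]
  constructor <;> rintro ⟨h1, h2⟩ <;> constructor <;> linarith

lemma image_rightWedge {Λ : Matrix (Fin 4) (Fin 4) ℝ} (hd : Λ.det ≠ 0)
    (h : ∀ x y, mink (Λ.mulVec x) (Λ.mulVec y) = mink x y) (a : Fin 4 → ℝ) :
    (fun x => Λ.mulVec x + a) '' rightWedge = {x | mink x (Λ.mulVec ![1, 1, 0, 0]) < mink a (Λ.mulVec ![1, 1, 0, 0]) ∧
      mink a (Λ.mulVec ![1, -1, 0, 0]) < mink x (Λ.mulVec ![1, -1, 0, 0])} := by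
  rw [rightWedge_eq]
  ext x
  simp only [Set.mem_image, Set.mem_ofPred_eq]
  constructor
  · rintro ⟨y, ⟨h1, h2⟩, rfl⟩
    rw [mink_add_left, mink_add_left, h, h]
    constructor <;> linarith
  · rintro ⟨h1, h2⟩
    obtain ⟨y, hy⟩ := lorentz_surj hd (x - a)
    have hx : x = Λ.mulVec y + a := by rw [hy]; simp
    subst hx
    rw [mink_add_left, h] at h1 h2
    exact ⟨y, ⟨by linarith, by linarith⟩, rfl⟩

lemma lorentz_future {Λ : Matrix (Fin 4) (Fin 4) ℝ} (hΛ : Λ ∈ LorentzPO) :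
    0 < (Λ.mulVec ![1, 1, 0, 0]) 0 ∧ 0 < (Λ.mulVec ![1, -1, 0, 0]) 0 := by
  obtain ⟨h, hd, h0⟩ := hΛ
  have key := det_sq Λ h
  set η : Matrix (Fin 4) (Fin 4) ℝ := Matrix.diagonal ![1, -1, -1, -1] with hη
  have hηη : η * η = 1 := by
    rw [hη, Matrix.diagonal_mul_diagonal, ← Matrix.diagonal_one]
    congr 1; ext i; fin_cases i <;> simp
  have h1 : (η * Λ.transpose * η) * Λ = 1 := by
    rw [Matrix.mul_assoc, Matrix.mul_assoc, ← Matrix.mul_assoc _ η Λ, key, hηη]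
  have h2 : Λ * (η * Λ.transpose * η) = 1 := mul_eq_one_comm.1 h1
  have h3 := congrFun (congrFun h2 0) 0
  rw [Matrix.mul_apply, Fin.sum_univ_four] at h3
  simp only [hη, Matrix.mul_diagonal, Matrix.diagonal_mul, Matrix.transpose_apply, Matrix.cons_val, Matrix.one_apply_eq] at h3
  have : |Λ 0 1| < Λ 0 0 := by
    apply abs_lt_of_sq_lt_sq _ h0.le
    nlinarith [sq_nonneg (Λ 0 2), sq_nonneg (Λ 0 3)]
  rw [abs_lt] at this
  simp only [Matrix.mulVec, dotProduct, Fin.sum_univ_four, Matrix.cons_val]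
  constructor <;> linarith

lemma hs_scale {n : Fin 4 → ℝ} {s a : ℝ} (hs0 : 0 < s) : hs (s • n) (s * a) = hs n a := by
  ext x
  simp only [hs, Set.mem_ofPred_eq, mink_smul_right]
  exact mul_lt_mul_iff_right₀ hs0

lemma wedge_iff (S : Set (Fin 4 → ℝ)) : S ∈ WedgeSet ↔ ∃ n a m b, Valid n m ∧ S = wd n a m b := by
  constructor
  · rintro ⟨Λ, v, hΛ, rfl⟩
    have hf := lorentz_future hΛ
    obtain ⟨h, hd, h0⟩ := hΛ
    rw [image_rightWedge (by rw [hd]; norm_num) h]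
    have e1 := h ![1, 1, 0, 0] ![1, 1, 0, 0]
    have e2 := h ![1, -1, 0, 0] ![1, -1, 0, 0]
    have e3 := h ![1, 1, 0, 0] ![1, -1, 0, 0]
    set p := Λ.mulVec ![1, 1, 0, 0]
    set q := Λ.mulVec ![1, -1, 0, 0]
    simp [mink] at e1 e2 e3
    refine ⟨-((p 0)⁻¹ • p), -((p 0)⁻¹ * mink v p), (q 0)⁻¹ • q, (q 0)⁻¹ * mink v q, ⟨⟨?_, ?_⟩, ⟨?_, ?_⟩, ?_, ?_⟩, ?_⟩
    · have := hf.1.ne'; simp; field_simp; simp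
    · rw [mink_neg_left, mink_neg_right, mink_smul_left, mink_smul_right]; simp [mink, e1]
    · have := hf.2.ne'; simp; field_simp; simp
    · rw [mink_smul_left, mink_smul_right]; simp [mink, e2]
    · have := hf.1.ne'; have := hf.2.ne'; simp; field_simp
    · intro e
      have e' := neg_injective e
      have : mink ((p 0)⁻¹ • p) ((q 0)⁻¹ • q) = 0 := by
        rw [e', mink_smul_left, mink_smul_right]; simp [mink, e2]
      rw [mink_smul_left, mink_smul_right] at this
      have h4 : mink p q = 2 := by simp [mink]; linarith
      rw [h4] at this
      have := hf.1; have := hf.2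
      have : 0 < (p 0)⁻¹ * ((q 0)⁻¹ * 2) := by positivity
      linarith
    · rw [← smul_neg, ← mul_neg, wd, hs_scale (inv_pos.2 hf.1), hs_scale (inv_pos.2 hf.2)]
      ext x
      simp only [hs, Set.mem_ofPred_eq, Set.mem_inter_iff, mink_neg_right, neg_lt_neg_iff]
  · have main : ∀ n a m b, Valid n m → m 0 = 1 → wd n a m b ∈ WedgeSet := by
      intro n a m b hv hm
      obtain ⟨Λ, hΛ, s, hs0, h1, h2⟩ := exists_lorentz hv.1.neg hv.2.1 (by simp [hv.2.2.1, hm]) hm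
        (fun e => hv.2.2.2 (by rw [← e]; simp))
      have hlt := hv.mink_neg
      have hne := hlt.ne
      refine ⟨Λ, (b / mink n m) • n + (a / mink n m) • m, hΛ, ?_⟩
      rw [image_rightWedge (by rw [hΛ.2.1]; norm_num) hΛ.1, h1, h2]
      ext x
      simp only [wd, hs, Set.mem_ofPred_eq, Set.mem_inter_iff, mink_neg_right, mink_smul_right, mink_add_left, mink_smul_left,
        hv.1.2, hv.2.1.2, mink_comm m n, mul_lt_mul_iff_right₀ hs0]
      simp [hne]
    rintro ⟨n, a, m, b, hv, rfl⟩
    rcases hv.2.1.cases with hm | hm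
    · exact main n a m b hv hm
    · rw [wd_swap]; exact main m b n a hv.symm (by rw [hv.2.2.1, hm]; norm_num)


/-- order automorphisms of the plane -/
lemma plane_order (θ : ℝ × ℝ → ℝ × ℝ) (hle : ∀ x y, θ x ≤ θ y ↔ x ≤ y) (hsurj : Function.Surjective θ) :
    ∃ P Q : ℝ → ℝ, (StrictMono P ∧ Function.Surjective P) ∧ (StrictMono Q ∧ Function.Surjective Q) ∧
      ((∀ a b, θ (a, b) = (P a, Q b)) ∨ (∀ a b, θ (a, b) = (Q b, P a))) := by
  have hinj : Function.Injective θ := fun x y h =>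
    le_antisymm ((hle _ _).1 h.le) ((hle _ _).1 h.ge)
  -- comparable points with a common coordinate
  have edge : ∀ x y : ℝ × ℝ, x ≤ y → (x.1 = y.1 ∨ x.2 = y.2) → 
      ((θ x).1 = (θ y).1 ∨ (θ x).2 = (θ y).2) := by
    intro x y hxy hc
    by_contra hn
    push Not at hn
    have hθ := (hle x y).2 hxy
    obtain ⟨u, hu⟩ := hsurj ((θ x).1, (θ y).2)
    obtain ⟨v, hv⟩ := hsurj ((θ y).1, (θ x).2)
    have h1 : (θ x).1 < (θ y).1 := lt_of_le_of_ne hθ.1 hn.1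
    have h2 : (θ x).2 < (θ y).2 := lt_of_le_of_ne hθ.2 hn.2
    have xu : x ≤ u := (hle _ _).1 (by rw [hu]; exact ⟨le_rfl, h2.le⟩)
    have uy : u ≤ y := (hle _ _).1 (by rw [hu]; exact ⟨h1.le, le_rfl⟩)
    have xv : x ≤ v := (hle _ _).1 (by rw [hv]; exact ⟨h1.le, le_rfl⟩)
    have vy : v ≤ y := (hle _ _).1 (by rw [hv]; exact ⟨le_rfl, h2.le⟩)
    have nuv : ¬ u ≤ v := fun h => by
      have := (hle _ _).2 h; rw [hu, hv] at this; exact absurd this.2 (not_le.2 h2)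
    have nvu : ¬ v ≤ u := fun h => by
      have := (hle _ _).2 h; rw [hu, hv] at this; exact absurd this.1 (not_le.2 h1)
    rcases hc with hc | hc
    · have e1 : u.1 = v.1 := le_antisymm (by linarith [uy.1, xv.1]) (by linarith [vy.1, xu.1])
      rcases le_total u.2 v.2 with h | h
      · exact nuv ⟨e1.le, h⟩
      · exact nvu ⟨e1.ge, h⟩
    · have e1 : u.2 = v.2 := le_antisymm (by linarith [uy.2, xv.2]) (by linarith [vy.2, xu.2])
      rcases le_total u.1 v.1 with h | h
      · exact nuv ⟨h, e1.le⟩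
      · exact nvu ⟨h, e1.ge⟩
  have edgeV : ∀ a b b', (θ (a, b)).1 = (θ (a, b')).1 ∨ (θ (a, b)).2 = (θ (a, b')).2 := by
    intro a b b'
    rcases le_total b b' with h | h
    · exact edge (a, b) (a, b') ⟨le_rfl, h⟩ (Or.inl rfl)
    · have := edge (a, b') (a, b) ⟨le_rfl, h⟩ (Or.inl rfl)
      exact this.imp Eq.symm Eq.symm
  have edgeH : ∀ b a a', (θ (a, b)).1 = (θ (a', b)).1 ∨ (θ (a, b)).2 = (θ (a', b)).2 := by
    intro b a a'
    rcases le_total a a' with h | h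
    · exact edge (a, b) (a', b) ⟨h, le_rfl⟩ (Or.inr rfl)
    · have := edge (a', b) (a, b) ⟨h, le_rfl⟩ (Or.inr rfl)
      exact this.imp Eq.symm Eq.symm
  -- a family of points sharing coordinates pairwise lies on a line
  have line : ∀ g : ℝ → ℝ × ℝ, (∀ s t, (g s).1 = (g t).1 ∨ (g s).2 = (g t).2) →
      (∀ s t, (g s).1 = (g t).1) ∨ (∀ s t, (g s).2 = (g t).2) := by
    intro g hg
    by_cases h : ∀ s t, (g s).1 = (g t).1
    · exact Or.inl h
    · right
      push Not at h
      obtain ⟨s0, t0, h0⟩ := h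
      have h1 := (hg s0 t0).resolve_left h0
      have : ∀ s, (g s).2 = (g s0).2 := by
        intro s
        rcases hg s s0 with h2 | h2
        · rcases hg s t0 with h3 | h3
          · exact absurd (h2.symm.trans h3) h0
          · rw [h3, h1]
        · exact h2
      intro s t; rw [this s, this t]
  -- lines of the two kinds cannot be mixed
  have mix : ∀ g k : ℝ → ℝ × ℝ, Function.Injective g → Function.Injective k →
      (∀ s, (g s).1 = (k s).1 ∨ (g s).2 = (k s).2) → (∀ s t, (g s).1 = (g t).1) → (∀ s t, (k s).2 = (k t).2) → False := by
    intro g k hg hk h h1 h2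
    have A : ∀ s t, (g s).2 = (g t).2 → s = t := fun s t e => hg (Prod.ext (h1 s t) e)
    have B : ∀ s t, (k s).1 = (k t).1 → s = t := fun s t e => hk (Prod.ext e (h2 s t))
    have pig : ∀ s t, s ≠ t → (g s).1 = (k s).1 → (g t).1 = (k t).1 → False := by
      intro s t hst e1 e2
      exact hst (B s t (by rw [← e1, ← e2, h1 s t]))
    have pig' : ∀ s t, s ≠ t → (g s).2 = (k s).2 → (g t).2 = (k t).2 → False := by
      intro s t hst e1 e2
      exact hst (A s t (by rw [e1, e2, h2 s t]))
    have n01 : (0:ℝ) ≠ 1 := by norm_num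
    have n02 : (0:ℝ) ≠ 2 := by norm_num
    have n12 : (1:ℝ) ≠ 2 := by norm_num
    rcases h 0 with e0 | e0 <;> rcases h 1 with e1 | e1 <;> rcases h 2 with e2 | e2
    · exact pig _ _ n01 e0 e1
    · exact pig _ _ n01 e0 e1
    · exact pig _ _ n02 e0 e2
    · exact pig' _ _ n12 e1 e2
    · exact pig _ _ n12 e1 e2
    · exact pig' _ _ n02 e0 e2
    · exact pig' _ _ n01 e0 e1
    · exact pig' _ _ n01 e0 e1
  have injV : ∀ a, Function.Injective (fun b => θ (a, b)) := fun a b b' h => by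
    have := hinj h; simpa using this
  have injH : ∀ b, Function.Injective (fun a => θ (a, b)) := fun a b b' h => by
    have := hinj h; simpa using this
  have V : (∀ a b b', (θ (a, b)).1 = (θ (a, b')).1) ∨ (∀ a b b', (θ (a, b)).2 = (θ (a, b')).2) := by
    rcases line (fun b => θ (0, b)) (edgeV 0) with h | h
    · left
      intro a
      rcases line (fun b => θ (a, b)) (edgeV a) with h' | h'
      · exact h'
      · exact (mix _ _ (injV 0) (injV a) (fun s => edgeH s 0 a) h h').elim
    · right
      intro a
      rcases line (fun b => θ (a, b)) (edgeV a) with h' | h'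
      · exact (mix _ _ (injV a) (injV 0) (fun s => edgeH s a 0) h' h).elim
      · exact h'
  have H : (∀ b a a', (θ (a, b)).1 = (θ (a', b)).1) ∨ (∀ b a a', (θ (a, b)).2 = (θ (a', b)).2) := by
    rcases line (fun b => θ (b, 0)) (edgeH 0) with h | h
    · left
      intro a
      rcases line (fun b => θ (b, a)) (edgeH a) with h' | h'
      · exact h'
      · exact (mix _ _ (injH 0) (injH a) (fun s => edgeV s 0 a) h h').elim
    · right
      intro a
      rcases line (fun b => θ (b, a)) (edgeH a) with h' | h'
      · exact (mix _ _ (injH a) (injH 0) (fun s => edgeV s a 0) h' h).elim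
      · exact h'
  have smono : ∀ P : ℝ → ℝ, (∀ a b, P a ≤ P b ↔ a ≤ b) → StrictMono P := by
    intro P h a b hab
    rw [← not_le, h]; exact not_le.2 hab
  rcases V with V | V <;> rcases H with H | H
  · exfalso
    obtain ⟨x, hx⟩ := hsurj ((θ (0, 0)).1 + 1, 0)
    have h1 : (θ (x.1, x.2)).1 = (θ (0, 0)).1 := (V _ _ 0).trans (H _ _ _)
    rw [Prod.mk.eta, hx] at h1
    simp at h1
  · have e : ∀ a b, θ (a, b) = ((θ (a, 0)).1, (θ (0, b)).2) := fun a b => Prod.ext (V a b 0) (H b a 0)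
    refine ⟨fun a => (θ (a, 0)).1, fun b => (θ (0, b)).2, ⟨smono _ ?_, ?_⟩, ⟨smono _ ?_, ?_⟩, Or.inl e⟩
    · intro a b
      have := hle (a, 0) (b, 0)
      rw [e a, e b] at this
      simpa using this
    · intro y
      obtain ⟨x, hx⟩ := hsurj (y, 0)
      exact ⟨x.1, by have := e x.1 x.2; rw [Prod.mk.eta, hx] at this; exact (congrArg Prod.fst this).symm⟩
    · intro a b
      have := hle (0, a) (0, b)
      rw [e 0 a, e 0 b] at this
      simpa using this
    · intro y
      obtain ⟨x, hx⟩ := hsurj (0, y)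
      exact ⟨x.2, by have := e x.1 x.2; rw [Prod.mk.eta, hx] at this; exact (congrArg Prod.snd this).symm⟩
  · have e : ∀ a b, θ (a, b) = ((θ (0, b)).1, (θ (a, 0)).2) := fun a b => Prod.ext (H b a 0) (V a b 0)
    refine ⟨fun a => (θ (a, 0)).2, fun b => (θ (0, b)).1, ⟨smono _ ?_, ?_⟩, ⟨smono _ ?_, ?_⟩, Or.inr e⟩
    · intro a b
      have := hle (a, 0) (b, 0)
      rw [e a, e b] at this
      simpa using this
    · intro y
      obtain ⟨x, hx⟩ := hsurj (0, y)
      exact ⟨x.1, by have := e x.1 x.2; rw [Prod.mk.eta, hx] at this; exact (congrArg Prod.snd this).symm⟩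
    · intro a b
      have := hle (0, a) (0, b)
      rw [e 0 a, e 0 b] at this
      simpa using this
    · intro y
      obtain ⟨x, hx⟩ := hsurj (y, 0)
      exact ⟨x.2, by have := e x.1 x.2; rw [Prod.mk.eta, hx] at this; exact (congrArg Prod.fst this).symm⟩
  · exfalso
    obtain ⟨x, hx⟩ := hsurj (0, (θ (0, 0)).2 + 1)
    have h1 : (θ (x.1, x.2)).2 = (θ (0, 0)).2 := (V _ _ 0).trans (H _ _ _)
    rw [Prod.mk.eta, hx] at h1
    simp at h1

/-- The assumptions on `τ`, in terms of `wd`. -/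
structure Good (τ : Set (Fin 4 → ℝ) → Set (Fin 4 → ℝ)) : Prop where
  maps : ∀ {n m : Fin 4 → ℝ} (a b : ℝ), Valid n m → ∃ n' a' m' b', Valid n' m' ∧ τ (wd n a m b) = wd n' a' m' b'
  invol : ∀ {n m : Fin 4 → ℝ} (a b : ℝ), Valid n m → τ (τ (wd n a m b)) = wd n a m b
  mono : ∀ {n m n' m' : Fin 4 → ℝ} {a b a' b' : ℝ}, Valid n m → Valid n' m' → 
    wd n a m b ⊆ wd n' a' m' b' → τ (wd n a m b) ⊆ τ (wd n' a' m' b')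
  disj : ∀ {n m n' m' : Fin 4 → ℝ} {a b a' b' : ℝ}, Valid n m → Valid n' m' → 
    closure (wd n a m b) ∩ closure (wd n' a' m' b') = ∅ → τ (wd n a m b) ∩ τ (wd n' a' m' b') = ∅

/-- monotone bijections of the line -/
def Mono (P : ℝ → ℝ) : Prop := StrictMono P ∧ Function.Surjective P

lemma cell_stay {τ} (hτ : Good τ) {n m n' m' : Fin 4 → ℝ} {a b a' b' : ℝ} (hv : Valid n m) (hv' : Valid n' m')
    (h : τ (wd n a m b) = wd n' a' m' b') (a1 b1 : ℝ) : ∃ a2 b2, τ (wd n a1 m b1) = wd n' a2 m' b2 := by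
  obtain ⟨p, c, q, d, hpq, e⟩ := hτ.maps a1 b1 hv
  obtain ⟨p', c', q', d', hpq', e'⟩ := hτ.maps (max a a1) (max b b1) hv
  have s1 := hτ.mono hv hv ((wd_sub_iff hv).2 ⟨le_max_left a a1, le_max_left b b1⟩)
  have s2 := hτ.mono hv hv ((wd_sub_iff hv).2 ⟨le_max_right a a1, le_max_right b b1⟩)
  rw [e', h] at s1
  rw [e', e] at s2
  rcases wd_sub_wd hpq' hv' s1 with ⟨h1, h2, -, -⟩ | ⟨h1, h2, -, -⟩ <;>
    rcases wd_sub_wd hpq' hpq s2 with ⟨h3, h4, -, -⟩ | ⟨h3, h4, -, -⟩ <;> subst h1 h2 h3 h4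
  · exact ⟨_, _, e⟩
  · exact ⟨_, _, e.trans (wd_swap _ _ _ _)⟩
  · exact ⟨_, _, e.trans (wd_swap _ _ _ _)⟩
  · exact ⟨_, _, e⟩

lemma cell {τ} (hτ : Good τ) {n m : Fin 4 → ℝ} (hv : Valid n m) : ∃ n' m' P Q, Valid n' m' ∧ Mono P ∧ Mono Q ∧
    ∀ a b, τ (wd n a m b) = wd n' (P a) m' (Q b) := by
  obtain ⟨n', a0, m', b0, hv', e0⟩ := hτ.maps 0 0 hv
  choose A B hAB using cell_stay hτ hv hv' e0
  have e1 : τ (wd n' a0 m' b0) = wd n 0 m 0 := by rw [← e0, hτ.invol _ _ hv]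
  choose C D hCD using cell_stay hτ hv' hv e1
  obtain ⟨P, Q, hP, hQ, h⟩ := plane_order (fun x => (A x.1 x.2, B x.1 x.2)) (by
      intro x y
      constructor
      · intro h
        have h1 := hτ.mono hv' hv' ((wd_sub_iff hv').2 h)
        simp only [← hAB, hτ.invol _ _ hv] at h1
        exact (wd_sub_iff hv).1 h1
      · intro h
        have h1 := hτ.mono hv hv ((wd_sub_iff hv).2 h)
        simp only [hAB] at h1
        exact (wd_sub_iff hv').1 h1) (by
      intro y
      refine ⟨(C y.1 y.2, D y.1 y.2), ?_⟩
      have := hτ.invol y.1 y.2 hv'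
      rw [hCD, hAB] at this
      have := wd_ext hv' this
      exact Prod.ext this.1 this.2)
  rcases h with h | h
  · refine ⟨n', m', P, Q, hv', hP, hQ, fun a b => ?_⟩
    have := h a b
    simp only [Prod.mk.injEq] at this
    rw [hAB, this.1, this.2]
  · refine ⟨m', n', P, Q, hv'.symm, hP, hQ, fun a b => ?_⟩
    have := h a b
    simp only [Prod.mk.injEq] at this
    rw [hAB, this.1, this.2, wd_swap]


lemma mink_cont (n : Fin 4 → ℝ) : Continuous (fun x => mink x n) := by
  unfold mink; fun_prop

lemma wd_open (n m : Fin 4 → ℝ) (a b : ℝ) : IsOpen (wd n a m b) :=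
  (isOpen_lt continuous_const (mink_cont n)).inter (isOpen_lt continuous_const (mink_cont m))

lemma closure_wd (n m : Fin 4 → ℝ) (a b : ℝ) : closure (wd n a m b) ⊆ {x | a ≤ mink x n ∧ b ≤ mink x m} := by
  apply closure_minimal
  · rintro x ⟨h1, h2⟩; exact ⟨le_of_lt h1, le_of_lt h2⟩
  · exact (isClosed_le continuous_const (mink_cont n)).inter (isClosed_le continuous_const (mink_cont m))

lemma perp {τ} (hτ : Good τ) {n m n' m' : Fin 4 → ℝ} {a b a' b' : ℝ} (hv : Valid n m) (hv' : Valid n' m')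
    (h : wd n a m b ∩ wd n' a' m' b' = ∅) : τ (wd n a m b) ∩ τ (wd n' a' m' b') = ∅ := by
  have h1 : ∀ ε > 0, τ (wd n (a + ε) m (b + ε)) ∩ τ (wd n' a' m' b') = ∅ := by
    intro ε hε
    apply hτ.disj hv hv'
    have h2 : closure (wd n (a + ε) m (b + ε)) ⊆ wd n a m b := by
      intro x hx
      have := closure_wd _ _ _ _ hx
      exact ⟨lt_of_lt_of_le (by linarith) this.1, lt_of_lt_of_le (by linarith) this.2⟩
    have h3 : Disjoint (wd n a m b) (closure (wd n' a' m' b')) :=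
      (Set.disjoint_iff_inter_eq_empty.2 h).closure_right (wd_open _ _ _ _)
    exact Set.disjoint_iff_inter_eq_empty.1 (h3.mono_left h2)
  obtain ⟨p, q, P, Q, hpq, hP, hQ, e⟩ := cell hτ hv
  rw [Set.eq_empty_iff_forall_notMem]
  rintro x ⟨hx, hx'⟩
  rw [e] at hx
  obtain ⟨a1, ha1⟩ := hP.2 (mink x p)
  obtain ⟨b1, hb1⟩ := hQ.2 (mink x q)
  have ha : a < a1 := hP.1.lt_iff_lt.1 (by rw [ha1]; exact hx.1)
  have hb : b < b1 := hQ.1.lt_iff_lt.1 (by rw [hb1]; exact hx.2)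
  have hε : 0 < min (a1 - a) (b1 - b) / 2 := by
    have : 0 < min (a1 - a) (b1 - b) := lt_min (by linarith) (by linarith)
    linarith
  have := h1 _ hε
  rw [e, Set.eq_empty_iff_forall_notMem] at this
  refine this x ⟨⟨?_, ?_⟩, hx'⟩
  · show _ < mink x p
    rw [← ha1]; apply hP.1
    have := min_le_left (a1 - a) (b1 - b); linarith
  · show _ < mink x q
    rw [← hb1]; apply hQ.1
    have := min_le_right (a1 - a) (b1 - b); linarith

lemma perp_iff {τ} (hτ : Good τ) {n m n' m' : Fin 4 → ℝ} {a b a' b' : ℝ} (hv : Valid n m) (hv' : Valid n' m') :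
    τ (wd n a m b) ∩ τ (wd n' a' m' b') = ∅ ↔ wd n a m b ∩ wd n' a' m' b' = ∅ := by
  constructor
  · intro h
    obtain ⟨p, c, q, d, hpq, e⟩ := hτ.maps a b hv
    obtain ⟨p', c', q', d', hpq', e'⟩ := hτ.maps a' b' hv'
    rw [e, e'] at h
    have := perp hτ hpq hpq' h
    rwa [← e, ← e', hτ.invol _ _ hv, hτ.invol _ _ hv'] at this
  · exact perp hτ hv hv'

/-- `τ` acts on the half spaces with normal `n` by a new normal and a map. -/
def HRep (τ : Set (Fin 4 → ℝ) → Set (Fin 4 → ℝ)) (n n' : Fin 4 → ℝ) (P : ℝ → ℝ) : Prop :=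
  Mono P ∧ ∃ m m' Q, Valid n m ∧ Valid n' m' ∧ Mono Q ∧ ∀ a b, τ (wd n a m b) = wd n' (P a) m' (Q b)

lemma union_hs (V : Set (Fin 4 → ℝ)) (n m : Fin 4 → ℝ) (a : ℝ) :
    (∀ b, V ∩ wd n a m b = ∅) ↔ V ∩ hs n a = ∅ := by
  simp only [Set.eq_empty_iff_forall_notMem]
  constructor
  · rintro h x ⟨h1, h2⟩
    exact h (mink x m - 1) x ⟨h1, h2, by simp [hs]⟩
  · rintro h b x ⟨h1, h2, h3⟩
    exact h x ⟨h1, h2⟩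

lemma rep_disj {τ} (hτ : Good τ) {n n' : Fin 4 → ℝ} {P : ℝ → ℝ} (hr : HRep τ n n' P) {p q : Fin 4 → ℝ}
    (hpq : Valid p q) (c d a : ℝ) : τ (wd p c q d) ∩ hs n' (P a) = ∅ ↔ wd p c q d ∩ hs n a = ∅ := by
  obtain ⟨hP, m, m', Q, hv, hv', hQ, e⟩ := hr
  rw [← union_hs _ n' m', ← union_hs _ n m, hQ.2.forall]
  simp only [← e, perp_iff hτ hpq hv]

lemma rep_unique_aux {τ} (hτ : Good τ) {n n1 n2 : Fin 4 → ℝ} {P1 P2 : ℝ → ℝ} (h1 : HRep τ n n1 P1)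
    (h2 : HRep τ n n2 P2) (a : ℝ) : n2 = n1 ∧ P1 a ≤ P2 a := by
  obtain ⟨-, -, m1, -, -, hv1, -, -⟩ := id h1
  obtain ⟨-, -, m2, -, -, hv2, -, -⟩ := id h2
  set d := - P2 a - 1 with hd
  obtain ⟨p, c, q, c', hpq, e⟩ := hτ.maps (- P1 a) d hv1.neg
  have e' : τ (wd p c q c') = wd (-n1) (- P1 a) (-m1) d := by rw [← e, hτ.invol _ _ hv1.neg]
  have k1 : τ (wd p c q c') ∩ hs n1 (P1 a) = ∅ := by
    rw [e', Set.eq_empty_iff_forall_notMem]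
    rintro x ⟨⟨h3, -⟩, h4⟩
    simp only [hs, Set.mem_ofPred_eq, mink_neg_right] at h3 h4
    linarith
  rw [rep_disj hτ h1 hpq, ← rep_disj hτ h2 hpq, e'] at k1
  rcases wd_inter_hs hv1.neg hv2.1 k1 with ⟨h3, h4⟩ | ⟨h3, h4⟩
  · exact ⟨by rw [h3, neg_neg], by linarith⟩
  · linarith

lemma rep_unique {τ} (hτ : Good τ) {n n1 n2 : Fin 4 → ℝ} {P1 P2 : ℝ → ℝ} (h1 : HRep τ n n1 P1)
    (h2 : HRep τ n n2 P2) : n1 = n2 ∧ P1 = P2 :=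
  ⟨(rep_unique_aux hτ h2 h1 0).1, funext fun a =>
    le_antisymm (rep_unique_aux hτ h1 h2 a).2 (rep_unique_aux hτ h2 h1 a).2⟩

lemma exists_partner {n : Fin 4 → ℝ} (h : IsN n) : ∃ m, Valid n m := by
  refine ⟨![-n 0, n 1, n 2, n 3], h, ⟨?_, ?_⟩, ?_, ?_⟩
  · simpa using h.1
  · have := h.2; simp only [mink, Matrix.cons_val] at *; linarith
  · simp
  · intro e
    have e1 := congrFun e 1
    have e2 := congrFun e 2
    have e3 := congrFun e 3
    simp at e1 e2 e3
    have z1 : n 1 = 0 := by linarith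
    have z2 : n 2 = 0 := by linarith
    have z3 : n 3 = 0 := by linarith
    have := h.1
    have h2 := h.2
    simp only [mink, z1, z2, z3] at h2
    nlinarith

/-- `τ` comes from a map of half spaces -/
lemma exists_rep {τ} (hτ : Good τ) : ∃ (f : (Fin 4 → ℝ) → Fin 4 → ℝ) (φ : (Fin 4 → ℝ) → ℝ → ℝ),
    (∀ n, IsN n → Mono (φ n)) ∧ ∀ n m, Valid n m → Valid (f n) (f m) ∧
      ∀ a b, τ (wd n a m b) = wd (f n) (φ n a) (f m) (φ m b) := by
  have ex : ∀ n, ∃ n' P, IsN n → HRep τ n n' P := by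
    intro n
    by_cases hn : IsN n
    · obtain ⟨m, hv⟩ := exists_partner hn
      obtain ⟨n', m', P, Q, hv', hP, hQ, e⟩ := cell hτ hv
      exact ⟨n', P, fun _ => ⟨hP, m, m', Q, hv, hv', hQ, e⟩⟩
    · exact ⟨0, 0, fun h => absurd h hn⟩
  choose f φ hf using ex
  refine ⟨f, φ, fun n hn => (hf n hn).1, fun n m hv => ?_⟩
  obtain ⟨n', m', P, Q, hv', hP, hQ, e⟩ := cell hτ hv
  obtain ⟨h1, h2⟩ := rep_unique hτ (hf n hv.1) ⟨hP, m, m', Q, hv, hv', hQ, e⟩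
  obtain ⟨h3, h4⟩ := rep_unique hτ (hf m hv.2.1) ⟨hQ, n, n', P, hv.symm, hv'.symm, hP, fun a b => by
    rw [wd_swap, e, wd_swap]⟩
  rw [h1, h2, h3, h4]
  exact ⟨hv', e⟩


lemma sum_update {ι : Type*} [Fintype ι] [DecidableEq ι] (g : ι → ℝ → ℝ) (a : ι → ℝ) (i0 : ι) (y : ℝ) :
    ∑ i, g i (Function.update a i0 y i) = ∑ i, g i (a i) - g i0 (a i0) + g i0 y := by
  rw [← Finset.add_sum_erase _ _ (Finset.mem_univ i0), ← Finset.add_sum_erase (a := i0) _ (fun i => g i (a i)) (Finset.mem_univ i0)]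
  have : ∑ i ∈ Finset.univ.erase i0, g i (Function.update a i0 y i) = ∑ i ∈ Finset.univ.erase i0, g i (a i) := by
    apply Finset.sum_congr rfl
    intro i hi
    rw [Function.update_of_ne (Finset.ne_of_mem_erase hi)]
  rw [this]; simp; ring

lemma eq_of_iff {ι : Type*} [Fintype ι] {l l' : ι → ℝ} {φ : ι → ℝ → ℝ} (hl : ∀ i, 0 < l i) (hl' : ∀ i, 0 < l' i)
    (hφ : ∀ i, Mono (φ i)) (h : ∀ a : ι → ℝ, 0 ≤ ∑ i, l i * a i ↔ 0 ≤ ∑ i, l' i * φ i (a i)) (i0 : ι)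
    (a : ι → ℝ) (ha : ∑ i, l i * a i = 0) : ∑ i, l' i * φ i (a i) = 0 := by
  classical
  have h1 := (h a).1 ha.ge
  by_contra hne
  have hpos : 0 < ∑ i, l' i * φ i (a i) := lt_of_le_of_ne h1 (Ne.symm hne)
  set S := ∑ i, l' i * φ i (a i) with hS
  obtain ⟨y, hy⟩ := (hφ i0).2 (φ i0 (a i0) - S / l' i0)
  have hlt : y < a i0 := by
    rw [← (hφ i0).1.lt_iff_lt, hy]
    have := div_pos hpos (hl' i0)
    linarith
  have e1 := sum_update (fun i t => l' i * φ i t) a i0 y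
  have e2 := sum_update (fun i t => l i * t) a i0 y
  rw [← hS, hy] at e1
  have e3 : ∑ i, l' i * φ i (Function.update a i0 y i) = 0 := by
    rw [e1]; have := (hl' i0).ne'; field_simp; ring
  have := (h _).2 e3.ge
  rw [e2, ha] at this
  nlinarith [hl i0]

/-- `τ` acts through `f` and `φ` -/
def Act (τ : Set (Fin 4 → ℝ) → Set (Fin 4 → ℝ)) (f : (Fin 4 → ℝ) → Fin 4 → ℝ) (φ : (Fin 4 → ℝ) → ℝ → ℝ) : Prop :=
    (∀ n, IsN n → Mono (φ n)) ∧ ∀ n m, Valid n m → Valid (f n) (f m) ∧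
      ∀ a b, τ (wd n a m b) = wd (f n) (φ n a) (f m) (φ m b)

lemma act_neg {τ f φ} (hτ : Good τ) (hA : Act τ f φ) {n : Fin 4 → ℝ} (hn : IsN n) :
    f (-n) = - f n ∧ ∀ a, φ (-n) (-a) = - φ n a := by
  obtain ⟨m, hv⟩ := exists_partner hn
  obtain ⟨hv', e⟩ := hA.2 n m hv
  obtain ⟨hv1, e1⟩ := hA.2 _ _ hv.neg
  have hs1 := (hA.1 _ hv.neg.2.1).2
  have key : ∀ a c, (∀ b, wd n a m b ∩ hs (-n) c = ∅) ↔ (∀ b, wd (f n) (φ n a) (f m) (φ m b) ∩ hs (f (-n)) (φ (-n) c) = ∅) := by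
    intro a c
    refine forall_congr' fun b => ?_
    rw [← union_hs _ (-n) (-m), ← union_hs _ (f (-n)) (f (-m)), hs1.forall (p := fun d => wd (f n) (φ n a) (f m) (φ m b) ∩ wd (f (-n)) (φ (-n) c) (f (-m)) d = ∅)]
    refine forall_congr' fun d => ?_
    rw [← e1, ← e, perp_iff hτ hv hv.neg]
  have fwd : ∀ a c, 0 ≤ a + c → f (-n) = - f n ∧ 0 ≤ φ n a + φ (-n) c := by
    intro a c hac
    have := (key a c).1 (fun b => by
      have := hs_disj_hs_neg (n := n) hac
      rw [Set.eq_empty_iff_forall_notMem] at *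
      rintro x ⟨h1, h2⟩
      exact this x ⟨h1.1, h2⟩)
    obtain ⟨b, hb⟩ := (hA.1 _ hv.2.1).2 (- φ (-n) c - 1)
    rcases wd_inter_hs hv' hv1.1 (this b) with h | h
    · exact h
    · rw [hb] at h; linarith
  have hfn := (fwd 0 0 (by simp)).1
  have bwd : ∀ a c, 0 ≤ φ n a + φ (-n) c → 0 ≤ a + c := by
    intro a c hac
    have := (key a c).2 (fun b => by
      have := hs_disj_hs_neg (n := f n) hac
      rw [Set.eq_empty_iff_forall_notMem] at *
      rintro x ⟨h1, h2⟩
      rw [hfn] at h2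
      exact this x ⟨h1.1, h2⟩) 0
    rcases wd_inter_hs hv hn.neg this with h | h
    · exact h.2
    · exact absurd (neg_injective h.1) hv.ne
  refine ⟨hfn, fun a => ?_⟩
  have := eq_of_iff (ι := Fin 2) (l := fun _ => 1) (l' := fun _ => 1) (φ := ![φ n, φ (-n)]) (by simp) (by simp)
    (by intro i; fin_cases i; exacts [hA.1 _ hn, hA.1 _ hn.neg])
    (by
      intro a
      simp only [Fin.sum_univ_two, Matrix.cons_val, one_mul]
      exact ⟨fun h => (fwd _ _ h).2, fun h => bwd _ _ h⟩) 0 ![a, -a] (by simp [Fin.sum_univ_two])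
  simp [Fin.sum_univ_two] at this
  linarith

/-- two pairs of null vectors, crosswise valid -/
def Cross (n : Fin 4 → Fin 4 → ℝ) : Prop :=
  Valid (n 0) (n 2) ∧ Valid (n 0) (n 3) ∧ Valid (n 1) (n 2) ∧ Valid (n 1) (n 3)

lemma quad_rigid_aux {y z w : Fin 4 → ℝ} (h3 : Valid y z) (h4 : Valid y w) {q r s : ℝ} (hr : 0 ≤ r) (hs : 0 ≤ s)
    (h : q • y + r • z + s • w = 0) : q = 0 ∧ r = 0 ∧ s = 0 := by
  have e : r • z + s • w = q • (-y) := by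
    have : r • z + s • w = (q • y + r • z + s • w) - q • y := by abel
    rw [this, h]; simp
  have := core3 h3.2.1 h4.2.1 h3.1.neg (by simp [h3.2.2.1]) (by simp [h4.2.2.1]) h3.symm.2.2.2 h4.symm.2.2.2 hr hs e
  tauto

lemma quad_rigid {n : Fin 4 → Fin 4 → ℝ} (hn : Cross n) {l : Fin 4 → ℝ} (hl : ∀ i, 0 ≤ l i)
    (h : ∑ i, l i • n i = 0) (i : Fin 4) (hi : l i = 0) (j : Fin 4) : l j = 0 := by
  obtain ⟨v02, v03, v12, v13⟩ := hn
  rw [Fin.sum_univ_four] at h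
  have : l 0 = 0 ∧ l 1 = 0 ∧ l 2 = 0 ∧ l 3 = 0 := by
    have hi' : l 0 = 0 ∨ l 1 = 0 ∨ l 2 = 0 ∨ l 3 = 0 := by fin_cases i <;> simp_all
    rcases hi' with hi | hi | hi | hi
    · have := quad_rigid_aux v12 v13 (hl 2) (hl 3) (q := l 1) (by simpa [hi] using h)
      tauto
    · have := quad_rigid_aux v02 v03 (hl 2) (hl 3) (q := l 0) (by simpa [hi] using h)
      tauto
    · have := quad_rigid_aux v03.symm v13.symm (hl 0) (hl 1) (q := l 3) (by rw [← h, hi, zero_smul]; abel)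
      tauto
    · have := quad_rigid_aux v02.symm v12.symm (hl 0) (hl 1) (q := l 2) (by rw [← h, hi, zero_smul]; abel)
      tauto
  fin_cases j
  exacts [this.1, this.2.1, this.2.2.1, this.2.2.2]

lemma quad_pos {n : Fin 4 → Fin 4 → ℝ} (hn : Cross n) {l : Fin 4 → ℝ} (hl : ∀ i, 0 ≤ l i)
    (h : ∑ i, l i • n i = 0) (hne : ∃ i, l i ≠ 0) (j : Fin 4) : 0 < l j := by
  obtain ⟨i, hi⟩ := hne
  exact lt_of_le_of_ne (hl j) fun e => hi (quad_rigid hn hl h j e.symm i)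

lemma quad_prop {n : Fin 4 → Fin 4 → ℝ} (hn : Cross n) {l l' : Fin 4 → ℝ} (hl : ∀ i, 0 < l i) (hl' : ∀ i, 0 < l' i)
    (h : ∑ i, l i • n i = 0) (h' : ∑ i, l' i • n i = 0) : ∃ t > 0, ∀ i, l' i = t * l i := by
  obtain ⟨i, -, hi⟩ := Finset.exists_min_image Finset.univ (fun i => l' i / l i) ⟨0, Finset.mem_univ _⟩
  refine ⟨l' i / l i, div_pos (hl' i) (hl i), fun j => ?_⟩
  have := quad_rigid hn (l := fun j => l' j - l' i / l i * l j) (fun j => by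
    have h1 := hi j (Finset.mem_univ _)
    rw [le_div_iff₀ (hl j)] at h1
    simpa using h1) (by
      simp only [sub_smul, mul_smul, Finset.sum_sub_distrib, ← Finset.smul_sum, h, h']; simp) i (by
      have := (hl i).ne'
      field_simp; simp) j
  linarith

lemma quad_ex {n : Fin 4 → Fin 4 → ℝ} (hn : Cross n) {a : Fin 4 → ℝ}
    (h : wd (n 0) (a 0) (n 2) (a 2) ∩ wd (n 1) (a 1) (n 3) (a 3) = ∅) :
    ∃ l : Fin 4 → ℝ, (∀ i, 0 < l i) ∧ ∑ i, l i • n i = 0 ∧ 0 ≤ ∑ i, l i * a i := by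
  obtain ⟨l, h1, h2, h3, h4⟩ := farkas n a (by
    rintro ⟨x, hx⟩
    have : x ∈ wd (n 0) (a 0) (n 2) (a 2) ∩ wd (n 1) (a 1) (n 3) (a 3) := ⟨⟨hx 0, hx 2⟩, ⟨hx 1, hx 3⟩⟩
    rw [h] at this; exact this)
  exact ⟨l, quad_pos hn h1 h3 h2, h3, h4⟩

lemma quad_disj {n : Fin 4 → Fin 4 → ℝ} (hn : Cross n) {l : Fin 4 → ℝ} (hl : ∀ i, 0 < l i)
    (h : ∑ i, l i • n i = 0) (a : Fin 4 → ℝ) :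
    wd (n 0) (a 0) (n 2) (a 2) ∩ wd (n 1) (a 1) (n 3) (a 3) = ∅ ↔ 0 ≤ ∑ i, l i * a i := by
  constructor
  · intro hd
    obtain ⟨l', h1, h2, h3⟩ := quad_ex hn hd
    obtain ⟨t, ht, e⟩ := quad_prop hn hl h1 h h2
    simp only [e, mul_assoc, ← Finset.mul_sum] at h3
    exact nonneg_of_mul_nonneg_right h3 ht
  · intro hs
    rw [Set.eq_empty_iff_forall_notMem]
    rintro x ⟨⟨h0, h2⟩, ⟨h1, h3⟩⟩
    have e := mink_sum_right x l n
    rw [h, mink_zero_right] at e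
    have : ∑ i, l i * a i < ∑ i, l i * mink x (n i) := by
      apply Finset.sum_lt_sum_of_nonempty ⟨0, Finset.mem_univ _⟩
      intro i _
      refine mul_lt_mul_of_pos_left ?_ (hl i)
      fin_cases i
      exacts [h0, h1, h2, h3]
    linarith

lemma act_quad {τ f φ} (hτ : Good τ) (hA : Act τ f φ) {n : Fin 4 → Fin 4 → ℝ} (hn : Cross n) {l : Fin 4 → ℝ}
    (hl : ∀ i, 0 < l i) (h : ∑ i, l i • n i = 0) : ∃ l' : Fin 4 → ℝ, (∀ i, 0 < l' i) ∧ ∑ i, l' i • f (n i) = 0 ∧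
      ∀ a : Fin 4 → ℝ, ∑ i, l i * a i = 0 → ∑ i, l' i * φ (n i) (a i) = 0 := by
  have hn' : Cross (fun i => f (n i)) :=
    ⟨(hA.2 _ _ hn.1).1, (hA.2 _ _ hn.2.1).1, (hA.2 _ _ hn.2.2.1).1, (hA.2 _ _ hn.2.2.2).1⟩
  have key : ∀ a : Fin 4 → ℝ, wd (f (n 0)) (φ (n 0) (a 0)) (f (n 2)) (φ (n 2) (a 2)) ∩
      wd (f (n 1)) (φ (n 1) (a 1)) (f (n 3)) (φ (n 3) (a 3)) = ∅ ↔ 0 ≤ ∑ i, l i * a i := by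
    intro a
    rw [← quad_disj hn hl h, ← (hA.2 _ _ hn.1).2, ← (hA.2 _ _ hn.2.2.2).2, perp_iff hτ hn.1 hn.2.2.2]
  obtain ⟨l', hl', h', -⟩ := quad_ex hn' (a := fun i => φ (n i) 0) ((key 0).2 (by simp))
  refine ⟨l', hl', h', fun a ha => ?_⟩
  refine eq_of_iff (φ := fun i => φ (n i)) hl hl' (fun i => ?_) (fun a => ?_) 0 a ha
  · fin_cases i
    exacts [hA.1 _ hn.1.1, hA.1 _ hn.2.2.1.1, hA.1 _ hn.1.2.1, hA.1 _ hn.2.1.2.1]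
  · rw [← key, ← quad_disj hn' hl' h']

lemma pexider {l l' : Fin 4 → ℝ} {φ : Fin 4 → ℝ → ℝ} (hl : ∀ i, 0 < l i) (hl' : ∀ i, 0 < l' i)
    (hφ : ∀ i, Mono (φ i)) (h : ∀ a : Fin 4 → ℝ, ∑ i, l i * a i = 0 → ∑ i, l' i * φ i (a i) = 0) :
    ∃ κ > 0, ∀ i a, l' i * (φ i a - φ i 0) = κ * l i * a := by
  let g : Fin 4 → ℝ → ℝ := fun i x => l' i * (φ i (x / l i) - φ i 0)
  have g0 : ∀ i, g i 0 = 0 := by intro i; simp [g]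
  have hg : ∀ x y z w : ℝ, x + y + z + w = 0 → g 0 x + g 1 y + g 2 z + g 3 w = 0 := by
    intro x y z w hs
    have h1 := h (fun i => ![x, y, z, w] i / l i) (by
      have n0 := (hl 0).ne'; have n1 := (hl 1).ne'; have n2 := (hl 2).ne'; have n3 := (hl 3).ne'
      rw [Fin.sum_univ_four]; simp only [Matrix.cons_val]; field_simp; linarith)
    have h2 := h (fun _ => 0) (by simp)
    rw [Fin.sum_univ_four] at h1 h2
    simp only [Matrix.cons_val] at h1
    simp only [g]
    linarith
  have r2 : ∀ x, g 2 (-x) = - g 0 x := fun x => by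
    have := hg x 0 (-x) 0 (by ring); rw [g0, g0] at this; linarith
  have r3 : ∀ x, g 3 (-x) = - g 0 x := fun x => by
    have := hg x 0 0 (-x) (by ring); rw [g0, g0] at this; linarith
  have r1 : ∀ x, g 1 x = g 0 x := fun x => by
    have := hg 0 x (-x) 0 (by ring); rw [g0, g0, r2] at this; linarith
  have add : ∀ x y, g 0 (x + y) = g 0 x + g 0 y := fun x y => by
    have := hg x y (-(x + y)) 0 (by ring); rw [g0, r2, r1] at this; linarith
  have cont : Continuous (g 0) := by
    have := (hφ 0).1.monotone.continuous_of_surjective (hφ 0).2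
    simp only [g]; fun_prop
  let G : ℝ →+ ℝ := ⟨⟨g 0, g0 0⟩, add⟩
  have lin : ∀ x, g 0 x = g 0 1 * x := by
    intro x
    have := (G.toRealLinearMap cont).map_smul x 1
    simp only [smul_eq_mul, mul_one, AddMonoidHom.coe_toRealLinearMap] at this
    exact this.trans (mul_comm _ _)
  have gl : ∀ i x, g i x = g 0 1 * x := by
    intro i x
    fin_cases i
    · exact lin x
    · exact (r1 x).trans (lin x)
    · have := r2 (-x); rw [neg_neg, lin] at this; show g 2 x = _; linarith
    · have := r3 (-x); rw [neg_neg, lin] at this; show g 3 x = _; linarith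
  refine ⟨g 0 1, ?_, fun i a => ?_⟩
  · simp only [g]
    refine mul_pos (hl' 0) (sub_pos.2 ((hφ 0).1 ?_))
    have := hl 0; positivity
  · have := gl i (l i * a)
    simp only [g] at this ⊢
    rw [mul_div_cancel_left₀ _ (hl i).ne'] at this
    linarith

lemma exists_quad {n : Fin 4 → ℝ} (hn : IsN n) : ∃ N : Fin 4 → Fin 4 → ℝ, Cross N ∧ N 0 = n ∧ 
    ∑ i, (1 : ℝ) • N i = 0 := by
  obtain ⟨w1, w2, w3, hw, hwn, -⟩ := exists_perp (n 1) (n 2) (n 3) 0 0 0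
  have h1 := hn.1
  have h2 := hn.2
  simp only [mink] at h2
  have hsp : n 1 ^ 2 + n 2 ^ 2 + n 3 ^ 2 = 1 := by nlinarith
  have N1 : IsN ![n 0, - n 1, - n 2, - n 3] := ⟨by simpa using h1, by simp only [mink, Matrix.cons_val]; linarith⟩
  have N2 : IsN ![- n 0, w1, w2, w3] := ⟨by simpa using h1, by simp only [mink, Matrix.cons_val]; nlinarith⟩
  have N3 : IsN ![- n 0, -w1, -w2, -w3] := ⟨by simpa using h1, by simp only [mink, Matrix.cons_val]; nlinarith⟩
  refine ⟨![n, ![n 0, - n 1, - n 2, - n 3], ![- n 0, w1, w2, w3], ![- n 0, -w1, -w2, -w3]], ?_, rfl, ?_⟩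
  · refine ⟨⟨hn, N2, by simp, ?_⟩, ⟨hn, N3, by simp, ?_⟩, ⟨N1, N2, by simp, ?_⟩, ⟨N1, N3, by simp, ?_⟩⟩
    all_goals
      intro e
      have e1 := congrFun e 1
      have e2 := congrFun e 2
      have e3 := congrFun e 3
      simp at e1 e2 e3
      try rw [e1, e2, e3] at hwn hsp
      nlinarith
  · rw [Fin.sum_univ_four]
    ext i
    fin_cases i <;> simp [Matrix.vecHead, Matrix.vecTail]

lemma cross_isN {n : Fin 4 → Fin 4 → ℝ} (hn : Cross n) (i : Fin 4) : IsN (n i) := by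
  fin_cases i
  exacts [hn.1.1, hn.2.2.1.1, hn.1.2.1, hn.2.1.2.1]

/-- The affine form of the action -/
lemma act_affine {τ f φ} (hτ : Good τ) (hA : Act τ f φ) : ∃ c d : (Fin 4 → ℝ) → ℝ,
    (∀ n, IsN n → 0 < c n ∧ (∀ a, φ n a = c n * a + d n) ∧ f (-n) = - f n ∧ c (-n) = c n ∧ d (-n) = - d n) ∧
    (∀ n, Cross n → ∀ l : Fin 4 → ℝ, (∀ i, 0 < l i) → ∑ i, l i • n i = 0 → 
      ∑ i, l i • ((c (n i))⁻¹ • f (n i)) = 0 ∧ ∑ i, l i * ((c (n i))⁻¹ * d (n i)) = 0) := by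
  have aff : ∀ n, IsN n → ∃ c > 0, ∀ a, φ n a = c * a + φ n 0 := by
    intro n hn
    obtain ⟨N, hN, rfl, hs⟩ := exists_quad hn
    obtain ⟨l', hl', h1, h2⟩ := act_quad hτ hA hN (l := fun _ => 1) (by simp) hs
    obtain ⟨κ, hκ, h3⟩ := pexider (l := fun _ => 1) (φ := fun i => φ (N i)) (by simp) hl' 
      (fun i => hA.1 _ (cross_isN hN i)) h2
    refine ⟨κ / l' 0, div_pos hκ (hl' 0), fun a => ?_⟩
    have := h3 0 a
    have := (hl' 0).ne'
    field_simp
    linarith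
  have hc : ∀ n, IsN n → 0 < φ n 1 - φ n 0 ∧ ∀ a, φ n a = (φ n 1 - φ n 0) * a + φ n 0 := by
    intro n hn
    obtain ⟨c, hc, h⟩ := aff n hn
    have : φ n 1 - φ n 0 = c := by rw [h 1]; ring
    rw [this]; exact ⟨hc, h⟩
  refine ⟨fun n => φ n 1 - φ n 0, fun n => φ n 0, fun n hn => ?_, fun n hn l hl h => ?_⟩
  · obtain ⟨h1, h2⟩ := act_neg hτ hA hn
    have a0 := h2 0
    have a1 := h2 (-1)
    rw [neg_zero] at a0
    rw [neg_neg] at a1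
    refine ⟨(hc n hn).1, (hc n hn).2, h1, ?_, a0⟩
    have := (hc n hn).2 (-1)
    show φ (-n) 1 - φ (-n) 0 = φ n 1 - φ n 0
    linarith
  · obtain ⟨l', hl', h1, h2⟩ := act_quad hτ hA hn hl h
    obtain ⟨κ, hκ, h3⟩ := pexider (φ := fun i => φ (n i)) hl hl' 
      (fun i => hA.1 _ (cross_isN hn i)) h2
    have e : ∀ i, l i * (φ (n i) 1 - φ (n i) 0)⁻¹ = κ⁻¹ * l' i := by
      intro i
      have := h3 i 1
      have := (hc _ (cross_isN hn i)).1.ne'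
      have := hκ.ne'
      field_simp
      linarith
    have h4 := h2 (fun _ => 0) (by simp)
    constructor
    · simp only [← mul_smul, e]
      simp only [mul_smul, ← Finset.smul_sum, h1, smul_zero]
    · simp only [← mul_assoc, e]
      simp only [mul_assoc, ← Finset.mul_sum, h4, mul_zero]


/-- relation-respecting function on the unit sphere -/
def SphRel {V : Type*} [AddCommGroup V] [Module ℝ V] (g : (Fin 3 → ℝ) → V) : Prop :=
  ∀ a b c d : Fin 3 → ℝ, a ⬝ᵥ a = 1 → b ⬝ᵥ b = 1 → c ⬝ᵥ c = 1 → d ⬝ᵥ d = 1 → a ≠ c → a ≠ d → b ≠ c → b ≠ d →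
    ∀ α β γ δ : ℝ, 0 < α → 0 < β → 0 < γ → 0 < δ → α + β = γ + δ → α • a + β • b = γ • c + δ • d →
      α • g a + β • g b = γ • g c + δ • g d

lemma rel_circle_pos {V : Type*} [AddCommGroup V] [Module ℝ V] {g : (Fin 3 → ℝ) → V} (hg : SphRel g)
    {u v : Fin 3 → ℝ} (hu : u ⬝ᵥ u = 1) (hv : v ⬝ᵥ v = 1) (huv : u ⬝ᵥ v = 0)
    (g1 : g u = 0) (g2 : g (-u) = 0) (g3 : g v = 0) {x y : ℝ} (hx : 0 < x) (hy : 0 < y) (hxy : x ^ 2 + y ^ 2 = 1) :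
    g (x • u + y • v) = 0 := by
  have hvu : v ⬝ᵥ u = 0 := by rw [dotProduct_comm]; exact huv
  have hx1 : x < 1 := by nlinarith
  have hy1 : y < 1 := by nlinarith
  have hs : 1 < x + y := by nlinarith
  have := hg (x • u + y • v) (-u) u v
    (by simp [dotProduct_add, add_dotProduct, hu, hv, huv, hvu]; nlinarith) (by simpa using hu) hu hv
    (by
      intro e
      have := congrArg (fun z => z ⬝ᵥ v) e
      simp [add_dotProduct, hv, huv] at this
      linarith)
    (by
      intro e
      have := congrArg (fun z => z ⬝ᵥ u) e
      simp [add_dotProduct, hu, hvu] at this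
      linarith)
    (by
      intro e
      have := congrArg (fun z => z ⬝ᵥ u) e
      simp [hu] at this
      linarith)
    (by
      intro e
      have := congrArg (fun z => z ⬝ᵥ u) e
      simp [hu, hvu] at this)
    1 ((x + y - 1) / 2) ((1 - y + x) / 2) y one_pos (by linarith) (by linarith) hy (by ring) (by module)
  simpa [g1, g2, g3] using this

lemma rel_circle {V : Type*} [AddCommGroup V] [Module ℝ V] {g : (Fin 3 → ℝ) → V} (hg : SphRel g)
    {u v : Fin 3 → ℝ} (hu : u ⬝ᵥ u = 1) (hv : v ⬝ᵥ v = 1) (huv : u ⬝ᵥ v = 0)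
    (g1 : g u = 0) (g2 : g (-u) = 0) (g3 : g v = 0) (g4 : g (-v) = 0) {x y : ℝ} (hxy : x ^ 2 + y ^ 2 = 1) :
    g (x • u + y • v) = 0 := by
  have main : ∀ {u v : Fin 3 → ℝ} (hu : u ⬝ᵥ u = 1) (hv : v ⬝ᵥ v = 1) (huv : u ⬝ᵥ v = 0)
      (g1 : g u = 0) (g2 : g (-u) = 0) (g3 : g v = 0) {x y : ℝ} (hx : 0 ≤ x) (hy : 0 ≤ y) (hxy : x ^ 2 + y ^ 2 = 1),
      g (x • u + y • v) = 0 := by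
    intro u v hu hv huv g1 g2 g3 x y hx hy hxy
    rcases hx.eq_or_lt with rfl | hx
    · have : y = 1 := by nlinarith
      subst this; simpa using g3
    rcases hy.eq_or_lt with rfl | hy
    · have : x = 1 := by nlinarith
      subst this; simpa using g1
    exact rel_circle_pos hg hu hv huv g1 g2 g3 hx hy hxy
  rcases le_total 0 x with hx | hx <;> rcases le_total 0 y with hy | hy
  · exact main hu hv huv g1 g2 g3 hx hy hxy
  · have := main hu (v := -v) (by simpa using hv) (by simpa using huv) g1 g2 g4 hx (y := -y) (by linarith) (by nlinarith)
    simpa using this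
  · have := main (u := -u) (by simpa using hu) hv (by simpa using huv) g2 (by simpa using g1) g3 (x := -x) (by linarith) hy (by nlinarith)
    simpa using this
  · have := main (u := -u) (v := -v) (by simpa using hu) (by simpa using hv) (by simpa using huv) g2 (by simpa using g1) g4
      (x := -x) (y := -y) (by linarith) (by linarith) (by nlinarith)
    simpa using this

lemma rel_opp {V : Type*} [AddCommGroup V] [Module ℝ V] {g : (Fin 3 → ℝ) → V} (hg : SphRel g)
    {u v : Fin 3 → ℝ} (hu : u ⬝ᵥ u = 1) (hv : v ⬝ᵥ v = 1) (huv : u ⬝ᵥ v = 0)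
    (g1 : g u = 0) (g2 : g (-u) = 0) (g3 : g v = 0) : g (-v) = 0 := by
  have h1 : u ≠ v := by rintro rfl; linarith
  have h2 : u ≠ -v := by rintro rfl; simp [hv] at huv
  have h3 : -u ≠ v := by rintro rfl; simp [hu] at huv
  have h4 : -u ≠ -v := fun e => h1 (neg_injective e)
  have := hg u (-u) v (-v) hu (by simpa using hu) hv (by simpa using hv) h1 h2 h3 h4 1 1 1 1 one_pos one_pos
    one_pos one_pos rfl (by simp)
  simpa [g1, g2, g3] using this.symm

lemma rel_zero {V : Type*} [AddCommGroup V] [Module ℝ V] {g : (Fin 3 → ℝ) → V} (hg : SphRel g)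
    (g1 : g ![1, 0, 0] = 0) (g2 : g ![0, 1, 0] = 0) (g3 : g ![0, 0, 1] = 0) (g4 : g (-![0, 0, 1]) = 0)
    (w : Fin 3 → ℝ) (hw : w ⬝ᵥ w = 1) : g w = 0 := by
  have n1 : (![1, 0, 0] : Fin 3 → ℝ) ⬝ᵥ ![1, 0, 0] = 1 := by simp [dotProduct, Fin.sum_univ_three]
  have n2 : (![0, 1, 0] : Fin 3 → ℝ) ⬝ᵥ ![0, 1, 0] = 1 := by simp [dotProduct, Fin.sum_univ_three]
  have n3 : (![0, 0, 1] : Fin 3 → ℝ) ⬝ᵥ ![0, 0, 1] = 1 := by simp [dotProduct, Fin.sum_univ_three]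
  have n12 : (![1, 0, 0] : Fin 3 → ℝ) ⬝ᵥ ![0, 1, 0] = 0 := by simp [dotProduct, Fin.sum_univ_three]
  have n31 : (![0, 0, 1] : Fin 3 → ℝ) ⬝ᵥ ![1, 0, 0] = 0 := by simp [dotProduct, Fin.sum_univ_three]
  have n32 : (![0, 0, 1] : Fin 3 → ℝ) ⬝ᵥ ![0, 1, 0] = 0 := by simp [dotProduct, Fin.sum_univ_three]
  have g1' := rel_opp hg n3 n1 n31 g3 g4 g1
  have g2' := rel_opp hg n3 n2 n32 g3 g4 g2
  simp only [dotProduct, Fin.sum_univ_three] at hw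
  have equ : ∀ x y : ℝ, x ^ 2 + y ^ 2 = 1 → g ![x, y, 0] = 0 := by
    intro x y hxy
    have := rel_circle hg n1 n2 n12 g1 g1' g2 g2' hxy
    convert this using 2
    ext i; fin_cases i <;> simp
  by_cases hr : w 0 ^ 2 + w 1 ^ 2 = 0
  · have h0 : w 0 = 0 := by nlinarith [sq_nonneg (w 0), sq_nonneg (w 1)]
    have h1 : w 1 = 0 := by nlinarith [sq_nonneg (w 0), sq_nonneg (w 1)]
    have h2 : w 2 = 1 ∨ w 2 = -1 := sq_eq_one_iff.1 (by nlinarith)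
    rcases h2 with h2 | h2
    · convert g3 using 2
      ext i; fin_cases i <;> simp [h0, h1, h2]
    · convert g4 using 2
      ext i; fin_cases i <;> simp [h0, h1, h2]
  · have hpos : 0 < w 0 ^ 2 + w 1 ^ 2 := lt_of_le_of_ne (by positivity) (Ne.symm hr)
    obtain ⟨r, hr0, hr2⟩ : ∃ r : ℝ, 0 < r ∧ r ^ 2 = w 0 ^ 2 + w 1 ^ 2 :=
      ⟨√(w 0 ^ 2 + w 1 ^ 2), Real.sqrt_pos.2 hpos, Real.sq_sqrt hpos.le⟩
    have hrn := hr0.ne'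
    have hu : (w 0 / r) ^ 2 + (w 1 / r) ^ 2 = 1 := by field_simp; linarith
    have hu' : (-(w 0 / r)) ^ 2 + (-(w 1 / r)) ^ 2 = 1 := by rw [neg_sq, neg_sq]; exact hu
    have := rel_circle hg (u := ![w 0 / r, w 1 / r, 0]) (v := ![0, 0, 1])
      (by simp only [dotProduct, Fin.sum_univ_three, Matrix.cons_val]; linarith) n3
      (by simp [dotProduct, Fin.sum_univ_three]) (equ _ _ hu) (by
        convert equ _ _ hu' using 2
        ext i; fin_cases i <;> simp) g3 g4 (x := r) (y := w 2) (by nlinarith)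
    convert this using 2
    ext i; fin_cases i <;> simp <;> field_simp

lemma exists_linear {V : Type*} [AddCommGroup V] [Module ℝ V] {F : (Fin 4 → ℝ) → V}
    (hneg : ∀ n, IsN n → F (-n) = - F n)
    (hF : ∀ n, Cross n → ∀ l : Fin 4 → ℝ, (∀ i, 0 < l i) → ∑ i, l i • n i = 0 → ∑ i, l i • F (n i) = 0) :
    ∃ M : (Fin 4 → ℝ) →ₗ[ℝ] V, ∀ n, IsN n → M n = F n := by
  let nv : (Fin 3 → ℝ) → Fin 4 → ℝ := fun u => ![1, u 0, u 1, u 2]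
  have nvN : ∀ u : Fin 3 → ℝ, u ⬝ᵥ u = 1 → IsN (nv u) := by
    intro u hu
    simp only [dotProduct, Fin.sum_univ_three] at hu
    refine ⟨by simp [nv], ?_⟩
    simp only [mink, nv, Matrix.cons_val]; linarith
  have nvinj : ∀ u v, nv u = nv v → u = v := by
    intro u v h
    ext i
    have := congrFun h i.succ
    fin_cases i <;> simpa [nv] using this
  let p := F ![1, 0, 0, 1]
  let q := F ![1, 0, 0, -1]
  let e := F ![1, 1, 0, 0]
  let k := F ![1, 0, 1, 0]
  let s : V := (1 / 2 : ℝ) • (p + q)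
  let M : (Fin 4 → ℝ) →ₗ[ℝ] V := Fintype.linearCombination ℝ ![s, e - s, k - s, (1 / 2 : ℝ) • (p - q)]
  have hM : ∀ x, M x = x 0 • s + x 1 • (e - s) + x 2 • (k - s) + x 3 • ((1 / 2 : ℝ) • (p - q)) := by
    intro x
    simp [M, Fintype.linearCombination_apply, Fin.sum_univ_four]
  have hv : ∀ a c : Fin 3 → ℝ, a ⬝ᵥ a = 1 → c ⬝ᵥ c = 1 → a ≠ c → Valid (nv a) (- nv c) := by
    intro a c ha hc hac
    refine ⟨nvN a ha, (nvN c hc).neg, by simp [nv], ?_⟩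
    rw [neg_neg]
    exact fun h => hac (nvinj _ _ h)
  have hg : SphRel (fun u => F (nv u) - M (nv u)) := by
    intro a b c d ha hb hc hd hac had hbc hbd α β γ δ h1 h2 h3 h4 hs hvec
    have hsum : α • nv a + β • nv b + γ • (- nv c) + δ • (- nv d) = 0 := by
      ext i
      have e0 := congrFun hvec 0
      have e1 := congrFun hvec 1
      have e2 := congrFun hvec 2
      simp at e0 e1 e2
      fin_cases i <;> simp [nv] <;> linarith
    have := hF ![nv a, nv b, - nv c, - nv d] ⟨hv a c ha hc hac, hv a d ha hd had, hv b c hb hc hbc, hv b d hb hd hbd⟩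
      ![α, β, γ, δ] (by intro i; fin_cases i <;> assumption) (by simpa [Fin.sum_univ_four] using hsum)
    simp only [Fin.sum_univ_four, Matrix.cons_val] at this
    rw [hneg _ (nvN c hc), hneg _ (nvN d hd)] at this
    have hm := congrArg M hsum
    simp only [map_add, map_smul, map_neg, map_zero] at hm
    simp only [smul_sub]
    have h5 : (α • F (nv a) + β • F (nv b) + γ • -F (nv c) + δ • -F (nv d)) -
      (α • M (nv a) + β • M (nv b) + γ • -M (nv c) + δ • -M (nv d)) = 0 := by rw [this, hm, sub_zero]
    rw [← sub_eq_zero, ← h5]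
    module
  have hz := rel_zero hg (by
      have : nv ![1, 0, 0] = ![1, 1, 0, 0] := by simp [nv]
      simp only [this, hM, Matrix.cons_val]; simp [e]) (by
      have : nv ![0, 1, 0] = ![1, 0, 1, 0] := by simp [nv]
      simp only [this, hM, Matrix.cons_val]; simp [k]) (by
      have : nv ![0, 0, 1] = ![1, 0, 0, 1] := by simp [nv]
      simp only [this, hM, Matrix.cons_val]
      show p - _ = 0
      simp only [s]; module) (by
      have : nv (-![0, 0, 1]) = ![1, 0, 0, -1] := by simp [nv]
      simp only [this, hM, Matrix.cons_val]
      show q - _ = 0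
      simp only [s]; module)
  have fut : ∀ n, IsN n → n 0 = 1 → M n = F n := by
    intro n hn h0
    have h2 := hn.2
    simp only [mink, h0] at h2
    have := hz ![n 1, n 2, n 3] (by simp only [dotProduct, Fin.sum_univ_three, Matrix.cons_val]; linarith)
    have e : nv ![n 1, n 2, n 3] = n := by ext i; fin_cases i <;> simp [nv, h0]
    simp only [e] at this
    exact (sub_eq_zero.1 this).symm
  refine ⟨M, fun n hn => ?_⟩
  rcases hn.cases with h | h
  · exact fut n hn h
  · have := fut (-n) hn.neg (by simp [h])
    rw [map_neg, hneg n hn] at this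
    exact neg_injective this



lemma lin_expand (M : (Fin 4 → ℝ) →ₗ[ℝ] (Fin 4 → ℝ)) (x : Fin 4 → ℝ) :
    M x = x 0 • M (Pi.single 0 1) + x 1 • M (Pi.single 1 1) + x 2 • M (Pi.single 2 1) + x 3 • M (Pi.single 3 1) := by
  simp only [← map_smul, ← map_add]
  congr 1
  ext i; fin_cases i <;> simp

lemma exists_conf (M : (Fin 4 → ℝ) →ₗ[ℝ] (Fin 4 → ℝ)) (h : ∀ n, IsN n → mink (M n) (M n) = 0) :
    ∃ lam : ℝ, ∀ x y, mink (M x) (M y) = lam * mink x y := by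
  have N : ∀ x y z : ℝ, x ^ 2 + y ^ 2 + z ^ 2 = 1 → mink (M ![1, x, y, z]) (M ![1, x, y, z]) = 0 := by
    intro x y z hxyz
    refine h _ ⟨by simp, ?_⟩
    simp only [mink, Matrix.cons_val]; linarith
  have p1 := N 1 0 0 (by norm_num)
  have p2 := N 0 1 0 (by norm_num)
  have p3 := N 0 0 1 (by norm_num)
  have m1 := N (-1) 0 0 (by norm_num)
  have m2 := N 0 (-1) 0 (by norm_num)
  have m3 := N 0 0 (-1) (by norm_num)
  have q1 := N (3/5) (4/5) 0 (by norm_num)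
  have q2 := N 0 (3/5) (4/5) (by norm_num)
  have q3 := N (4/5) 0 (3/5) (by norm_num)
  refine ⟨mink (M (Pi.single 0 1)) (M (Pi.single 0 1)), fun x y => ?_⟩
  rw [lin_expand M x, lin_expand M y]
  rw [lin_expand M ![_, _, _, _]] at p1 p2 p3 m1 m2 m3 q1 q2 q3
  simp only [Matrix.cons_val] at p1 p2 p3 m1 m2 m3 q1 q2 q3
  generalize M (Pi.single 0 1) = E0 at *
  generalize M (Pi.single 1 1) = E1 at *
  generalize M (Pi.single 2 1) = E2 at *
  generalize M (Pi.single 3 1) = E3 at *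
  simp only [mink_add_left, mink_add_right, mink_smul_left, mink_smul_right] at *
  rw [mink_comm E1 E0, mink_comm E2 E0, mink_comm E3 E0, mink_comm E2 E1, mink_comm E3 E1, mink_comm E3 E2] at *
  have b01 : mink E0 E1 = 0 := by linarith
  have b02 : mink E0 E2 = 0 := by linarith
  have b03 : mink E0 E3 = 0 := by linarith
  have b11 : mink E1 E1 = - mink E0 E0 := by linarith
  have b22 : mink E2 E2 = - mink E0 E0 := by linarith
  have b33 : mink E3 E3 = - mink E0 E0 := by linarith
  have b12 : mink E1 E2 = 0 := by linarith
  have b23 : mink E2 E3 = 0 := by linarith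
  have b13 : mink E1 E3 = 0 := by linarith
  rw [b01, b02, b03, b11, b22, b33, b12, b23, b13]
  simp only [mink]
  ring

lemma act_invol {τ f φ} (hτ : Good τ) (hA : Act τ f φ) {n : Fin 4 → ℝ} (hn : IsN n) :
    f (f n) = n ∧ ∀ a, φ (f n) (φ n a) = a := by
  obtain ⟨m, hv⟩ := exists_partner hn
  obtain ⟨hv1, e1⟩ := hA.2 n m hv
  obtain ⟨hv2, e2⟩ := hA.2 _ _ hv1
  have key : ∀ a b, wd (f (f n)) (φ (f n) (φ n a)) (f (f m)) (φ (f m) (φ m b)) = wd n a m b := by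
    intro a b
    rw [← e2, ← e1, hτ.invol a b hv]
  have hnm := hv.ne
  have hff : f (f n) = n := by
    rcases wd_sub_wd hv hv2 (key 0 (φ (f n) (φ n 0) - 1)).ge with h | h
    · exact h.1
    · linarith [h.2.2.1]
  refine ⟨hff, fun a => le_antisymm ?_ ?_⟩
  · rcases wd_sub_wd hv hv2 (key a 0).ge with h | h
    · exact h.2.2.1
    · exact absurd (hff.symm.trans h.1) hnm
  · rcases wd_sub_wd hv2 hv (key a 0).le with h | h
    · exact h.2.2.1
    · exact absurd (hff.symm.trans h.2.1.symm) hnm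

lemma good_poincare {τ} (hτ : Good τ) : ∃ (Λ : Matrix (Fin 4) (Fin 4) ℝ) (v : Fin 4 → ℝ),
    (∀ x y, mink (Λ.mulVec x) (Λ.mulVec y) = mink x y) ∧
    ∀ n m a b, Valid n m → τ (wd n a m b) = (fun x => Λ.mulVec x + v) '' wd n a m b := by
  obtain ⟨f, φ, hA'⟩ := exists_rep hτ
  have hA : Act τ f φ := hA'
  obtain ⟨c, d, h1, h2⟩ := act_affine hτ hA
  obtain ⟨M', hM'⟩ := exists_linear (F := fun n => ((c n)⁻¹ • f n, (c n)⁻¹ * d n)) (by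
      intro n hn
      obtain ⟨-, -, e1, e2, e3⟩ := h1 n hn
      simp [e1, e2, e3]) (by
      intro n hn l hl hs
      obtain ⟨e1, e2⟩ := h2 n hn l hl hs
      refine Prod.ext ?_ ?_
      · rw [Prod.fst_sum]; exact e1
      · rw [Prod.snd_sum]; exact e2)
  let M : (Fin 4 → ℝ) →ₗ[ℝ] (Fin 4 → ℝ) := LinearMap.fst ℝ _ _ ∘ₗ M'
  let D : (Fin 4 → ℝ) →ₗ[ℝ] ℝ := LinearMap.snd ℝ _ _ ∘ₗ M'
  have hf : ∀ n, IsN n → f n = c n • M n := by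
    intro n hn
    have : M n = (c n)⁻¹ • f n := congrArg Prod.fst (hM' n hn)
    rw [this, smul_inv_smul₀ (h1 n hn).1.ne']
  have hd : ∀ n, IsN n → d n = c n * D n := by
    intro n hn
    have : D n = (c n)⁻¹ * d n := congrArg Prod.snd (hM' n hn)
    rw [this, mul_inv_cancel_left₀ (h1 n hn).1.ne']
  clear_value M D
  have fN : ∀ n, IsN n → IsN (f n) := by
    intro n hn
    obtain ⟨m, hv⟩ := exists_partner hn
    exact (hA.2 n m hv).1.1
  obtain ⟨lam, hlam⟩ := exists_conf M (by
    intro n hn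
    have h3 := (fN n hn).2
    rw [hf n hn, mink_smul_left, mink_smul_right] at h3
    have := (h1 n hn).1.ne'
    simpa [this] using h3)
  have MM : ∀ n, IsN n → M (M n) = n := by
    intro n hn
    obtain ⟨e1, e2⟩ := act_invol hτ hA hn
    have hfn := fN n hn
    have hc : c (f n) * c n = 1 := by
      have a0 := e2 0
      have a1 := e2 1
      rw [(h1 n hn).2.1, (h1 _ hfn).2.1] at a0 a1
      linarith
    rw [hf _ hfn] at e1
    nth_rewrite 2 [hf n hn] at e1
    rwa [map_smul, ← mul_smul, hc, one_smul] at e1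
  have n0 : IsN ![1, 1, 0, 0] := by constructor <;> simp [mink]
  obtain ⟨m0, hv0⟩ := exists_partner n0
  have lam1 : lam = 1 := by
    have h3 := hlam (M ![1, 1, 0, 0]) (M m0)
    rw [MM _ n0, MM _ hv0.2.1, hlam] at h3
    have h4 := hv0.mink_neg
    have h5 := (hA.2 _ _ hv0).1.mink_neg
    rw [hf _ n0, hf _ hv0.2.1, mink_smul_left, mink_smul_right, hlam] at h5
    have c1 := (h1 _ n0).1
    have c2 := (h1 _ hv0.2.1).1
    have h6 : lam * mink ![1, 1, 0, 0] m0 < 0 := by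
      by_contra hcon
      push Not at hcon
      have := mul_nonneg c1.le (mul_nonneg c2.le hcon)
      linarith
    have h7 : 0 < lam := by nlinarith
    have h8 : lam * lam = 1 := mul_right_cancel₀ h4.ne (by linarith)
    nlinarith
  subst lam1
  simp only [one_mul] at hlam
  have Minj : Function.Injective M := by
    rw [← LinearMap.ker_eq_bot, LinearMap.ker_eq_bot']
    intro x hx
    apply mink_nondeg
    intro y
    rw [← hlam, hx]; simp [mink]
  have Msurj : Function.Surjective M := LinearMap.injective_iff_surjective.1 Minj
  obtain ⟨w, hw⟩ : ∃ w, ∀ x, D x = mink w x := by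
    refine ⟨![D (Pi.single 0 1), -D (Pi.single 1 1), -D (Pi.single 2 1), -D (Pi.single 3 1)], fun x => ?_⟩
    have : x = x 0 • Pi.single 0 1 + x 1 • Pi.single 1 1 + x 2 • Pi.single 2 1 + x 3 • Pi.single 3 1 := by
      ext i; fin_cases i <;> simp
    have e := congrArg D this
    simp only [map_add, map_smul, smul_eq_mul] at e
    rw [e]
    simp only [mink, Matrix.cons_val]
    ring
  have hmv : ∀ x, (LinearMap.toMatrix' M).mulVec x = M x := fun x => LinearMap.toMatrix'_mulVec M x
  refine ⟨LinearMap.toMatrix' M, M w, fun x y => by rw [hmv, hmv, hlam], fun n m a b hv => ?_⟩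
  have side : ∀ n a, IsN n → hs (f n) (φ n a) = hs (M n) (a + D n) := by
    intro n a hn
    rw [(h1 n hn).2.1, hd n hn, hf n hn, ← mul_add, hs_scale (h1 n hn).1]
  rw [(hA.2 n m hv).2, wd, side n a hv.1, side m b hv.2.1]
  have mem : ∀ x n a, M x + M w ∈ hs (M n) (a + D n) ↔ x ∈ hs n a := by
    intro x n a
    simp only [hs, Set.mem_ofPred_eq]
    rw [mink_add_left, hlam, hlam, hw]
    simp
  ext z
  simp only [Set.mem_image, hmv]
  constructor
  · rintro hz
    obtain ⟨x, hx⟩ := Msurj (z - M w)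
    obtain rfl : M x + M w = z := by rw [hx]; simp
    exact ⟨x, ⟨(mem _ _ _).1 hz.1, (mem _ _ _).1 hz.2⟩, rfl⟩
  · rintro ⟨x, hx, rfl⟩
    exact ⟨(mem _ _ _).2 hx.1, (mem _ _ _).2 hx.2⟩

/-- Let `τ` be an involutive bijection of the set of wedges which
preserves inclusions and maps pairs of wedges with disjoint closures to disjoint
wedges.  Then `τ` is implemented by an element of the full Poincaré group: there are
a real 4×4 matrix `Λ` preserving the Minkowski form and a translation `a` such that
`τ W = Λ W + a` for every wedge `W`. -/
theorem wedge_transform_is_poincare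
    (τ : Set (Fin 4 → ℝ) → Set (Fin 4 → ℝ))
    (hmaps : ∀ W ∈ WedgeSet, τ W ∈ WedgeSet)
    (hinvol : ∀ W ∈ WedgeSet, τ (τ W) = W)
    (hmono : ∀ W₁ ∈ WedgeSet, ∀ W₂ ∈ WedgeSet, W₁ ⊆ W₂ → τ W₁ ⊆ τ W₂)
    (hdisj : ∀ W₁ ∈ WedgeSet, ∀ W₂ ∈ WedgeSet,
      closure W₁ ∩ closure W₂ = ∅ → τ W₁ ∩ τ W₂ = ∅) :
    ∃ (Λ : Matrix (Fin 4) (Fin 4) ℝ) (a : Fin 4 → ℝ),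
      (∀ x y, mink (Λ.mulVec x) (Λ.mulVec y) = mink x y) ∧
      ∀ W ∈ WedgeSet, τ W = (fun x => Λ.mulVec x + a) '' W := by
  have mem : ∀ {n m : Fin 4 → ℝ} (a b : ℝ), Valid n m → wd n a m b ∈ WedgeSet :=
    fun a b hv => (wedge_iff _).2 ⟨_, a, _, b, hv, rfl⟩
  have hτ : Good τ :=
    { maps := fun a b hv => (wedge_iff _).1 (hmaps _ (mem a b hv))
      invol := fun a b hv => hinvol _ (mem a b hv)
      mono := fun hv hv' h => hmono _ (mem _ _ hv) _ (mem _ _ hv') h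
      disj := fun hv hv' h => hdisj _ (mem _ _ hv) _ (mem _ _ hv') h }
  obtain ⟨Λ, v, h1, h2⟩ := good_poincare hτ
  refine ⟨Λ, v, h1, fun W hW => ?_⟩
  obtain ⟨n, a, m, b, hv, rfl⟩ := (wedge_iff W).1 hW
  exact h2 n m a b hv
end
end

section
/- Let D ⊂ ℝ⁴ be a double cone and x ∈ ℝ⁴ with cl(D) + x ⊆ W_r. Set Γ(D+x) = {g ∈ 𝓛₊↑ : cl(D) + x ⊆ g W_r} and, for g ∈ 𝓛₊↑, write Λ_{gW_r}(t) := g Λ_{W_r}(t) g⁻¹. Then there exist g₁, …, g₆ ∈ Γ(D+x) and T₁, …, T₆ > 0 such that D + x ⊆ Λ_{g₆W_r}(t₆) ⋯ Λ_{g₁W_r}(t₁) W_r whenever |tᵢ| < Tᵢ for i = 1, …, 6. Moreover g₁, …, g₆ can be chosen so that the six matrices gᵢ M₀ gᵢ⁻¹ are linearly independent, where M₀ = (d/dt)|_{t=0} Λ_{W_r}(t) is the generator of the boost group of W_r. -/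
noncomputable section

open Real

/-- The generator `M₀ = (d/dt)|₀ Λ_{W_r}(t)` of the boost group of the right wedge. -/
def boostGen : Matrix (Fin 4) (Fin 4) ℝ :=
  Matrix.of fun i j => deriv (fun t : ℝ => boost t i j) 0

/-- The boost group of the wedge `g W_r`: `Λ_{gW_r}(t) = g Λ_{W_r}(t) g⁻¹`. -/
def boostConj (g : Matrix (Fin 4) (Fin 4) ℝ) (t : ℝ) : Matrix (Fin 4) (Fin 4) ℝ :=
  g * boost t * g⁻¹

def gR2 (c s : ℝ) : Matrix (Fin 4) (Fin 4) ℝ := !![1,0,0,0; 0,c,-s,0; 0,s,c,0; 0,0,0,1]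
def gR3 (c s : ℝ) : Matrix (Fin 4) (Fin 4) ℝ := !![1,0,0,0; 0,c,0,-s; 0,0,1,0; 0,s,0,c]
def gB2 (c s : ℝ) : Matrix (Fin 4) (Fin 4) ℝ := !![c,0,s,0; 0,1,0,0; s,0,c,0; 0,0,0,1]
def gB3 (c s : ℝ) : Matrix (Fin 4) (Fin 4) ℝ := !![c,0,0,s; 0,1,0,0; 0,0,1,0; s,0,0,c]

/-- The family of six Lorentz transformations. -/
def gFam (e : ℝ) : Fin 6 → Matrix (Fin 4) (Fin 4) ℝ :=
  ![1, gR2 (cos e) (sin e), gR3 (cos e) (sin e), gB2 (cosh e) (sinh e), gB3 (cosh e) (sinh e),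
    gB3 (cosh e) (sinh e) * gR2 (cos e) (sin e)]

/-- Their inverses. -/
def hFam (e : ℝ) : Fin 6 → Matrix (Fin 4) (Fin 4) ℝ :=
  ![1, gR2 (cos e) (-sin e), gR3 (cos e) (-sin e), gB2 (cosh e) (-sinh e), gB3 (cosh e) (-sinh e),
    gR2 (cos e) (-sin e) * gB3 (cosh e) (-sinh e)]

lemma gR2_mul (c s : ℝ) (h : c ^ 2 + s ^ 2 = 1) : gR2 c s * gR2 c (-s) = 1 := by
  ext i j
  fin_cases i <;> fin_cases j <;> simp [gR2, Matrix.mul_apply, Fin.sum_univ_four] <;> linarith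

lemma gR3_mul (c s : ℝ) (h : c ^ 2 + s ^ 2 = 1) : gR3 c s * gR3 c (-s) = 1 := by
  ext i j
  fin_cases i <;> fin_cases j <;> simp [gR3, Matrix.mul_apply, Fin.sum_univ_four] <;> linarith

lemma gB2_mul (c s : ℝ) (h : c ^ 2 - s ^ 2 = 1) : gB2 c s * gB2 c (-s) = 1 := by
  ext i j
  fin_cases i <;> fin_cases j <;> simp [gB2, Matrix.mul_apply, Fin.sum_univ_four] <;> linarith

lemma gB3_mul (c s : ℝ) (h : c ^ 2 - s ^ 2 = 1) : gB3 c s * gB3 c (-s) = 1 := by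
  ext i j
  fin_cases i <;> fin_cases j <;> simp [gB3, Matrix.mul_apply, Fin.sum_univ_four] <;> linarith

lemma gFam_mul_hFam (e : ℝ) (i : Fin 6) : gFam e i * hFam e i = 1 := by
  have h1 := cos_sq_add_sin_sq e
  have h2 := cosh_sq_sub_sinh_sq e
  fin_cases i
  · simp [gFam, hFam]
  · exact gR2_mul _ _ h1
  · exact gR3_mul _ _ h1
  · exact gB2_mul _ _ h2
  · exact gB3_mul _ _ h2
  · change gB3 _ _ * gR2 _ _ * (gR2 _ _ * gB3 _ _) = 1
    rw [mul_assoc, ← mul_assoc (gR2 _ _), gR2_mul _ _ h1, one_mul, gB3_mul _ _ h2]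

lemma gR2_mem (c s : ℝ) (h : c ^ 2 + s ^ 2 = 1) : gR2 c s ∈ LorentzPO := by
  refine ⟨fun x y => ?_, ?_, ?_⟩
  · simp [gR2, mink, Matrix.mulVec, dotProduct, Fin.sum_univ_four]
    linear_combination (-x 1 * y 1 - x 2 * y 2) * h
  · simp [gR2, Matrix.det_succ_row_zero, Fin.sum_univ_succ, Fin.succAbove]
    linarith
  · simp [gR2]

lemma gR3_mem (c s : ℝ) (h : c ^ 2 + s ^ 2 = 1) : gR3 c s ∈ LorentzPO := by
  refine ⟨fun x y => ?_, ?_, ?_⟩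
  · simp [gR3, mink, Matrix.mulVec, dotProduct, Fin.sum_univ_four]
    linear_combination (-x 1 * y 1 - x 3 * y 3) * h
  · simp [gR3, Matrix.det_succ_row_zero, Fin.sum_univ_succ, Fin.succAbove]
    linarith
  · simp [gR3]

lemma gB2_mem (c s : ℝ) (h : c ^ 2 - s ^ 2 = 1) (hc : 0 < c) : gB2 c s ∈ LorentzPO := by
  refine ⟨fun x y => ?_, ?_, ?_⟩
  · simp [gB2, mink, Matrix.mulVec, dotProduct, Fin.sum_univ_four]
    linear_combination (x 0 * y 0 - x 2 * y 2) * h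
  · simp [gB2, Matrix.det_succ_row_zero, Fin.sum_univ_succ, Fin.succAbove]
    linarith
  · simpa [gB2]

lemma gB3_mem (c s : ℝ) (h : c ^ 2 - s ^ 2 = 1) (hc : 0 < c) : gB3 c s ∈ LorentzPO := by
  refine ⟨fun x y => ?_, ?_, ?_⟩
  · simp [gB3, mink, Matrix.mulVec, dotProduct, Fin.sum_univ_four]
    linear_combination (x 0 * y 0 - x 3 * y 3) * h
  · simp [gB3, Matrix.det_succ_row_zero, Fin.sum_univ_succ, Fin.succAbove]
    linarith
  · simpa [gB3]

lemma gFam_mem (e : ℝ) (i : Fin 6) : gFam e i ∈ LorentzPO := by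
  have h1 := cos_sq_add_sin_sq e
  have h2 := cosh_sq_sub_sinh_sq e
  have h3 := cosh_pos e
  fin_cases i
  · exact ⟨by simp [gFam], by simp [gFam], by simp [gFam]⟩
  · exact gR2_mem _ _ h1
  · exact gR3_mem _ _ h1
  · exact gB2_mem _ _ h2 h3
  · exact gB3_mem _ _ h2 h3
  · change gB3 _ _ * gR2 _ _ ∈ LorentzPO
    obtain ⟨a1, a2, -⟩ := gB3_mem _ _ h2 h3
    obtain ⟨b1, b2, -⟩ := gR2_mem _ _ h1
    refine ⟨fun x y => ?_, ?_, ?_⟩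
    · rw [← Matrix.mulVec_mulVec, ← Matrix.mulVec_mulVec, a1, b1]
    · rw [Matrix.det_mul, a2, b2, one_mul]
    · simpa [gB3, gR2, Matrix.mul_apply, Fin.sum_univ_four] using h3

lemma boostGen_eq : boostGen = (-(2 * π)) • !![0,1,0,0; 1,0,0,0; 0,0,0,0; 0,0,0,0] := by
  have hc : deriv (fun t : ℝ => cosh (2 * π * t)) 0 = 0 := by
    have : HasDerivAt (fun t : ℝ => cosh (2 * π * t)) (sinh (2 * π * 0) * (2 * π * 1)) 0 :=
      ((hasDerivAt_id (0:ℝ)).const_mul (2 * π)).cosh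
    simpa using this.deriv
  have hs : deriv (fun t : ℝ => - sinh (2 * π * t)) 0 = -(2 * π) := by
    have : HasDerivAt (fun t : ℝ => - sinh (2 * π * t)) (-(cosh (2 * π * 0) * (2 * π * 1))) 0 :=
      ((hasDerivAt_id (0:ℝ)).const_mul (2 * π)).sinh.neg
    simpa using this.deriv
  ext i j
  fin_cases i <;> fin_cases j <;> simp [boostGen, boost, hc] <;> simpa using hs

lemma gFam_indep (e : ℝ) (he : 0 < e) (he1 : e < 1) :
    LinearIndependent ℝ (fun i => gFam e i * boostGen * (gFam e i)⁻¹) := by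
  have hs : 0 < sin e := sin_pos_of_pos_of_lt_pi he (by linarith [pi_gt_three])
  have hsh : 0 < sinh e := sinh_pos_iff.2 he
  have hch : 0 < cosh e := cosh_pos e
  have h1 := cos_sq_add_sin_sq e
  have h2 := cosh_sq_sub_sinh_sq e
  have hinv : ∀ i, (gFam e i)⁻¹ = hFam e i := fun i =>
    Matrix.inv_eq_right_inv (gFam_mul_hFam e i)
  simp only [hinv]
  rw [Fintype.linearIndependent_iff]
  intro v hv
  have E : ∀ i j, (∑ k, v k • (gFam e k * !![0,1,0,0; 1,0,0,0; 0,0,0,0; 0,0,0,0] * hFam e k) :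
      Matrix (Fin 4) (Fin 4) ℝ) i j
      = 0 := by
    intro i j
    have := congrFun (congrFun hv i) j
    simp only [boostGen_eq, Matrix.mul_smul, Matrix.smul_mul, smul_comm _ (-(2 * π)),
      ← Finset.smul_sum] at this
    simpa [pi_ne_zero] using this
  have e01 := E 0 1
  have e02 := E 0 2
  have e03 := E 0 3
  have e12 := E 1 2
  have e13 := E 1 3
  have e23 := E 2 3
  clear E hv
  simp [Fin.sum_univ_six, gFam, hFam, gR2, gR3, gB2, gB3] at e01 e02 e03 e12 e13 e23
  have v5 : v 5 = 0 := by simpa [hs.ne', he.ne'] using e23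
  have v3 : v 3 = 0 := by simpa [he.ne'] using e12
  have v2 : v 2 = 0 := by simpa [hs.ne'] using e03
  have v1 : v 1 = 0 := by simpa [v5, hs.ne'] using e02
  have v4 : v 4 = 0 := by simpa [v5, he.ne'] using e13
  have v0 : v 0 = 0 := by simpa [v1, v2, v3, v4, v5] using e01
  intro i
  fin_cases i <;> assumption

lemma eventually_wedge {X : Type*} [TopologicalSpace X] (K : Set (Fin 4 → ℝ)) (hK : IsCompact K)
    (hW : K ⊆ rightWedge) (f : X → Matrix (Fin 4) (Fin 4) ℝ) (hf : Continuous f) (p : X)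
    (hp : f p = 1) : ∀ᶠ q in nhds p, ∀ k ∈ K, (f q).mulVec k ∈ rightWedge := by
  have ho : IsOpen rightWedge := isOpen_lt (by fun_prop) (by fun_prop)
  refine hK.eventually_forall_of_forall_eventually fun k hk => ?_
  have hc : Continuous fun z : X × (Fin 4 → ℝ) => (f z.1).mulVec z.2 := by fun_prop
  apply hc.continuousAt.eventually_mem
  apply ho.mem_nhds
  simpa [hp] using hW hk

lemma isCompact_closure_doubleCone (D : Set (Fin 4 → ℝ)) (hD : IsDoubleCone D) :
    IsCompact (closure D) := by
  obtain ⟨a, b, -, rfl⟩ := hD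
  set r := b 0 - a 0
  have : {x | x - a ∈ fwdCone ∧ b - x ∈ fwdCone} ⊆
      Set.Icc (fun i => a i - r) (fun i => a i + r) := by
    rintro y ⟨⟨h1, h2⟩, h3, -⟩
    simp only [mink, Pi.sub_apply] at h1 h2 h3
    have hb : ∀ i, |y i - a i| ≤ y 0 - a 0 := by
      intro i
      apply abs_le_of_sq_le_sq _ h1.le
      fin_cases i <;> simp <;> 
        nlinarith [sq_nonneg (y 1 - a 1), sq_nonneg (y 2 - a 2), sq_nonneg (y 3 - a 3)]
    constructor <;> intro i <;> have := abs_le.1 (hb i) <;> simp only [r] <;> linarith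
  exact (Metric.isBounded_Icc _ _).subset this |>.isCompact_closure

lemma boost_mul (t : ℝ) : boost t * boost (-t) = 1 := by
  have h2 := cosh_sq_sub_sinh_sq (2 * π * t)
  ext i j
  fin_cases i <;> fin_cases j <;> simp [boost, Matrix.mul_apply, Fin.sum_univ_four] <;> linarith

lemma continuous_boost : Continuous boost := by
  refine continuous_matrix fun i j => ?_
  simp only [boost, Matrix.of_apply]
  split_ifs <;> fun_prop

lemma boost_zero : boost 0 = 1 := by
  ext i j
  fin_cases i <;> fin_cases j <;> simp [boost]

lemma continuous_hFam (i : Fin 6) : Continuous fun e => hFam e i := by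
  refine continuous_matrix fun a b => ?_
  fin_cases i <;> simp [hFam, gR2, gR3, gB2, gB3] <;>
    fin_cases a <;> fin_cases b <;> simp <;> fun_prop

lemma hFam_zero (i : Fin 6) : hFam 0 i = 1 := by
  ext a b
  fin_cases i <;> simp [hFam, gR2, gR3, gB2, gB3] <;>
    fin_cases a <;> fin_cases b <;> simp

lemma boostConj_mul (e : ℝ) (i : Fin 6) (t : ℝ) :
    boostConj (gFam e i) t * boostConj (gFam e i) (-t) = 1 := by
  have h := gFam_mul_hFam e i
  have h' : hFam e i * gFam e i = 1 := mul_eq_one_comm.1 h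
  have hinv : (gFam e i)⁻¹ = hFam e i := Matrix.inv_eq_right_inv h
  simp only [boostConj, hinv]
  calc _ = gFam e i * (boost t * (hFam e i * gFam e i) * boost (-t)) * hFam e i := by
        simp only [mul_assoc]
    _ = 1 := by rw [h', mul_one, boost_mul, mul_one, h]

lemma boostConj_zero (e : ℝ) (i : Fin 6) : boostConj (gFam e i) 0 = 1 := by
  have h := gFam_mul_hFam e i
  have hinv : (gFam e i)⁻¹ = hFam e i := Matrix.inv_eq_right_inv h
  simp only [boostConj, hinv, boost_zero, mul_one, h]

lemma continuous_boostConj (g : Matrix (Fin 4) (Fin 4) ℝ) : Continuous (boostConj g) := by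
  unfold boostConj
  have := continuous_boost
  fun_prop

lemma mul_six {M : Type*} [Monoid M] {a b c d e f a' b' c' d' e' f' : M} (ha : a * a' = 1)
    (hb : b * b' = 1) (hc : c * c' = 1) (hd : d * d' = 1) (he : e * e' = 1) (hf : f * f' = 1) :
    (f * e * d * c * b * a) * (a' * b' * c' * d' * e' * f') = 1 := by
  have h : ∀ {p q : M} (r : M), p * q = 1 → p * (q * r) = r := fun r h => by
    rw [← mul_assoc, h, one_mul]
  simp only [mul_assoc, h _ ha, h _ hb, h _ hc, h _ hd, h _ he, hf]

/-- Let `D` be a double cone and `x` such that `cl(D) + x ⊆ W_r`.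
Then there are `g₁, …, g₆` in `Γ(D+x) = {g ∈ 𝓛₊↑ : cl(D)+x ⊆ gW_r}` and `T₁, …, T₆ > 0`
such that `D + x ⊆ Λ_{g₆W_r}(t₆) ⋯ Λ_{g₁W_r}(t₁) W_r` whenever `|tᵢ| < Tᵢ`; moreover the
`gᵢ` can be chosen so that the conjugated generators `gᵢ M₀ gᵢ⁻¹` are linearly
independent. -/
theorem boosts_around_double_cone
    (D : Set (Fin 4 → ℝ)) (hD : IsDoubleCone D) (x : Fin 4 → ℝ)
    (hDx : (fun y => y + x) '' closure D ⊆ rightWedge) :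
    ∃ (g : Fin 6 → Matrix (Fin 4) (Fin 4) ℝ) (T : Fin 6 → ℝ),
      (∀ i, g i ∈ LorentzPO ∧
        (fun y => y + x) '' closure D ⊆ (fun y => (g i).mulVec y) '' rightWedge) ∧
      (∀ i, 0 < T i) ∧
      (∀ t : Fin 6 → ℝ, (∀ i, |t i| < T i) →
        (fun y => y + x) '' D ⊆
          (fun y => (boostConj (g 5) (t 5) * boostConj (g 4) (t 4) * boostConj (g 3) (t 3) *
            boostConj (g 2) (t 2) * boostConj (g 1) (t 1) * boostConj (g 0) (t 0)).mulVec y) ''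
            rightWedge) ∧
      LinearIndependent ℝ (fun i => g i * boostGen * (g i)⁻¹) := by
  have hK : IsCompact ((fun y => y + x) '' closure D) :=
    (isCompact_closure_doubleCone D hD).image (by fun_prop)
  have hev : ∀ᶠ e in nhds (0:ℝ), ∀ i, ∀ k ∈ (fun y => y + x) '' closure D,
      (hFam e i).mulVec k ∈ rightWedge :=
    Filter.eventually_all.2 fun i =>
      eventually_wedge _ hK hDx (fun e => hFam e i) (continuous_hFam i) 0 (hFam_zero i)
  obtain ⟨δ, hδ, hball⟩ := Metric.eventually_nhds_iff.1 hev
  obtain ⟨e, he0, heδ⟩ := exists_between (lt_min hδ one_pos)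
  have hh := hball (y := e) (by
    rw [Real.dist_eq, sub_zero, abs_of_pos he0]; exact heδ.trans_le (min_le_left _ _))
  set P : (Fin 6 → ℝ) → Matrix (Fin 4) (Fin 4) ℝ := fun t =>
    boostConj (gFam e 0) (-t 0) * boostConj (gFam e 1) (-t 1) * boostConj (gFam e 2) (-t 2) *
      boostConj (gFam e 3) (-t 3) * boostConj (gFam e 4) (-t 4) * boostConj (gFam e 5) (-t 5)
    with hP
  have hPc : Continuous P := by
    have := fun i => continuous_boostConj (gFam e i)
    fun_prop
  have hP0 : P 0 = 1 := by simp [hP, boostConj_zero]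
  obtain ⟨T, hT, hTb⟩ := Metric.eventually_nhds_iff.1 (eventually_wedge _ hK hDx P hPc 0 hP0)
  refine ⟨gFam e, fun _ => T, fun i => ⟨gFam_mem e i, fun k hk => ⟨_, hh i k hk, ?_⟩⟩,
    fun _ => hT, fun t ht k hk => ⟨_, hTb (y := t) ?_ k ?_, ?_⟩,
    gFam_indep e he0 (heδ.trans_le (min_le_right _ _))⟩
  · simp [Matrix.mulVec_mulVec, gFam_mul_hFam]
  · rw [dist_zero_right, pi_norm_lt_iff hT]
    exact ht
  · exact Set.image_mono subset_closure hk
  · simp only [Matrix.mulVec_mulVec]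
    rw [mul_six (boostConj_mul e 0 _) (boostConj_mul e 1 _) (boostConj_mul e 2 _)
      (boostConj_mul e 3 _) (boostConj_mul e 4 _) (boostConj_mul e 5 _), Matrix.one_mulVec]
end
end

section
/- Let H be a complex Hilbert space and U a unitary representation of 𝓛₊↑ on H (a group homomorphism into the unitary group of H) such that Λ ↦ ⟨φ, U(Λ)ψ⟩ is continuous for all φ, ψ ∈ H. Let D ⊂ ℝ⁴ be a double cone with cl(D) ⊆ W_r and set Γ = {Λ ∈ 𝓛₊↑ : cl(D) ⊆ Λ W_r} (so the identity belongs to Γ). Let ψ ∈ H be such that for every Λ ∈ Γ there exists a bounded continuous function F_Λ from the closed strip {z ∈ ℂ : −1/2 ≤ Im z ≤ 0} to H, holomorphic on the open strip, with F_Λ(t) = U(Λ Λ_{W_r}(t) Λ⁻¹) ψ for all t ∈ ℝ. Then the vector U(Λ R_{W_r}(π) Λ⁻¹) F_Λ(−i/2) is independent of Λ ∈ Γ; that is, U(Λ R_{W_r}(π) Λ⁻¹) F_Λ(−i/2) = U(R_{W_r}(π)) F_1(−i/2) for every Λ ∈ Γ. -/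
noncomputable section

open Real

open scoped InnerProductSpace

/-- The rotation `R_{W_r}(π) = diag(1,1,−1,−1)` by π in the plane perpendicular to the
characteristic two-plane of the right wedge. -/
def rotPi : Matrix (Fin 4) (Fin 4) ℝ := Matrix.diagonal ![1, 1, -1, -1]

/-- The closed strip `{z : ℂ | -1/2 ≤ Im z ≤ 0}`. -/
def closedStripHalf : Set ℂ := {z | -(1/2 : ℝ) ≤ z.im ∧ z.im ≤ 0}

/-- The open strip `{z : ℂ | -1/2 < Im z < 0}`. -/
def openStripHalf : Set ℂ := {z | -(1/2 : ℝ) < z.im ∧ z.im < 0}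

/-- The square trick: a function vanishing on the real line vanishes just below it. -/
lemma strip_zero_near (g : ℂ → ℂ) (hc : ContinuousOn g closedStripHalf)
    (hd : DifferentiableOn ℂ g openStripHalf) (h0 : ∀ t : ℝ, g t = 0)
    (c : ℂ) (hc1 : -(1/4 : ℝ) < c.im) (hc2 : c.im < 0) : g c = 0 := by
  set δ : ℝ := -c.im with hδ
  have hδ0 : 0 < δ := by linarith
  have hδ1 : δ < 1/4 := by linarith
  set Q : Set ℂ := Set.Ioo (-δ) δ ×ℂ Set.Ioo (-δ) δ with hQ
  have hclQ : closure Q = Set.Icc (-δ) δ ×ℂ Set.Icc (-δ) δ := by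
    rw [hQ, Complex.closure_reProdIm, closure_Ioo (by linarith)]
  have hQo : IsOpen Q := isOpen_Ioo.reProdIm isOpen_Ioo
  have hQb : Bornology.IsBounded Q := (Metric.isBounded_Ioo _ _).reProdIm (Metric.isBounded_Ioo _ _)
  -- a rotated copy
  have key : ∀ a : ℂ, (a = 1 ∨ a = -1 ∨ a = Complex.I ∨ a = -Complex.I) →
      DiffContOnCl ℂ (fun z => g (c + a * z)) Q := by
    intro a ha
    refine ⟨?_, ?_⟩
    · refine hd.comp (by fun_prop) ?_
      intro z hz
      simp only [hQ, Complex.mem_reProdIm, Set.mem_Ioo] at hz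
      rcases ha with rfl | rfl | rfl | rfl <;> constructor <;> simp <;> linarith [hz.1.1, hz.1.2, hz.2.1, hz.2.2]
    · refine hc.comp (by fun_prop) ?_
      intro z hz
      rw [hclQ] at hz
      simp only [Complex.mem_reProdIm, Set.mem_Icc] at hz
      rcases ha with rfl | rfl | rfl | rfl <;> constructor <;> simp <;> linarith [hz.1.1, hz.1.2, hz.2.1, hz.2.2]
  have hreal : ∀ z : ℂ, z.im = 0 → g z = 0 := by
    intro z hz
    have : z = ((z.re : ℝ) : ℂ) := by apply Complex.ext <;> simp [hz]
    rw [this]; exact h0 _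
  let h : ℂ → ℂ := fun z => (g (c + 1 * z) * g (c + (-1) * z)) *
      (g (c + Complex.I * z) * g (c + (-Complex.I) * z))
  have hh : DiffContOnCl ℂ h Q :=
    ⟨((key 1 (by simp)).differentiableOn.mul (key (-1) (by simp)).differentiableOn).mul
      ((key Complex.I (by simp)).differentiableOn.mul (key (-Complex.I) (by simp)).differentiableOn),
     ((key 1 (by simp)).continuousOn.mul (key (-1) (by simp)).continuousOn).mul
      ((key Complex.I (by simp)).continuousOn.mul (key (-Complex.I) (by simp)).continuousOn)⟩
  have hfr : ∀ z ∈ frontier Q, ‖h z‖ ≤ 0 := by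
    intro z hz
    rw [frontier, hQo.interior_eq, hclQ] at hz
    obtain ⟨h1, h2⟩ := hz
    simp only [hQ, Complex.mem_reProdIm, Set.mem_Icc, Set.mem_Ioo] at h1 h2
    obtain ⟨⟨r1, r2⟩, ⟨i1, i2⟩⟩ := h1
    have hcases : z.im = δ ∨ z.im = -δ ∨ z.re = δ ∨ z.re = -δ := by
      by_contra hcon
      push Not at hcon
      exact h2 ⟨⟨lt_of_le_of_ne r1 (Ne.symm hcon.2.2.2), lt_of_le_of_ne r2 hcon.2.2.1⟩,
        ⟨lt_of_le_of_ne i1 (Ne.symm hcon.2.1), lt_of_le_of_ne i2 hcon.1⟩⟩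
    rw [norm_le_zero_iff]
    rcases hcases with hz | hz | hz | hz
    · have : g (c + 1 * z) = 0 := hreal _ (by simp [hz, hδ])
      simp only [h]; rw [this]; ring
    · have : g (c + (-1) * z) = 0 := hreal _ (by simp [hz, hδ])
      simp only [h]; rw [this]; ring
    · have : g (c + Complex.I * z) = 0 := hreal _ (by simp [hz, hδ])
      simp only [h]; rw [this]; ring
    · have : g (c + (-Complex.I) * z) = 0 := hreal _ (by simp [hz, hδ])
      simp only [h]; rw [this]; ring
  have h00 : (0:ℂ) ∈ closure Q := by
    rw [hclQ]; simp [Complex.mem_reProdIm, hδ0.le]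
  have := Complex.norm_le_of_forall_mem_frontier_norm_le hQb hh hfr h00
  rw [norm_le_zero_iff] at this
  simp only [h, mul_zero, add_zero] at this
  simpa using this

/-- Uniqueness: a function vanishing on the real line vanishes at `-i/2`. -/
lemma strip_zero (g : ℂ → ℂ) (hc : ContinuousOn g closedStripHalf)
    (hd : DifferentiableOn ℂ g openStripHalf) (h0 : ∀ t : ℝ, g t = 0) :
    g (-(Complex.I / 2)) = 0 := by
  have hopen : IsOpen openStripHalf :=
    (isOpen_lt continuous_const Complex.continuous_im).inter
      (isOpen_lt Complex.continuous_im continuous_const)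
  have hconv : Convex ℝ openStripHalf :=
    (convex_halfSpace_im_gt _).inter (convex_halfSpace_im_lt _)
  have han := hd.analyticOnNhd hopen
  let p : ℂ := -(Complex.I / 8)
  have hp : p ∈ openStripHalf := by constructor <;> simp [p] <;> norm_num
  have hev : g =ᶠ[nhds p] 0 := by
    have hU : IsOpen {z : ℂ | -(1/4 : ℝ) < z.im ∧ z.im < 0} :=
      (isOpen_lt continuous_const Complex.continuous_im).inter
        (isOpen_lt Complex.continuous_im continuous_const)
    refine Filter.eventually_of_mem (hU.mem_nhds (by constructor <;> simp [p] <;> norm_num)) ?_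
    intro z hz
    exact strip_zero_near g hc hd h0 z hz.1 hz.2
  have hz := han.eqOn_zero_of_preconnected_of_eventuallyEq_zero hconv.isPreconnected hp hev
  -- continuity along the segment
  have hq : -(Complex.I/2) ∈ closedStripHalf := by constructor <;> simp <;> norm_num
  let γ : ℝ → ℂ := fun s => -((s:ℂ) * Complex.I)
  have hγ : Filter.Tendsto γ (nhdsWithin (1/2) (Set.Ioo 0 (1/2))) (nhdsWithin (-(Complex.I/2)) closedStripHalf) := by
    refine tendsto_nhdsWithin_iff.2 ⟨?_, ?_⟩
    · have : Filter.Tendsto γ (nhds (1/2)) (nhds (γ (1/2))) := by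
        apply Continuous.tendsto; fun_prop
      have e : γ (1/2) = -(Complex.I/2) := by simp [γ]; ring
      rw [e] at this
      exact this.mono_left nhdsWithin_le_nhds
    · filter_upwards [self_mem_nhdsWithin] with s hs
      constructor <;> simp [γ] <;> linarith [hs.1, hs.2]
  have hlim := (hc _ hq).tendsto.comp hγ
  have hlim0 : Filter.Tendsto (g ∘ γ) (nhdsWithin (1/2) (Set.Ioo 0 (1/2))) (nhds 0) := by
    refine tendsto_const_nhds.congr' ?_
    filter_upwards [self_mem_nhdsWithin] with s hs
    symm
    apply hz
    constructor <;> simp [γ] <;> linarith [hs.1, hs.2]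
  have : (nhdsWithin (1/2:ℝ) (Set.Ioo 0 (1/2))).NeBot := by
    apply right_nhdsWithin_Ioo_neBot; norm_num
  exact tendsto_nhds_unique hlim hlim0

/-- Size of the complex Gaussian. -/
lemma gauss_norm_le (n : ℝ) (hn : 0 < n) (s R : ℝ) (w : ℂ) (hw : ‖w‖ ≤ R) :
    ‖Complex.exp (-(n:ℂ) * ((s:ℂ) - w)^2)‖ ≤ Real.exp (n * R^2) * Real.exp (-(n/2) * s^2) := by
  rw [Complex.norm_exp, ← Real.exp_add]
  apply Real.exp_le_exp.2
  have h1 : (-(n:ℂ) * ((s:ℂ) - w)^2).re = -n * ((s - w.re)^2 - w.im^2) := by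
    simp [pow_two]
  have h2 : w.re^2 + w.im^2 ≤ R^2 := by
    have : w.re^2 + w.im^2 = ‖w‖^2 := by
      rw [← Complex.normSq_eq_norm_sq, Complex.normSq_apply]; ring
    rw [this]; gcongr
  rw [h1]
  nlinarith [mul_nonneg hn.le (sq_nonneg (s - 2 * w.re)), mul_le_mul_of_nonneg_left h2 hn.le]

lemma gauss_integrable {E : Type*} [NormedAddCommGroup E] [NormedSpace ℂ E]
    (L : ℝ → E) (hL : Continuous L) (C : ℝ) (hC : ∀ s, ‖L s‖ ≤ C) (n : ℝ) (hn : 0 < n) (w : ℂ) :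
    MeasureTheory.Integrable (fun s : ℝ => Complex.exp (-(n:ℂ) * ((s:ℂ) - w)^2) • L s) := by
  have hC0 : 0 ≤ C := (norm_nonneg _).trans (hC 0)
  refine MeasureTheory.Integrable.mono'
    (((integrable_exp_neg_mul_sq (half_pos hn)).const_mul (Real.exp (n * ‖w‖^2))).mul_const C)
    (Continuous.aestronglyMeasurable (by fun_prop)) (Filter.Eventually.of_forall fun s => ?_)
  rw [norm_smul]
  exact mul_le_mul (gauss_norm_le n hn s _ w le_rfl) (hC s) (norm_nonneg _) (by positivity)

lemma gauss_differentiable {E : Type*} [NormedAddCommGroup E] [NormedSpace ℂ E]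
    (L : ℝ → E) (hL : Continuous L) (C : ℝ) (hC : ∀ s, ‖L s‖ ≤ C) (n : ℝ) (hn : 0 < n) :
    Differentiable ℂ (fun w : ℂ => ∫ s : ℝ, Complex.exp (-(n:ℂ) * ((s:ℂ) - w)^2) • L s) := by
  intro w₀
  have hC0 : 0 ≤ C := (norm_nonneg _).trans (hC 0)
  set R : ℝ := ‖w₀‖ + 1 with hR
  have hR0 : 0 ≤ R := by positivity
  have hbdint : MeasureTheory.Integrable (fun s : ℝ =>
      (2 * n * Real.exp (n * R^2)) * (‖s * Real.exp (-(n/2) * s^2)‖ + R * Real.exp (-(n/2) * s^2)) * C) :=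
    ((((integrable_mul_exp_neg_mul_sq (half_pos hn)).norm).add
      ((integrable_exp_neg_mul_sq (half_pos hn)).const_mul R)).const_mul _).mul_const C
  refine (hasDerivAt_integral_of_dominated_loc_of_deriv_le (μ := MeasureTheory.volume)
    (F := fun (w : ℂ) (s : ℝ) => Complex.exp (-(n:ℂ) * ((s:ℂ) - w)^2) • L s)
    (F' := fun (w : ℂ) (s : ℝ) =>
      (Complex.exp (-(n:ℂ) * ((s:ℂ) - w)^2) * (2 * (n:ℂ) * ((s:ℂ) - w))) • L s)
    (s := Metric.ball w₀ 1) (Metric.ball_mem_nhds _ one_pos)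
    (Filter.Eventually.of_forall fun w => Continuous.aestronglyMeasurable (by fun_prop))
    (gauss_integrable L hL C hC n hn w₀)
    (Continuous.aestronglyMeasurable (by fun_prop))
    (Filter.Eventually.of_forall fun s w hw => ?_) hbdint
    (Filter.Eventually.of_forall fun s w hw => ?_)).2.differentiableAt
  · have hwR : ‖w‖ ≤ R := by
      have h1 : ‖w - w₀‖ < 1 := by simpa [dist_eq_norm] using hw
      have h2 := norm_add_le (w - w₀) w₀
      rw [sub_add_cancel] at h2
      linarith
    have h3 := gauss_norm_le n hn s R w hwR
    have h4 : ‖(2 * (n:ℂ) * ((s:ℂ) - w))‖ ≤ 2 * n * (|s| + R) := by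
      rw [norm_mul, norm_mul]
      have h5 : ‖(s:ℂ) - w‖ ≤ |s| + R := by
        refine (norm_sub_le _ _).trans ?_
        rw [Complex.norm_real, Real.norm_eq_abs]; linarith
      have h6 : ‖(2:ℂ)‖ * ‖(n:ℂ)‖ = 2 * n := by
        simp [abs_of_pos hn]
      rw [h6]
      exact mul_le_mul_of_nonneg_left h5 (by positivity)
    rw [norm_smul, norm_mul]
    calc _ ≤ ((Real.exp (n * R^2) * Real.exp (-(n/2) * s^2)) * (2 * n * (|s| + R))) * C :=
          mul_le_mul (mul_le_mul h3 h4 (norm_nonneg _) (by positivity)) (hC s) (norm_nonneg _)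
            (by positivity)
      _ = _ := by
          rw [norm_mul, Real.norm_eq_abs, Real.norm_eq_abs, abs_of_pos (Real.exp_pos _)]; ring
  · have h1 : HasDerivAt (fun w : ℂ => -(n:ℂ) * ((s:ℂ) - w)^2) (2 * (n:ℂ) * ((s:ℂ) - w)) w := by
      have := (((hasDerivAt_id w).const_sub (s:ℂ)).pow 2).const_mul (-(n:ℂ))
      refine this.congr_deriv ?_
      simp only [id_eq]; push_cast; ring
    exact h1.cexp.smul_const (L s)

lemma gauss_limit (f : ℝ → ℂ) (hf : Continuous f) (C : ℝ) (hC : ∀ s, ‖f s‖ ≤ C)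
    (h : ∀ n : ℝ, 0 < n → ∫ s : ℝ, Complex.exp (-(n:ℂ) * (s:ℂ)^2) • f s = 0) : f 0 = 0 := by
  have hk : ∀ k : ℕ, ∫ u : ℝ, Complex.exp (-(u:ℂ)^2) • f (u / ((k:ℝ) + 1)) = 0 := by
    intro k
    have hk0 : (0:ℝ) < (k:ℝ) + 1 := by positivity
    have h1 := MeasureTheory.Measure.integral_comp_div
      (fun s : ℝ => Complex.exp (-((((k:ℝ)+1)^2 : ℝ):ℂ) * (s:ℂ)^2) • f s) ((k:ℝ)+1)
    rw [h _ (by positivity), smul_zero] at h1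
    rw [← h1]
    congr 1
    ext u
    congr 2
    have : ((k:ℂ)+1) ≠ 0 := by exact_mod_cast hk0.ne'
    push_cast
    field_simp
  have hlim : Filter.Tendsto (fun k : ℕ => ∫ u : ℝ, Complex.exp (-(u:ℂ)^2) • f (u / ((k:ℝ) + 1)))
      Filter.atTop (nhds (∫ u : ℝ, Complex.exp (-(u:ℂ)^2) • f 0)) := by
    refine MeasureTheory.tendsto_integral_of_dominated_convergence
      (fun u => Real.exp (-1 * u^2) * C) (fun k => Continuous.aestronglyMeasurable (by fun_prop))
      ((integrable_exp_neg_mul_sq one_pos).mul_const C)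
      (fun k => Filter.Eventually.of_forall fun u => ?_) (Filter.Eventually.of_forall fun u => ?_)
    · rw [norm_smul]
      have : ‖Complex.exp (-(u:ℂ)^2)‖ = Real.exp (-1 * u^2) := by
        rw [Complex.norm_exp]; congr 1; simp [pow_two]
      rw [this]
      exact mul_le_mul_of_nonneg_left (hC _) (Real.exp_pos _).le
    · refine Filter.Tendsto.const_smul ?_ _
      refine (hf.tendsto 0).comp ?_
      have := tendsto_one_div_add_atTop_nhds_zero_nat (𝕜 := ℝ)
      have := this.const_mul u
      simpa [div_eq_mul_inv] using this
  simp_rw [hk] at hlim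
  have h0 := tendsto_nhds_unique hlim tendsto_const_nhds
  rw [integral_smul_const] at h0
  have hg : ∫ u : ℝ, Complex.exp (-(u:ℂ)^2) ≠ 0 := by
    have := integral_gaussian_complex (b := 1) (by simp)
    simp only [neg_mul, one_mul] at this
    rw [this]
    simp [Real.pi_ne_zero]
  exact (smul_eq_zero.1 h0).resolve_left hg

/-- Main analytic lemma. -/
lemma continuation_lemma {H : Type*} [NormedAddCommGroup H] [InnerProductSpace ℂ H]
    [CompleteSpace H] (T : ℝ → (H →L[ℂ] H)) (hT0 : T 0 = 1)
    (hTadd : ∀ a b, T (a + b) = T a * T b)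
    (hTu : ∀ a, T a ∈ unitary (H →L[ℂ] H))
    (hTc : ∀ φ χ : H, Continuous fun a => (⟪φ, T a χ⟫_ℂ : ℂ))
    (σ : ℝ) (hσ : σ = 1 ∨ σ = -1) (f g : ℂ → H)
    (hfc : ContinuousOn f closedStripHalf) (hfd : DifferentiableOn ℂ f openStripHalf)
    (hgc : ContinuousOn g closedStripHalf) (hgd : DifferentiableOn ℂ g openStripHalf)
    (hfg : ∀ t : ℝ, g t = T (1 - Real.exp (2 * π * σ * t)) (f t)) :
    g (-(Complex.I / 2)) = T 2 (f (-(Complex.I / 2))) := by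
  have hnorm : ∀ a x, ‖T a x‖ = ‖x‖ := fun a x =>
    ContinuousLinearMap.norm_map_of_mem_unitary (hTu a) x
  have hinner : ∀ a x y, (⟪T a x, T a y⟫_ℂ : ℂ) = ⟪x, y⟫_ℂ := fun a x y =>
    ContinuousLinearMap.inner_map_map_of_mem_unitary (hTu a) x y
  have hstrong : ∀ x, Continuous fun a => T a x := by
    intro x
    rw [continuous_iff_continuousAt]
    intro a₀
    rw [ContinuousAt, tendsto_iff_norm_sub_tendsto_zero]
    have h1 : ∀ a, ‖T a x - T a₀ x‖ = Real.sqrt (2 * ‖x‖^2 - 2 * (⟪T a₀ x, T a x⟫_ℂ : ℂ).re) := by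
      intro a
      rw [← Real.sqrt_sq (norm_nonneg (T a x - T a₀ x)), norm_sub_sq (𝕜 := ℂ), hnorm, hnorm,
        inner_re_symm]
      congr 1
      simp only [RCLike.re_to_complex]
      ring
    simp_rw [h1]
    have h2 : Continuous fun a => Real.sqrt (2 * ‖x‖^2 - 2 * (⟪T a₀ x, T a x⟫_ℂ : ℂ).re) := by
      have := hTc (T a₀ x) x
      fun_prop
    have h3 := h2.tendsto a₀
    rw [← h1 a₀, sub_self, norm_zero] at h3
    exact h3
  set y : H := g (-(Complex.I / 2)) - T 2 (f (-(Complex.I / 2))) with hy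
  suffices hy0 : (⟪T 0 y, y⟫_ℂ : ℂ) = 0 by
    rw [hT0] at hy0
    exact sub_eq_zero.1 (inner_self_eq_zero.1 hy0)
  let L : ℝ → (H →L[ℂ] ℂ) := fun s => innerSL ℂ (T s y)
  have hLc : Continuous L := (innerSL ℂ).continuous.comp (hstrong y)
  have hLb : ∀ s, ‖L s‖ ≤ ‖y‖ := fun s => by
    simp only [L, innerSL_apply_norm, hnorm]; exact le_rfl
  refine gauss_limit (fun s => (⟪T s y, y⟫_ℂ : ℂ))
    ((hstrong y).inner continuous_const) (‖y‖ * ‖y‖) (fun s => ?_) (fun n hn => ?_)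
  · exact (norm_inner_le_norm _ _).trans (by rw [hnorm])
  let Ψ : ℂ → (H →L[ℂ] ℂ) := fun w => ∫ s : ℝ, Complex.exp (-(n:ℂ) * ((s:ℂ) - w)^2) • L s
  have hΨd : Differentiable ℂ Ψ := gauss_differentiable L hLc _ hLb n hn
  have hΨapp : ∀ w x, Ψ w x = ∫ s : ℝ, Complex.exp (-(n:ℂ) * ((s:ℂ) - w)^2) • (⟪T s y, x⟫_ℂ : ℂ) := by
    intro w x
    simp only [Ψ]
    rw [ContinuousLinearMap.integral_apply (gauss_integrable L hLc _ hLb n hn w)]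
    rfl
  have hΨT : ∀ (a : ℝ) x, Ψ 0 (T a x) = Ψ ((-a : ℝ) : ℂ) x := by
    intro a x
    rw [hΨapp, hΨapp, ← MeasureTheory.integral_add_right_eq_self _ a]
    congr 1
    ext s
    have : T (s + a) = T a * T s := by rw [add_comm, hTadd]
    rw [this, mul_apply_eq_comp, hinner]
    congr 3
    push_cast; ring
  let w : ℂ → ℂ := fun z => Complex.exp (2 * π * σ * z) - 1
  have hwd : Differentiable ℂ w := by fun_prop
  have key := strip_zero (fun z => Ψ 0 (g z) - Ψ (w z) (f z))
    (((Ψ 0).continuous.comp_continuousOn hgc).sub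
      (((hΨd.comp hwd).continuous.continuousOn).clm_apply hfc))
    (((Ψ 0).differentiable.comp_differentiableOn hgd).sub
      (((hΨd.comp hwd).differentiableOn).clm_apply hfd)) (fun t => by
        rw [hfg, hΨT, sub_eq_zero]
        congr 2
        simp [w])
  have hw2 : w (-(Complex.I / 2)) = ((-2 : ℝ) : ℂ) := by
    simp only [w]
    have : Complex.exp (2 * π * σ * (-(Complex.I/2))) = -1 := by
      rcases hσ with rfl | rfl
      · rw [show (2 * π * ((1:ℝ):ℂ) * (-(Complex.I/2)) : ℂ) = -(π * Complex.I) by push_cast; ring,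
          Complex.exp_neg, Complex.exp_pi_mul_I]; norm_num
      · rw [show (2 * π * ((-1:ℝ):ℂ) * (-(Complex.I/2)) : ℂ) = (π * Complex.I) by push_cast; ring,
          Complex.exp_pi_mul_I]
    rw [this]; push_cast; norm_num
  simp only [hw2] at key
  rw [← hΨT, ← map_sub, ← hy, hΨapp] at key
  simpa using key

/-- Minkowski metric matrix. -/
def etaM : Matrix (Fin 4) (Fin 4) ℝ := Matrix.diagonal ![1, -1, -1, -1]

lemma mink_eq (x y : Fin 4 → ℝ) : mink x y = x ⬝ᵥ (etaM.mulVec y) := by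
  simp [mink, etaM, dotProduct, Fin.sum_univ_four, Matrix.mulVec_diagonal]; ring

lemma etaM_sq : etaM * etaM = 1 := by
  rw [etaM, Matrix.diagonal_mul_diagonal, ← Matrix.diagonal_one]
  congr 1; ext i; fin_cases i <;> simp

lemma lorentz_iff (Λ : Matrix (Fin 4) (Fin 4) ℝ) :
    (∀ x y, mink (Λ.mulVec x) (Λ.mulVec y) = mink x y) ↔ Λ.transpose * etaM * Λ = etaM := by
  have h : ∀ x y, mink (Λ.mulVec x) (Λ.mulVec y) = x ⬝ᵥ ((Λ.transpose * etaM * Λ).mulVec y) := by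
    intro x y
    rw [mink_eq, ← Matrix.mulVec_mulVec, ← Matrix.mulVec_mulVec, Matrix.mulVec_transpose,
      dotProduct_comm x, ← Matrix.dotProduct_mulVec, dotProduct_comm]
  constructor
  · intro H
    ext i j
    have := H (Pi.single i 1) (Pi.single j 1)
    rw [h, mink_eq] at this
    simpa using this
  · intro H x y
    rw [h, H, mink_eq]

lemma lorentz_inv_left {Λ : Matrix (Fin 4) (Fin 4) ℝ} (h : Λ ∈ LorentzPO) :
    (etaM * Λ.transpose * etaM) * Λ = 1 := by
  rw [Matrix.mul_assoc, Matrix.mul_assoc, ← Matrix.mul_assoc Λ.transpose,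
    (lorentz_iff Λ).1 h.1, etaM_sq]

lemma lorentz_inv {Λ : Matrix (Fin 4) (Fin 4) ℝ} (h : Λ ∈ LorentzPO) :
    Λ⁻¹ = etaM * Λ.transpose * etaM := Matrix.inv_eq_left_inv (lorentz_inv_left h)

lemma lorentz_mul_inv {Λ : Matrix (Fin 4) (Fin 4) ℝ} (h : Λ ∈ LorentzPO) : Λ * Λ⁻¹ = 1 :=
  Matrix.mul_nonsing_inv _ (by rw [h.2.1]; exact isUnit_one)

lemma lorentz_inv_mul {Λ : Matrix (Fin 4) (Fin 4) ℝ} (h : Λ ∈ LorentzPO) : Λ⁻¹ * Λ = 1 :=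
  Matrix.nonsing_inv_mul _ (by rw [h.2.1]; exact isUnit_one)

lemma lorentz_inv_mem {Λ : Matrix (Fin 4) (Fin 4) ℝ} (h : Λ ∈ LorentzPO) : Λ⁻¹ ∈ LorentzPO := by
  refine ⟨fun x y => ?_, ?_, ?_⟩
  · rw [← h.1, Matrix.mulVec_mulVec, Matrix.mulVec_mulVec, lorentz_mul_inv h]; simp
  · rw [Matrix.det_nonsing_inv, h.2.1]; simp
  · rw [lorentz_inv h]
    have := h.2.2
    simpa [etaM, Matrix.mul_diagonal, Matrix.diagonal_mul] using this

lemma lorentz_col {Λ : Matrix (Fin 4) (Fin 4) ℝ} (h : Λ ∈ LorentzPO) :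
    Λ 0 0 ^ 2 = 1 + Λ 1 0 ^ 2 + Λ 2 0 ^ 2 + Λ 3 0 ^ 2 := by
  have := h.1 (Pi.single 0 1) (Pi.single 0 1)
  simp [mink] at this
  linarith

lemma lorentz_row {Λ : Matrix (Fin 4) (Fin 4) ℝ} (h : Λ ∈ LorentzPO) :
    Λ 0 0 ^ 2 = 1 + Λ 0 1 ^ 2 + Λ 0 2 ^ 2 + Λ 0 3 ^ 2 := by
  have := lorentz_col (lorentz_inv_mem h)
  rw [lorentz_inv h] at this
  simpa [etaM, Matrix.mul_diagonal, Matrix.diagonal_mul] using this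

lemma lorentz_mul_mem {A B : Matrix (Fin 4) (Fin 4) ℝ} (hA : A ∈ LorentzPO) (hB : B ∈ LorentzPO) :
    A * B ∈ LorentzPO := by
  refine ⟨fun x y => ?_, ?_, ?_⟩
  · rw [← Matrix.mulVec_mulVec, ← Matrix.mulVec_mulVec, hA.1, hB.1]
  · rw [Matrix.det_mul, hA.2.1, hB.2.1, one_mul]
  · have h1 := lorentz_row hA
    have h2 := lorentz_col hB
    have ha := hA.2.2
    have hb := hB.2.2
    rw [Matrix.mul_apply, Fin.sum_univ_four]
    set a := A 0 0
    set b := B 0 0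
    set p := A 0 1 * B 1 0 + A 0 2 * B 2 0 + A 0 3 * B 3 0 with hp
    have hcs : p^2 ≤ (a^2 - 1) * (b^2 - 1) := by
      rw [h1, h2, hp]
      nlinarith [sq_nonneg (A 0 1 * B 2 0 - A 0 2 * B 1 0), sq_nonneg (A 0 1 * B 3 0 - A 0 3 * B 1 0),
        sq_nonneg (A 0 2 * B 3 0 - A 0 3 * B 2 0)]
    have ha1 : 1 ≤ a^2 := by rw [h1]; nlinarith [sq_nonneg (A 0 1), sq_nonneg (A 0 2), sq_nonneg (A 0 3)]
    have hb1 : 1 ≤ b^2 := by rw [h2]; nlinarith [sq_nonneg (B 1 0), sq_nonneg (B 2 0), sq_nonneg (B 3 0)]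
    have hlt : p^2 < (a*b)^2 := by nlinarith
    have := (abs_lt_of_sq_lt_sq' hlt (by positivity)).1
    linarith

lemma one_mem_lorentz : (1 : Matrix (Fin 4) (Fin 4) ℝ) ∈ LorentzPO := by
  refine ⟨fun x y => by simp, by simp, by simp⟩

lemma rotPi_mem : rotPi ∈ LorentzPO := by
  refine ⟨fun x y => ?_, ?_, ?_⟩
  · simp [rotPi, mink, Matrix.mulVec_diagonal]
  · simp [rotPi, Matrix.det_diagonal, Fin.prod_univ_four]
  · simp [rotPi]

lemma boost_eq (t : ℝ) : boost t = !![Real.cosh (2*π*t), -Real.sinh (2*π*t), 0, 0;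
    -Real.sinh (2*π*t), Real.cosh (2*π*t), 0, 0; 0, 0, 1, 0; 0, 0, 0, 1] := by
  ext i j
  fin_cases i <;> fin_cases j <;> simp [boost]

lemma rotPi_eq : rotPi = !![1,0,0,0;0,1,0,0;0,0,-1,0;0,0,0,-1] := by
  ext i j
  fin_cases i <;> fin_cases j <;> simp [rotPi]

lemma boost_mem (t : ℝ) : boost t ∈ LorentzPO := by
  have h := Real.cosh_sq (2*π*t)
  rw [boost_eq]
  refine ⟨fun x y => ?_, ?_, ?_⟩
  · simp [mink, Matrix.mulVec, dotProduct, Fin.sum_univ_four]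
    linear_combination (x 0 * y 0 - x 1 * y 1) * h
  · simp [Matrix.det_succ_row_zero, Fin.sum_univ_succ, Fin.succAbove]
    linear_combination h
  · simpa using Real.cosh_pos _

/-- Null rotation fixing `(1,ε,0,0)`. -/
def nullRot (e c d : ℝ) : Matrix (Fin 4) (Fin 4) ℝ :=
  !![1 + (c^2+d^2)/2, -e*(c^2+d^2)/2, c, d;
     e*(c^2+d^2)/2, 1 - (c^2+d^2)/2, e*c, e*d;
     c, -e*c, 1, 0;
     d, -e*d, 0, 1]

lemma nullRot_mem (e c d : ℝ) (he : e = 1 ∨ e = -1) : nullRot e c d ∈ LorentzPO := by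
  refine ⟨fun x y => ?_, ?_, ?_⟩
  · rcases he with rfl | rfl <;>
    · simp [nullRot, mink, Matrix.mulVec, dotProduct, Fin.sum_univ_four]
      ring
  · rcases he with rfl | rfl <;>
    · simp [nullRot, Matrix.det_succ_row_zero, Fin.sum_univ_succ, Fin.succAbove]
      ring
  · simp [nullRot]; positivity

lemma nullRot_mul (e c d c' d' : ℝ) (he : e = 1 ∨ e = -1) :
    nullRot e c d * nullRot e c' d' = nullRot e (c + c') (d + d') := by
  rcases he with rfl | rfl <;>
  · ext i j
    fin_cases i <;> fin_cases j <;> simp [nullRot, Matrix.mul_apply, Fin.sum_univ_four] <;> ring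

lemma nullRot_zero (e : ℝ) : nullRot e 0 0 = 1 := by
  ext i j
  fin_cases i <;> fin_cases j <;> simp [nullRot]

lemma nullRot_inv (e c d : ℝ) (he : e = 1 ∨ e = -1) : (nullRot e c d)⁻¹ = nullRot e (-c) (-d) := by
  apply Matrix.inv_eq_left_inv
  rw [nullRot_mul _ _ _ _ _ he]; simp [nullRot_zero]

lemma nullRot_rotPi (e c d : ℝ) : nullRot e c d * rotPi = rotPi * nullRot e (-c) (-d) := by
  rw [rotPi_eq]
  ext i j
  fin_cases i <;> fin_cases j <;> simp [nullRot, Matrix.mul_apply, Fin.sum_univ_four]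

lemma boost_nullRot (e c d t : ℝ) (he : e = 1 ∨ e = -1) :
    boost t * nullRot e c d =
      nullRot e (Real.exp (2*π*(-e)*t) * c) (Real.exp (2*π*(-e)*t) * d) * boost t := by
  rw [boost_eq]
  have h1 : Real.exp (2*π*(-e)*t) = Real.cosh (2*π*t) - e * Real.sinh (2*π*t) := by
    rcases he with rfl | rfl
    · rw [one_mul, Real.cosh_sub_sinh]; congr 1; ring
    · rw [show Real.cosh (2*π*t) - -1 * Real.sinh (2*π*t) = Real.cosh (2*π*t) + Real.sinh (2*π*t) by ring,
        Real.cosh_add_sinh]; congr 1; ring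
  have h := Real.cosh_sq (2*π*t)
  rw [h1]
  set C := Real.cosh (2*π*t)
  set S := Real.sinh (2*π*t)
  have h' : C^2 = S^2 + 1 := h
  rcases he with rfl | rfl <;>
  · ext i j
    fin_cases i <;> fin_cases j <;> simp [nullRot, Matrix.mul_apply, Fin.sum_univ_four] <;>
      first
      | ring1
      | linear_combination (-(c^2+d^2)/2*(C - S)) * h'
      | linear_combination ((c^2+d^2)/2*(C - S)) * h'
      | linear_combination (-(c^2+d^2)/2*(C + S)) * h'
      | linear_combination ((c^2+d^2)/2*(C + S)) * h'
      | linear_combination c * h'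
      | linear_combination -c * h'
      | linear_combination d * h'
      | linear_combination -d * h'

lemma nullRot_fix (e c d : ℝ) (he : e = 1 ∨ e = -1) :
    (nullRot e c d).mulVec ![1, e, 0, 0] = ![1, e, 0, 0] := by
  rcases he with rfl | rfl <;>
  · ext i
    fin_cases i <;> simp [nullRot, Matrix.mulVec, dotProduct, Fin.sum_univ_four] <;> ring

lemma nullRot_vec (e : ℝ) (he : e = 1 ∨ e = -1) (p : Fin 4 → ℝ) (hp : mink p p = 0) (s : ℝ)
    (hs : s = p 0 - e * p 1) (hs0 : s ≠ 0) :
    (nullRot e (p 2 / s) (p 3 / s)).mulVec ![1, -e, 0, 0] = (2 / s) • p := by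
  have h : (p 2)^2 + (p 3)^2 = s * (p 0 + e * p 1) := by
    simp only [mink] at hp
    rw [hs]
    rcases he with rfl | rfl <;> linear_combination -hp
  have hq : (p 2 / s)^2 + (p 3 / s)^2 = (p 0 + e * p 1) / s := by
    field_simp
    linear_combination h
  have h1 : nullRot e (p 2 / s) (p 3 / s) = !![1 + ((p 0 + e * p 1) / s)/2, -e*((p 0 + e * p 1) / s)/2, p 2 / s, p 3 / s;
     e*((p 0 + e * p 1) / s)/2, 1 - ((p 0 + e * p 1) / s)/2, e*(p 2 / s), e*(p 3 / s);
     p 2 / s, -e*(p 2 / s), 1, 0;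
     p 3 / s, -e*(p 3 / s), 0, 1] := by
    rw [nullRot, hq]
  rw [h1]
  rcases he with rfl | rfl <;>
  · ext i
    fin_cases i <;> simp [Matrix.mulVec, dotProduct, Fin.sum_univ_four] <;> field_simp <;>
      first
      | ring1
      | (rw [hs]; ring1)

lemma stab_entries {S : Matrix (Fin 4) (Fin 4) ℝ} (hS : S ∈ LorentzPO) (α β : ℝ)
    (h1 : S.mulVec ![1, 1, 0, 0] = α • ![1, 1, 0, 0])
    (h2 : S.mulVec ![1, -1, 0, 0] = β • ![1, -1, 0, 0]) :
    (∀ t, S * boost t = boost t * S) ∧ S * rotPi = rotPi * S := by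
  have hp := hS.1 ![1, 1, 0, 0] ![1, -1, 0, 0]
  have hp2 := hS.1 (Pi.single 2 1) ![1, 1, 0, 0]
  have hp3 := hS.1 (Pi.single 3 1) ![1, 1, 0, 0]
  have hm2 := hS.1 (Pi.single 2 1) ![1, -1, 0, 0]
  have hm3 := hS.1 (Pi.single 3 1) ![1, -1, 0, 0]
  rw [h1] at hp2 hp3
  rw [h2] at hm2 hm3
  rw [h1, h2] at hp
  simp [mink] at hp hp2 hp3 hm2 hm3
  have hα : α ≠ 0 := by rintro rfl; norm_num at hp
  have hβ : β ≠ 0 := by rintro rfl; norm_num at hp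
  have a0 := congrFun h1 0
  have a1 := congrFun h1 1
  have a2 := congrFun h1 2
  have a3 := congrFun h1 3
  have b0 := congrFun h2 0
  have b1 := congrFun h2 1
  have b2 := congrFun h2 2
  have b3 := congrFun h2 3
  simp [Matrix.mulVec, dotProduct, Fin.sum_univ_four] at a0 a1 a2 a3 b0 b1 b2 b3
  have e02 : S 0 2 - S 1 2 = 0 := by
    apply mul_right_cancel₀ hα; linarith
  have e03 : S 0 3 - S 1 3 = 0 := by
    apply mul_right_cancel₀ hα; linarith
  have f02 : S 0 2 + S 1 2 = 0 := by
    apply mul_right_cancel₀ hβ; linarith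
  have f03 : S 0 3 + S 1 3 = 0 := by
    apply mul_right_cancel₀ hβ; linarith
  have z02 : S 0 2 = 0 := by linarith
  have z12 : S 1 2 = 0 := by linarith
  have z03 : S 0 3 = 0 := by linarith
  have z13 : S 1 3 = 0 := by linarith
  have z20 : S 2 0 = 0 := by linarith
  have z21 : S 2 1 = 0 := by linarith
  have z30 : S 3 0 = 0 := by linarith
  have z31 : S 3 1 = 0 := by linarith
  have z11 : S 1 1 = S 0 0 := by linarith
  have z10 : S 1 0 = S 0 1 := by linarith
  constructor
  · intro t
    rw [boost_eq]
    ext i j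
    fin_cases i <;> fin_cases j <;>
      simp [Matrix.mul_apply, Fin.sum_univ_four, z02, z12, z03, z13, z20, z21, z30, z31, z11, z10] <;>
      ring
  · rw [rotPi_eq]
    ext i j
    fin_cases i <;> fin_cases j <;>
      simp [Matrix.mul_apply, Fin.sum_univ_four, z02, z12, z03, z13, z20, z21, z30, z31]

/-- Gauss decomposition of a Lorentz transformation. -/
lemma gauss_decomp {Λ : Matrix (Fin 4) (Fin 4) ℝ} (hΛ : Λ ∈ LorentzPO) (s : ℝ)
    (hs : s = (Λ.mulVec ![1, 1, 0, 0]) 0 + (Λ.mulVec ![1, 1, 0, 0]) 1) (hs0 : s ≠ 0) :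
    ∃ c d c' d' S, S ∈ LorentzPO ∧ (∀ t, S * boost t = boost t * S) ∧ S * rotPi = rotPi * S ∧
      Λ = nullRot (-1) c d * nullRot 1 c' d' * S ∧
      (nullRot (-1) c d).mulVec ![1, 1, 0, 0] = (2 / s) • Λ.mulVec ![1, 1, 0, 0] := by
  set p := Λ.mulVec ![1, 1, 0, 0] with hp
  have hpn : mink p p = 0 := by rw [hp, hΛ.1]; simp [mink]
  have hN1p := nullRot_vec (-1) (Or.inr rfl) p hpn s (by rw [hs]; ring) hs0
  rw [neg_neg] at hN1p
  set N1 := nullRot (-1) (p 2 / s) (p 3 / s) with hN1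
  have hN1m : N1 ∈ LorentzPO := nullRot_mem _ _ _ (Or.inr rfl)
  have hΛ'm : N1⁻¹ * Λ ∈ LorentzPO := lorentz_mul_mem (lorentz_inv_mem hN1m) hΛ
  set Λ' := N1⁻¹ * Λ with hΛ'
  have hΛ'p : Λ'.mulVec ![1, 1, 0, 0] = (s / 2) • ![1, 1, 0, 0] := by
    have h1 : p = (s / 2) • N1.mulVec ![1, 1, 0, 0] := by
      rw [hN1p, smul_smul]; field_simp; simp
    rw [hΛ', ← Matrix.mulVec_mulVec, ← hp, h1, Matrix.mulVec_smul, Matrix.mulVec_mulVec,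
      lorentz_inv_mul hN1m, Matrix.one_mulVec]
  set r := Λ'.mulVec ![1, -1, 0, 0] with hr
  have hrn : mink r r = 0 := by rw [hr, hΛ'm.1]; simp [mink]
  have hrp : s / 2 * (r 0 - 1 * r 1) = 2 := by
    have := hΛ'm.1 ![1, 1, 0, 0] ![1, -1, 0, 0]
    rw [hΛ'p, ← hr] at this
    simp [mink] at this
    linarith
  have hr0 : r 0 - 1 * r 1 ≠ 0 := by
    intro h; rw [h] at hrp; norm_num at hrp
  have hN2r := nullRot_vec 1 (Or.inl rfl) r hrn _ rfl hr0
  set σ := r 0 - 1 * r 1 with hσ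
  have hN2f := nullRot_fix 1 (r 2 / σ) (r 3 / σ) (Or.inl rfl)
  set N2 := nullRot 1 (r 2 / σ) (r 3 / σ) with hN2
  have hN2m : N2 ∈ LorentzPO := nullRot_mem _ _ _ (Or.inl rfl)
  have hSm : N2⁻¹ * Λ' ∈ LorentzPO := lorentz_mul_mem (lorentz_inv_mem hN2m) hΛ'm
  have hS := stab_entries hSm (s / 2) (σ / 2) (by
      rw [← Matrix.mulVec_mulVec, hΛ'p, ← hN2f, Matrix.mulVec_smul, Matrix.mulVec_mulVec,
        lorentz_inv_mul hN2m, Matrix.one_mulVec, hN2f]) (by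
      have h1 : r = (σ / 2) • N2.mulVec ![1, -1, 0, 0] := by
        rw [hN2r, smul_smul]; field_simp; simp
      rw [← Matrix.mulVec_mulVec, ← hr, h1, Matrix.mulVec_smul, Matrix.mulVec_mulVec,
        lorentz_inv_mul hN2m, Matrix.one_mulVec])
  refine ⟨p 2 / s, p 3 / s, r 2 / σ, r 3 / σ, N2⁻¹ * Λ', hSm, hS.1, hS.2, ?_, hN1p⟩
  rw [← hN1, ← hN2, Matrix.mul_assoc, ← Matrix.mul_assoc N2, lorentz_mul_inv hN2m, Matrix.one_mul,
    hΛ', ← Matrix.mul_assoc, lorentz_mul_inv hN1m, Matrix.one_mul]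

/-- Comparison of two wedges sharing a null direction. -/
lemma step_lemma {H : Type*} [NormedAddCommGroup H] [InnerProductSpace ℂ H] [CompleteSpace H]
    (U : Matrix (Fin 4) (Fin 4) ℝ → (H →L[ℂ] H))
    (hU_unitary : ∀ Λ ∈ LorentzPO, U Λ ∈ unitary (H →L[ℂ] H))
    (hU_one : U 1 = 1)
    (hU_mul : ∀ Λ₁ ∈ LorentzPO, ∀ Λ₂ ∈ LorentzPO, U (Λ₁ * Λ₂) = U Λ₁ * U Λ₂)
    (hU_cont : ∀ φ ψ : H, ContinuousOn (fun Λ => (⟪φ, U Λ ψ⟫_ℂ : ℂ)) LorentzPO)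
    (ψ : H) (M S Λ : Matrix (Fin 4) (Fin 4) ℝ) (e c d : ℝ) (he : e = 1 ∨ e = -1)
    (hM : M ∈ LorentzPO) (hS : S ∈ LorentzPO)
    (hSb : ∀ t, S * boost t = boost t * S) (hSr : S * rotPi = rotPi * S)
    (hΛ : Λ = M * nullRot e c d * S) (f g : ℂ → H)
    (hfc : ContinuousOn f closedStripHalf) (hfd : DifferentiableOn ℂ f openStripHalf)
    (hgc : ContinuousOn g closedStripHalf) (hgd : DifferentiableOn ℂ g openStripHalf)
    (hf : ∀ t : ℝ, f t = U (M * boost t * M⁻¹) ψ) (hg : ∀ t : ℝ, g t = U (Λ * boost t * Λ⁻¹) ψ) :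
    U (Λ * rotPi * Λ⁻¹) (g (-(Complex.I / 2))) = U (M * rotPi * M⁻¹) (f (-(Complex.I / 2))) := by
  have hMi := lorentz_inv_mem hM
  have hMM := lorentz_inv_mul hM
  have hN : ∀ a : ℝ, nullRot e (a * c) (a * d) ∈ LorentzPO := fun a => nullRot_mem _ _ _ he
  have hNm : ∀ a : ℝ, M * nullRot e (a * c) (a * d) * M⁻¹ ∈ LorentzPO := fun a =>
    lorentz_mul_mem (lorentz_mul_mem hM (hN a)) hMi
  have hNadd : ∀ a b : ℝ, nullRot e (a * c) (a * d) * nullRot e (b * c) (b * d) =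
      nullRot e ((a + b) * c) ((a + b) * d) := by
    intro a b
    rw [nullRot_mul _ _ _ _ _ he, add_mul, add_mul]
  -- conjugation by `M`
  have hconj : ∀ A B : Matrix (Fin 4) (Fin 4) ℝ,
      (M * A * M⁻¹) * (M * B * M⁻¹) = M * (A * B) * M⁻¹ := by
    intro A B
    calc (M * A * M⁻¹) * (M * B * M⁻¹) = M * A * (M⁻¹ * M) * B * M⁻¹ := by
          simp only [Matrix.mul_assoc]
      _ = _ := by rw [hMM, Matrix.mul_one]; simp only [Matrix.mul_assoc]
  have hΛc : ∀ B : Matrix (Fin 4) (Fin 4) ℝ, S * B = B * S →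
      Λ * B * Λ⁻¹ = M * (nullRot e c d * B * nullRot e (-c) (-d)) * M⁻¹ := by
    intro B hB
    rw [hΛ, Matrix.mul_inv_rev, Matrix.mul_inv_rev, nullRot_inv _ _ _ he]
    calc M * nullRot e c d * S * B * (S⁻¹ * (nullRot e (-c) (-d) * M⁻¹))
        = M * nullRot e c d * (S * B) * S⁻¹ * (nullRot e (-c) (-d) * M⁻¹) := by
          simp only [Matrix.mul_assoc]
      _ = M * nullRot e c d * B * (S * S⁻¹) * (nullRot e (-c) (-d) * M⁻¹) := by
          rw [hB]; simp only [Matrix.mul_assoc]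
      _ = _ := by rw [lorentz_mul_inv hS, Matrix.mul_one]; simp only [Matrix.mul_assoc]
  let T : ℝ → (H →L[ℂ] H) := fun a => U (M * nullRot e (a * c) (a * d) * M⁻¹)
  have key := continuation_lemma T
    (by simp only [T, zero_mul, nullRot_zero, Matrix.mul_one, lorentz_mul_inv hM, hU_one])
    (fun a b => by
      simp only [T]
      rw [← hU_mul _ (hNm a) _ (hNm b), hconj, hNadd])
    (fun a => hU_unitary _ (hNm a))
    (fun φ χ => by
      refine (hU_cont φ χ).comp_continuous ?_ hNm
      have : Continuous fun a : ℝ => nullRot e (a * c) (a * d) := by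
        refine continuous_matrix fun i j => ?_
        fin_cases i <;> fin_cases j <;> simp [nullRot] <;> fun_prop
      exact (continuous_const.matrix_mul this).matrix_mul continuous_const)
    (-e) (by rcases he with rfl | rfl <;> simp) f g hfc hfd hgc hgd
    (fun t => by
      rw [hf, hg, hΛc _ (hSb t), Matrix.mul_assoc (nullRot e c d), boost_nullRot _ _ _ _ he,
        ← Matrix.mul_assoc (nullRot e c d),
        nullRot_mul _ _ _ _ _ he]
      simp only [T]
      rw [← mul_apply_eq_comp, ← hU_mul _ (hNm _) _ (lorentz_mul_mem (lorentz_mul_mem hM (boost_mem t)) hMi),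
        hconj]
      congr 6 <;> ring)
  rw [key, hΛc _ hSr]
  simp only [T]
  rw [← mul_apply_eq_comp, ← hU_mul _ _ _ (hNm _), hconj]
  · congr 3
    rw [nullRot_rotPi, Matrix.mul_assoc, Matrix.mul_assoc, nullRot_mul _ _ _ _ _ he,
      nullRot_mul _ _ _ _ _ he]
    rw [show -c + (-c + 2 * c) = 0 by ring, show -d + (-d + 2 * d) = 0 by ring, nullRot_zero,
      Matrix.mul_one]
  · exact lorentz_mul_mem (lorentz_mul_mem hM (lorentz_mul_mem (lorentz_mul_mem
      (nullRot_mem _ _ _ he) rotPi_mem) (nullRot_mem _ _ _ he))) hMi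

/-- Let `U` be a weakly continuous unitary representation of `𝓛₊↑`
on a complex Hilbert space `H`, `D` a double cone with `cl(D) ⊆ W_r`, and
`Γ = {Λ ∈ 𝓛₊↑ : cl(D) ⊆ Λ W_r}`.  Let `ψ ∈ H` be such that for every `Λ ∈ Γ` there is a
bounded continuous function `F_Λ` on the closed strip `{-1/2 ≤ Im z ≤ 0}`, holomorphic on
the open strip, with `F_Λ(t) = U(Λ Λ_{W_r}(t) Λ⁻¹) ψ` for real `t`.  Then
`U(Λ R_{W_r}(π) Λ⁻¹) F_Λ(−i/2)` is independent of `Λ ∈ Γ`. -/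
theorem analytic_continuation_independent_of_wedge
    {H : Type*} [NormedAddCommGroup H] [InnerProductSpace ℂ H] [CompleteSpace H]
    (U : Matrix (Fin 4) (Fin 4) ℝ → (H →L[ℂ] H))
    (hU_unitary : ∀ Λ ∈ LorentzPO, U Λ ∈ unitary (H →L[ℂ] H))
    (hU_one : U 1 = 1)
    (hU_mul : ∀ Λ₁ ∈ LorentzPO, ∀ Λ₂ ∈ LorentzPO, U (Λ₁ * Λ₂) = U Λ₁ * U Λ₂)
    (hU_cont : ∀ φ ψ : H, ContinuousOn (fun Λ => (⟪φ, U Λ ψ⟫_ℂ : ℂ)) LorentzPO)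
    (D : Set (Fin 4 → ℝ)) (hD : IsDoubleCone D)
    (hDW : closure D ⊆ rightWedge)
    (ψ : H)
    (F : Matrix (Fin 4) (Fin 4) ℝ → ℂ → H)
    (hF : ∀ Λ, Λ ∈ LorentzPO → closure D ⊆ (fun y => Λ.mulVec y) '' rightWedge →
      ContinuousOn (F Λ) closedStripHalf ∧
      (∃ C : ℝ, ∀ z ∈ closedStripHalf, ‖F Λ z‖ ≤ C) ∧
      DifferentiableOn ℂ (F Λ) openStripHalf ∧
      (∀ t : ℝ, F Λ t = U (Λ * boost t * Λ⁻¹) ψ)) :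
    ∀ Λ, Λ ∈ LorentzPO → closure D ⊆ (fun y => Λ.mulVec y) '' rightWedge →
      U (Λ * rotPi * Λ⁻¹) (F Λ (-(Complex.I / 2))) = U rotPi (F 1 (-(Complex.I / 2))) := by
  intro Λ hΛ hΛD
  -- a point of `D`
  obtain ⟨x₀, hx₀⟩ : (closure D).Nonempty := by
    obtain ⟨a, b, hab, rfl⟩ := hD
    refine ⟨(1/2 : ℝ) • (a + b), subset_closure ?_⟩
    obtain ⟨h1, h2⟩ := hab
    simp only [mink, Pi.sub_apply] at h1 h2
    refine ⟨⟨?_, ?_⟩, ⟨?_, ?_⟩⟩ <;> simp [mink] <;> nlinarith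
  set p := Λ.mulVec ![1, 1, 0, 0] with hp
  have hpD : ∀ x ∈ closure D, mink x p < 0 := by
    intro x hx
    obtain ⟨y, hy, rfl⟩ := hΛD hx
    simp only
    rw [hp, hΛ.1]
    have hy' : |y 0| < y 1 := hy
    have := (abs_lt.1 hy').2
    simp [mink]; linarith
  have hpn : mink p p = 0 := by rw [hp, hΛ.1]; simp [mink]
  have hp0 : 0 < p 0 := by
    have h1 := lorentz_row hΛ
    have h2 := hΛ.2.2
    have h3 : p 0 = Λ 0 0 + Λ 0 1 := by
      simp [hp, Matrix.mulVec, dotProduct, Fin.sum_univ_four]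
    have h4 : (Λ 0 1)^2 < (Λ 0 0)^2 := by nlinarith [sq_nonneg (Λ 0 2), sq_nonneg (Λ 0 3)]
    have := (abs_lt_of_sq_lt_sq' h4 h2.le).1
    linarith
  have hs : 0 < p 0 + p 1 := by
    have hpn' : p 0 * p 0 - p 1 * p 1 - p 2 * p 2 - p 3 * p 3 = 0 := hpn
    have h1 : 0 ≤ p 0 + p 1 := by
      have : (p 1)^2 ≤ (p 0)^2 := by nlinarith [sq_nonneg (p 2), sq_nonneg (p 3)]
      have := (abs_le_of_sq_le_sq' this hp0.le).1
      linarith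
    refine lt_of_le_of_ne h1 fun h0 => ?_
    have h2 : p 1 = - p 0 := by linarith
    rw [h2] at hpn'
    have h3 : p 2 = 0 := by nlinarith [sq_nonneg (p 2), sq_nonneg (p 3)]
    have h4 : p 3 = 0 := by nlinarith [sq_nonneg (p 2), sq_nonneg (p 3)]
    have h5 := hpD x₀ hx₀
    have h6 : |x₀ 0| < x₀ 1 := hDW hx₀
    have h7 := (abs_lt.1 h6).1
    simp only [mink, h2, h3, h4] at h5
    nlinarith
  obtain ⟨c, d, c', d', S, hSm, hSb, hSr, hdec, hN1⟩ := gauss_decomp hΛ _ rfl hs.ne'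
  have hNm : nullRot (-1) c d ∈ LorentzPO := nullRot_mem _ _ _ (Or.inr rfl)
  have hND : closure D ⊆ (fun y => (nullRot (-1) c d).mulVec y) '' rightWedge := by
    intro x hx
    have hxy : (nullRot (-1) c d).mulVec ((nullRot (-1) c d)⁻¹.mulVec x) = x := by
      rw [Matrix.mulVec_mulVec, lorentz_mul_inv hNm, Matrix.one_mulVec]
    refine ⟨(nullRot (-1) c d)⁻¹.mulVec x, ?_, hxy⟩
    set y := (nullRot (-1) c d)⁻¹.mulVec x with hy
    have h1 : mink y ![1, 1, 0, 0] < 0 := by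
      rw [← hNm.1, hxy, hN1]
      have h2 := hpD x hx
      have h3 : mink x ((2 / (p 0 + p 1)) • p) = (2 / (p 0 + p 1)) * mink x p := by
        simp [mink]; ring
      rw [h3]
      exact mul_neg_of_pos_of_neg (by positivity) h2
    have h2 : 0 < mink y ![1, -1, 0, 0] := by
      rw [← hNm.1, hxy, nullRot_fix _ _ _ (Or.inr rfl)]
      have h6 : |x 0| < x 1 := hDW hx
      have h7 := (abs_lt.1 h6).1
      simp [mink]; linarith
    simp [mink] at h1 h2
    have h3 : |y 0| < y 1 := abs_lt.2 ⟨by linarith, by linarith⟩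
    exact h3
  have h1D : closure D ⊆ (fun y => (1 : Matrix (Fin 4) (Fin 4) ℝ).mulVec y) '' rightWedge := by
    intro x hx
    exact ⟨x, hDW hx, by simp⟩
  obtain ⟨f1, -, f3, f4⟩ := hF 1 one_mem_lorentz h1D
  obtain ⟨n1, -, n3, n4⟩ := hF _ hNm hND
  obtain ⟨g1, -, g3, g4⟩ := hF Λ hΛ hΛD
  have s1 := step_lemma U hU_unitary hU_one hU_mul hU_cont ψ 1 1 (nullRot (-1) c d) (-1) c d
    (Or.inr rfl) one_mem_lorentz one_mem_lorentz (by simp) (by simp) (by simp)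
    (F 1) (F (nullRot (-1) c d)) f1 f3 n1 n3 f4 n4
  have s2 := step_lemma U hU_unitary hU_one hU_mul hU_cont ψ (nullRot (-1) c d) S Λ 1 c' d'
    (Or.inl rfl) hNm hSm hSb hSr hdec (F (nullRot (-1) c d)) (F Λ) n1 n3 g1 g3 n4 g4
  rw [s2, s1]
  simp
end
end

section
/- Every element of the proper orthochronous Lorentz group 𝓛₊↑ is a finite product of matrices of the form g Λ_{W_r}(t) g⁻¹ with g ∈ 𝓛₊↑ and t ∈ ℝ; in other words, the subgroup of 𝓛₊↑ generated by the boost groups of all wedges with edge through the origin is all of 𝓛₊↑. -/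
noncomputable section

open Real

open Matrix

/-- The set of generators. -/
def Gens : Set (Matrix (Fin 4) (Fin 4) ℝ) :=
  {M : Matrix (Fin 4) (Fin 4) ℝ | ∃ g ∈ LorentzPO, ∃ t : ℝ, M = g * boost t * g⁻¹}

/-- Proper Lorentz transformations (no orthochronicity). -/
def IsL (M : Matrix (Fin 4) (Fin 4) ℝ) : Prop :=
  (∀ x y, mink (M.mulVec x) (M.mulVec y) = mink x y) ∧ M.det = 1

lemma IsL.mul {A B : Matrix (Fin 4) (Fin 4) ℝ} (hA : IsL A) (hB : IsL B) : IsL (A * B) := by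
  refine ⟨fun x y => ?_, by rw [det_mul, hA.2, hB.2, one_mul]⟩
  rw [← mulVec_mulVec, ← mulVec_mulVec, hA.1, hB.1]

lemma mul4 (A B : Matrix (Fin 4) (Fin 4) ℝ) (i j : Fin 4) :
    (A * B) i j = A i 0 * B 0 j + A i 1 * B 1 j + A i 2 * B 2 j + A i 3 * B 3 j := by
  rw [Matrix.mul_apply, Fin.sum_univ_four]

lemma mulVec4 (A : Matrix (Fin 4) (Fin 4) ℝ) (x : Fin 4 → ℝ) (i : Fin 4) :
    (A.mulVec x) i = A i 0 * x 0 + A i 1 * x 1 + A i 2 * x 2 + A i 3 * x 3 := by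
  simp [Matrix.mulVec, dotProduct, Fin.sum_univ_four]

/-- Boost matrix with algebraic parameters. -/
def Bm (c s : ℝ) : Matrix (Fin 4) (Fin 4) ℝ :=
  !![c, -s, 0, 0; -s, c, 0, 0; 0, 0, 1, 0; 0, 0, 0, 1]
/-- Null rotation. -/
def Um (a : ℝ) : Matrix (Fin 4) (Fin 4) ℝ :=
  !![1 + a^2/2, -(a^2/2), a, 0; a^2/2, 1 - a^2/2, a, 0; a, -a, 1, 0; 0, 0, 0, 1]
/-- Opposite null rotation. -/
def Lm (b : ℝ) : Matrix (Fin 4) (Fin 4) ℝ :=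
  !![1 + b^2/2, b^2/2, b, 0; -(b^2/2), 1 - b^2/2, -b, 0; b, b, 1, 0; 0, 0, 0, 1]
/-- Rotation in the plane 1,2. -/
def R12 (c s : ℝ) : Matrix (Fin 4) (Fin 4) ℝ :=
  !![1, 0, 0, 0; 0, c, -s, 0; 0, s, c, 0; 0, 0, 0, 1]
/-- Rotation in the plane 2,3. -/
def R23 (c s : ℝ) : Matrix (Fin 4) (Fin 4) ℝ :=
  !![1, 0, 0, 0; 0, 1, 0, 0; 0, 0, c, -s; 0, 0, s, c]
/-- Cyclic permutation of the space axes. -/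
def Pm : Matrix (Fin 4) (Fin 4) ℝ :=
  !![1, 0, 0, 0; 0, 0, 0, 1; 0, 1, 0, 0; 0, 0, 1, 0]
/-- Rotation by a half turn. -/
def Qm : Matrix (Fin 4) (Fin 4) ℝ :=
  !![1, 0, 0, 0; 0, -1, 0, 0; 0, 0, 1, 0; 0, 0, 0, -1]

lemma isL_Bm {c s : ℝ} (h : c^2 - s^2 = 1) : IsL (Bm c s) := by
  refine ⟨fun x y => ?_, ?_⟩
  · simp only [mink, mulVec4]
    simp [Bm]
    linear_combination (x 0 * y 0 - x 1 * y 1) * h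
  · simp [Bm, det_succ_row_zero, Fin.sum_univ_succ, Fin.succAbove]
    linear_combination h

lemma isL_Um (a : ℝ) : IsL (Um a) := by
  refine ⟨fun x y => ?_, ?_⟩
  · simp only [mink, mulVec4]
    simp [Um]
    ring
  · simp [Um, det_succ_row_zero, Fin.sum_univ_succ, Fin.succAbove]
    ring

lemma isL_R12 {c s : ℝ} (h : c^2 + s^2 = 1) : IsL (R12 c s) := by
  refine ⟨fun x y => ?_, ?_⟩
  · simp only [mink, mulVec4]
    simp [R12]
    linear_combination -(x 1 * y 1 + x 2 * y 2) * h
  · simp [R12, det_succ_row_zero, Fin.sum_univ_succ, Fin.succAbove]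
    linear_combination h

lemma isL_R23 {c s : ℝ} (h : c^2 + s^2 = 1) : IsL (R23 c s) := by
  refine ⟨fun x y => ?_, ?_⟩
  · simp only [mink, mulVec4]
    simp [R23]
    linear_combination -(x 3 * y 3 + x 2 * y 2) * h
  · simp [R23, det_succ_row_zero, Fin.sum_univ_succ, Fin.succAbove]
    linear_combination h

/-- Lorentz transformations fixing the time coordinate. -/
def Good_s13 (P : Matrix (Fin 4) (Fin 4) ℝ) : Prop :=
  IsL P ∧ ∀ M : Matrix (Fin 4) (Fin 4) ℝ, (P * M) 0 0 = M 0 0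

lemma good_one : Good_s13 1 := ⟨⟨by simp, by simp⟩, by simp⟩

lemma good_Pm : Good_s13 Pm := by
  refine ⟨⟨fun x y => ?_, ?_⟩, fun M => ?_⟩
  · simp only [mink, mulVec4]
    simp [Pm]
    ring
  · simp [Pm, det_succ_row_zero, Fin.sum_univ_succ, Fin.succAbove]
  · simp [mul4, Pm]

lemma good_Qm : Good_s13 Qm := by
  refine ⟨⟨fun x y => ?_, ?_⟩, fun M => ?_⟩
  · simp only [mink, mulVec4]
    simp [Qm]
  · simp [Qm, det_succ_row_zero, Fin.sum_univ_succ, Fin.succAbove]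
  · simp [mul4, Qm]

lemma Good_s13.mul {A B : Matrix (Fin 4) (Fin 4) ℝ} (hA : Good_s13 A) (hB : Good_s13 B) : Good_s13 (A * B) :=
  ⟨hA.1.mul hB.1, fun M => by rw [Matrix.mul_assoc, hA.2, hB.2]⟩

lemma boost_eq_s13 {c s : ℝ} (h : c^2 - s^2 = 1) (hc : 0 < c) : ∃ t, boost t = Bm c s := by
  refine ⟨Real.arsinh s / (2 * π), ?_⟩
  have e : 2 * π * (Real.arsinh s / (2 * π)) = Real.arsinh s := by
    field_simp
  have e2 : Real.cosh (Real.arsinh s) = c := by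
    rw [Real.cosh_arsinh, show 1 + s^2 = c^2 by linarith, Real.sqrt_sq hc.le]
  ext i j
  simp only [boost, e, e2, Real.sinh_arsinh]
  fin_cases i <;> fin_cases j <;> simp [Bm]

lemma gen_mem {g : Matrix (Fin 4) (Fin 4) ℝ} (hg : IsL g) (h0 : 0 < g 0 0) {c s : ℝ}
    (h : c^2 - s^2 = 1) (hc : 0 < c) : g * Bm c s * g⁻¹ ∈ Submonoid.closure Gens := by
  obtain ⟨t, ht⟩ := boost_eq_s13 h hc
  exact Submonoid.subset_closure ⟨g, ⟨hg.1, hg.2, h0⟩, t, by rw [ht]⟩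

lemma Um_inv (a : ℝ) : (Um a)⁻¹ = Um (-a) := by
  apply Matrix.inv_eq_right_inv
  ext i j
  rw [mul4]
  fin_cases i <;> fin_cases j <;> simp [Um] <;> ring

lemma IsL.inv_mul {P : Matrix (Fin 4) (Fin 4) ℝ} (h : IsL P) : P⁻¹ * P = 1 :=
  Matrix.nonsing_inv_mul P (by rw [h.2]; exact isUnit_one)

lemma conjMat_mul {P : Matrix (Fin 4) (Fin 4) ℝ} (h : IsL P) (A B : Matrix (Fin 4) (Fin 4) ℝ) :
    P * (A * B) * P⁻¹ = (P * A * P⁻¹) * (P * B * P⁻¹) := by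
  simp only [Matrix.mul_assoc]
  rw [← Matrix.mul_assoc P⁻¹ P, h.inv_mul, Matrix.one_mul]

lemma Um_mem {P : Matrix (Fin 4) (Fin 4) ℝ} (hP : Good_s13 P) (a : ℝ) :
    P * Um a * P⁻¹ ∈ Submonoid.closure Gens := by
  have key : Um a = Bm (5/4) (-3/4) * (Um a * Bm (5/4) (3/4) * (Um a)⁻¹) := by
    rw [Um_inv]
    ext i j
    simp only [mul4]
    fin_cases i <;> fin_cases j <;> simp [Um, Bm] <;> ring
  have e : P * Um a * P⁻¹ = (P * Bm (5/4) (-3/4) * P⁻¹) *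
      ((P * Um a) * Bm (5/4) (3/4) * (P * Um a)⁻¹) := by
    conv_lhs => rw [key]
    rw [conjMat_mul hP.1, Matrix.mul_inv_rev]
    simp only [Matrix.mul_assoc]
  rw [e]
  refine Submonoid.mul_mem _ (gen_mem hP.1 ?_ (by norm_num) (by norm_num))
    (gen_mem (hP.1.mul (isL_Um a)) ?_ (by norm_num) (by norm_num))
  · have := hP.2 1
    rw [Matrix.mul_one] at this
    rw [this]; simp
  · rw [hP.2]; simp [Um]; positivity

lemma Lm_mem {P : Matrix (Fin 4) (Fin 4) ℝ} (hP : Good_s13 P) (a : ℝ) :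
    P * Lm a * P⁻¹ ∈ Submonoid.closure Gens := by
  have hQ : Qm⁻¹ = Qm := by
    apply Matrix.inv_eq_right_inv
    ext i j
    rw [mul4]
    fin_cases i <;> fin_cases j <;> simp [Qm]
  have e : Lm a = Qm * Um a * Qm⁻¹ := by
    rw [hQ]
    ext i j
    simp only [mul4]
    fin_cases i <;> fin_cases j <;> simp [Qm, Um, Lm]
  have := Um_mem (hP.mul good_Qm) a
  rw [Matrix.mul_inv_rev] at this
  rw [e]
  simpa only [Matrix.mul_assoc] using this

lemma half_angle {c s : ℝ} (h : c^2 + s^2 = 1) :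
    ∃ p q : ℝ, 0 ≤ p ∧ p^2 + q^2 = 1 ∧ c = p^2 - q^2 ∧ s = 2 * p * q := by
  by_cases hc : c = -1
  · subst hc
    have : s = 0 := by nlinarith
    exact ⟨0, 1, le_rfl, by norm_num, by norm_num, by simp [this]⟩
  · have h1 : 0 < 1 + c := by
      have : -1 ≤ c := by nlinarith
      have := lt_of_le_of_ne this (Ne.symm hc)
      linarith
    set p := Real.sqrt ((1 + c)/2) with hp
    have hp0 : 0 < p := Real.sqrt_pos.2 (by linarith)
    have hp2 : p^2 = (1 + c)/2 := Real.sq_sqrt (by linarith)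
    have hq2 : (s / (2 * p))^2 = (1 - c)/2 := by
      rw [div_pow, mul_pow, hp2]
      field_simp
      nlinarith
    refine ⟨p, s / (2 * p), hp0.le, ?_, ?_, ?_⟩
    · rw [hp2, hq2]; ring
    · rw [hp2, hq2]; ring
    · field_simp

lemma R12_conj_mem {P : Matrix (Fin 4) (Fin 4) ℝ} (hP : Good_s13 P) {c s : ℝ} (h : c^2 + s^2 = 1) :
    P * R12 c s * P⁻¹ ∈ Submonoid.closure Gens := by
  obtain ⟨p, q, hp, h1, rfl, rfl⟩ := half_angle h
  have hp1 : 1 + p ≠ 0 := by positivity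
  obtain ⟨a, ha⟩ : ∃ a, a = q / (1 + p) := ⟨_, rfl⟩
  have hq : q = a * (1 + p) := by rw [ha]; field_simp
  have hp' : p * (1 + a^2) = 1 - a^2 := by
    subst hq
    have : (1 + p) * (p * (1 + a^2) - (1 - a^2)) = 0 := by linear_combination h1
    have := (mul_eq_zero.1 this).resolve_left hp1
    linarith
  have ha2 : 1 + a^2 ≠ 0 := by positivity
  have hpa : p = (1 - a^2) / (1 + a^2) := by field_simp; linarith
  have hqa : q = 2 * a / (1 + a^2) := by rw [hq, hpa]; field_simp; ring
  have key : R12 (p^2 - q^2) (2 * p * q) = Um (-a) * (Lm q * Um (-a)) := by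
    rw [hpa, hqa]
    ext i j
    simp only [mul4]
    fin_cases i <;> fin_cases j <;> simp [Um, Lm, R12] <;> field_simp <;> ring
  rw [key, conjMat_mul hP.1, conjMat_mul hP.1]
  exact Submonoid.mul_mem _ (Um_mem hP _) (Submonoid.mul_mem _ (Lm_mem hP _) (Um_mem hP _))

lemma R12_mem {c s : ℝ} (h : c^2 + s^2 = 1) : R12 c s ∈ Submonoid.closure Gens := by
  simpa using R12_conj_mem good_one h

lemma R23_mem {c s : ℝ} (h : c^2 + s^2 = 1) : R23 c s ∈ Submonoid.closure Gens := by
  have hP : Pm⁻¹ = Pmᵀ := by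
    apply Matrix.inv_eq_right_inv
    ext i j
    rw [mul4]
    fin_cases i <;> fin_cases j <;> simp [Pm]
  have := R12_conj_mem good_Pm h
  convert this using 1
  rw [hP]
  ext i j
  simp only [mul4]
  fin_cases i <;> fin_cases j <;> simp [Pm, R12, R23]

lemma Bm_mem {c s : ℝ} (h : c^2 - s^2 = 1) (hc : 0 < c) : Bm c s ∈ Submonoid.closure Gens := by
  simpa using gen_mem good_one.1 (by simp) h hc

lemma red {X Y M : Matrix (Fin 4) (Fin 4) ℝ} (hYX : Y * X = 1) (hY : Y ∈ Submonoid.closure Gens)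
    (h : X * M ∈ Submonoid.closure Gens) : M ∈ Submonoid.closure Gens := by
  have := Submonoid.mul_mem _ hY h
  rwa [← Matrix.mul_assoc, hYX, Matrix.one_mul] at this

lemma red12 {M : Matrix (Fin 4) (Fin 4) ℝ} {c s : ℝ} (h : c^2 + s^2 = 1)
    (hm : R12 c s * M ∈ Submonoid.closure Gens) : M ∈ Submonoid.closure Gens := by
  refine red (Y := R12 c (-s)) ?_ (R12_mem (by linarith)) hm
  ext i j
  rw [mul4]
  fin_cases i <;> fin_cases j <;> simp [R12] <;> linarith

lemma red23 {M : Matrix (Fin 4) (Fin 4) ℝ} {c s : ℝ} (h : c^2 + s^2 = 1)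
    (hm : R23 c s * M ∈ Submonoid.closure Gens) : M ∈ Submonoid.closure Gens := by
  refine red (Y := R23 c (-s)) ?_ (R23_mem (by linarith)) hm
  ext i j
  rw [mul4]
  fin_cases i <;> fin_cases j <;> simp [R23] <;> linarith

lemma redB {M : Matrix (Fin 4) (Fin 4) ℝ} {c s : ℝ} (h : c^2 - s^2 = 1) (hc : 0 < c)
    (hm : Bm c s * M ∈ Submonoid.closure Gens) : M ∈ Submonoid.closure Gens := by
  refine red (Y := Bm c (-s)) ?_ (Bm_mem (by linarith) hc) hm
  ext i j
  rw [mul4]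
  fin_cases i <;> fin_cases j <;> simp [Bm] <;> linarith

lemma givens (x y : ℝ) : ∃ c s : ℝ, c^2 + s^2 = 1 ∧ 0 ≤ c * x - s * y ∧ s * x + c * y = 0 := by
  by_cases h : x^2 + y^2 = 0
  · have hx : x = 0 := by nlinarith [sq_nonneg x, sq_nonneg y]
    have hy : y = 0 := by nlinarith [sq_nonneg x, sq_nonneg y]
    exact ⟨1, 0, by norm_num, by simp [hx], by simp [hy]⟩
  · have hpos : 0 < x^2 + y^2 := lt_of_le_of_ne (by positivity) (Ne.symm h)
    obtain ⟨r, hr⟩ : ∃ r, r = Real.sqrt (x^2 + y^2) := ⟨_, rfl⟩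
    have hr0 : 0 < r := hr ▸ Real.sqrt_pos.2 hpos
    have hr2 : r^2 = x^2 + y^2 := hr ▸ Real.sq_sqrt hpos.le
    refine ⟨x / r, -y / r, ?_, ?_, ?_⟩
    · field_simp; linarith
    · have : x / r * x - -y / r * y = (x^2 + y^2) / r := by field_simp; ring
      rw [this]; positivity
    · field_simp; ring

lemma IsL.col {M : Matrix (Fin 4) (Fin 4) ℝ} (h : IsL M) (i j : Fin 4) :
    M 0 i * M 0 j - M 1 i * M 1 j - M 2 i * M 2 j - M 3 i * M 3 j
      = mink (Pi.single i 1) (Pi.single j 1) := by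
  have := h.1 (Pi.single i 1) (Pi.single j 1)
  rw [← this]
  simp [mink]

lemma step5 {M : Matrix (Fin 4) (Fin 4) ℝ} (h : IsL M) (h00 : M 0 0 = 1) (h10 : M 1 0 = 0)
    (h20 : M 2 0 = 0) (h30 : M 3 0 = 0) (h11 : 0 ≤ M 1 1) (h21 : M 2 1 = 0) (h31 : M 3 1 = 0) :
    M ∈ Submonoid.closure Gens := by
  have c01 := h.col 0 1
  have c02 := h.col 0 2
  have c03 := h.col 0 3
  have c11 := h.col 1 1
  have c12 := h.col 1 2
  have c13 := h.col 1 3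
  have c22 := h.col 2 2
  have c33 := h.col 3 3
  have c23 := h.col 2 3
  have hd := h.2
  simp [mink, h00, h10, h20, h30, h21, h31] at c01 c02 c03 c11 c12 c13 c22 c33 c23
  simp [c01] at c11
  have e11 : M 1 1 = 1 := by nlinarith
  simp [c01, c02, c03, e11] at c12 c13 c22 c33 c23
  simp [c12, c13] at c22 c33 c23
  simp [det_succ_row_zero, Fin.sum_univ_succ, Fin.succAbove, h00, h10, h20, h30, h21, h31,
    c01, c02, c03, e11, c12, c13] at hd
  have n22 : M 2 2 * M 2 2 + M 3 2 * M 3 2 = 1 := by linarith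
  have n23 : M 2 2 * M 2 3 + M 3 2 * M 3 3 = 0 := by linarith
  have nd : M 2 2 * M 3 3 - M 2 3 * M 3 2 = 1 := by linarith
  have e33 : M 3 3 = M 2 2 := by
    linear_combination -M 3 3 * n22 + M 2 2 * nd + M 3 2 * n23
  have e23 : M 2 3 = - M 3 2 := by
    linear_combination -M 2 3 * n22 + M 2 2 * n23 - M 3 2 * nd
  have : M = R23 (M 2 2) (M 3 2) := by
    ext i j
    fin_cases i <;> fin_cases j <;> simp [R23, *]
  rw [this]
  exact R23_mem (by linarith)

lemma step4 {M : Matrix (Fin 4) (Fin 4) ℝ} (h : IsL M) (h00 : M 0 0 = 1) (h10 : M 1 0 = 0)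
    (h20 : M 2 0 = 0) (h30 : M 3 0 = 0) (h31 : M 3 1 = 0) :
    M ∈ Submonoid.closure Gens := by
  obtain ⟨c, s, hcs, h1, h2⟩ := givens (M 1 1) (M 2 1)
  refine red12 hcs (step5 ((isL_R12 hcs).mul h) ?_ ?_ ?_ ?_ ?_ ?_ ?_) <;>
    rw [mul4] <;> simp [R12, *] <;> linarith

lemma step3 {M : Matrix (Fin 4) (Fin 4) ℝ} (h : IsL M) (h00 : M 0 0 = 1) (h10 : M 1 0 = 0)
    (h20 : M 2 0 = 0) (h30 : M 3 0 = 0) :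
    M ∈ Submonoid.closure Gens := by
  obtain ⟨c, s, hcs, h1, h2⟩ := givens (M 2 1) (M 3 1)
  refine red23 hcs (step4 ((isL_R23 hcs).mul h) ?_ ?_ ?_ ?_ ?_) <;>
    rw [mul4] <;> simp [R23, *]

lemma step2 {M : Matrix (Fin 4) (Fin 4) ℝ} (h : IsL M) (h00 : 0 < M 0 0)
    (h20 : M 2 0 = 0) (h30 : M 3 0 = 0) :
    M ∈ Submonoid.closure Gens := by
  have hc := h.col 0 0
  simp [mink, h20, h30] at hc
  have hcs : (M 0 0)^2 - (M 1 0)^2 = 1 := by linarith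
  refine redB hcs h00 (step3 ((isL_Bm hcs).mul h) ?_ ?_ ?_ ?_) <;>
    rw [mul4] <;> simp [Bm, *] <;> linarith

lemma step1 {M : Matrix (Fin 4) (Fin 4) ℝ} (h : IsL M) (h00 : 0 < M 0 0)
    (h30 : M 3 0 = 0) :
    M ∈ Submonoid.closure Gens := by
  obtain ⟨c, s, hcs, h1, h2⟩ := givens (M 1 0) (M 2 0)
  refine red12 hcs (step2 ((isL_R12 hcs).mul h) ?_ ?_ ?_) <;>
    rw [mul4] <;> simp [R12, *]

lemma step0 {M : Matrix (Fin 4) (Fin 4) ℝ} (h : IsL M) (h00 : 0 < M 0 0) :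
    M ∈ Submonoid.closure Gens := by
  obtain ⟨c, s, hcs, h1, h2⟩ := givens (M 2 0) (M 3 0)
  refine red23 hcs (step1 ((isL_R23 hcs).mul h) ?_ ?_) <;>
    rw [mul4] <;> simp [R23, *]

/-- Every element of the proper orthochronous Lorentz group is a
finite product of conjugated boosts `g Λ_{W_r}(t) g⁻¹` with `g ∈ 𝓛₊↑` and `t ∈ ℝ`:
the boost groups of all wedges with edge through the origin generate `𝓛₊↑`. -/
theorem lorentz_generated_by_wedge_boosts
    (Λ : Matrix (Fin 4) (Fin 4) ℝ) (hΛ : Λ ∈ LorentzPO) :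
    Λ ∈ Submonoid.closure
      {M : Matrix (Fin 4) (Fin 4) ℝ | ∃ g ∈ LorentzPO, ∃ t : ℝ, M = g * boost t * g⁻¹} := by
  exact step0 ⟨hΛ.1, hΛ.2.1⟩ hΛ.2.2
end
end
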